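/- arXiv:2105.13969 — 16 statements merged into one kernel-verified Lean document; each statement's English description precedes it below -/
import Mathlib

section
/- Let L be a Leibniz algebra over a field F. Then for every natural number n, the subspace L^n·L is contained in L·L^n, where L^k denotes the k-th term of the lower central series. -/
/-!
STATEMENT 0: Let `L` be a Leibniz algebra over a field `F`.  Then for every
natural number `n`, the subspace `L^n·L` is contained in `L·L^n`, where `L^k`
denotes the `k`-th term of the lower central series.
-/

namespace Stmt0

variable {F L : Type*} [Field F] [AddCommGroup L] [Module F L]

/-- For subspaces `S`, `T` of an algebra with bilinear multiplication `mul`,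
`pSub mul S T` is the subspace spanned by all products `s·t` with `s ∈ S`, `t ∈ T`. -/
def pSub (mul : L →ₗ[F] L →ₗ[F] L) (S T : Submodule F L) : Submodule F L :=
  Submodule.span F {z | ∃ s ∈ S, ∃ t ∈ T, z = mul s t}

/-- The lower central series: `L^0 = L`, `L^{k+1} = L·L^k`. -/
def lcs (mul : L →ₗ[F] L →ₗ[F] L) : ℕ → Submodule F L
  | 0 => ⊤
  | k + 1 => pSub mul ⊤ (lcs mul k)

theorem mul_mem_lcs (mul : L →ₗ[F] L →ₗ[F] L) {n : ℕ} (x : L) {y : L} (hy : y ∈ lcs mul n) :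
    mul x y ∈ lcs mul (n + 1) :=
  Submodule.subset_span ⟨x, Submodule.mem_top, y, hy, rfl⟩

/-- In a Leibniz algebra, `L^m·L^n ⊆ L^{m+n+1}`. -/
theorem mul_lcs_mem_lcs_add (mul : L →ₗ[F] L →ₗ[F] L)
    (hleib : ∀ x y z : L, mul x (mul y z) = mul (mul x y) z + mul y (mul x z))
    (m : ℕ) {n : ℕ} {s t : L} (hs : s ∈ lcs mul m) (ht : t ∈ lcs mul n) :
    mul s t ∈ lcs mul (m + n + 1) := by
  induction m generalizing n s t with
  | zero => simpa using mul_mem_lcs mul s ht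
  | succ m ih =>
    suffices h : lcs mul (m + 1) ≤ (lcs mul (m + 1 + n + 1)).comap (mul.flip t) from h hs
    refine Submodule.span_le.mpr ?_
    rintro _ ⟨x, -, y, hy, rfl⟩
    change mul (mul x y) t ∈ lcs mul (m + 1 + n + 1)
    rw [eq_sub_of_add_eq (hleib x y t).symm, Nat.add_right_comm m 1 n]
    have hxt : mul y (mul x t) ∈ lcs mul (m + (n + 1) + 1) := ih hy (mul_mem_lcs mul x ht)
    exact sub_mem (mul_mem_lcs mul x (ih hy ht)) hxt

/-- In a Leibniz algebra `L`, `L^n·L ⊆ L·L^n` for all `n`. -/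
theorem lcs_mul_le_mul_lcs (mul : L →ₗ[F] L →ₗ[F] L)
    (hleib : ∀ x y z : L, mul x (mul y z) = mul (mul x y) z + mul y (mul x z))
    (n : ℕ) :
    pSub mul (lcs mul n) ⊤ ≤ pSub mul ⊤ (lcs mul n) := by
  refine Submodule.span_le.mpr ?_
  rintro _ ⟨s, hs, t, -, rfl⟩
  exact mul_lcs_mem_lcs_add mul hleib n (n := 0) hs Submodule.mem_top

end Stmt0
end

section
/- Let A and B be Leibniz algebras with B nilpotent of class s, and let 0 → A --σ--> L --π--> B → 0 be an extension of A by B. Define subspaces A_k of A by A_0 = A and A_{k+1} = σ⁻¹(σ(A_k)·L + L·σ(A_k)). Then L^{k+s} ⊆ σ(A_k) ⊆ L^k for all k ≥ 0. Consequently, L is nilpotent if and only if A_k = 0 for some k. -/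
/-!
STATEMENT 1: Let `A` and `B` be Leibniz algebras with `B` nilpotent of class `s`,
and let `0 → A --σ--> L --π--> B → 0` be an extension of `A` by `B`.  Define
subspaces `A_k` of `A` by `A_0 = A` and `A_{k+1} = σ⁻¹(σ(A_k)·L + L·σ(A_k))`.
Then `L^{k+s} ⊆ σ(A_k) ⊆ L^k` for all `k ≥ 0`.  Consequently, `L` is nilpotent
if and only if `A_k = 0` for some `k`.
-/

namespace Stmt1

/-- Subspace spanned by all products `s·t` with `s ∈ S`, `t ∈ T`. -/
def pSub {F L : Type*} [Field F] [AddCommGroup L] [Module F L]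
    (mul : L →ₗ[F] L →ₗ[F] L) (S T : Submodule F L) : Submodule F L :=
  Submodule.span F {z | ∃ s ∈ S, ∃ t ∈ T, z = mul s t}

/-- The lower central series: `L^0 = L`, `L^{k+1} = L·L^k`. -/
def lcs {F L : Type*} [Field F] [AddCommGroup L] [Module F L]
    (mul : L →ₗ[F] L →ₗ[F] L) : ℕ → Submodule F L
  | 0 => ⊤
  | k + 1 => pSub mul ⊤ (lcs mul k)

section

variable {F L B : Type*} [Field F] [AddCommGroup L] [Module F L] [AddCommGroup B] [Module F B]

theorem mul_mem_pSub (mul : L →ₗ[F] L →ₗ[F] L) {S T : Submodule F L} {s t : L}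
    (hs : s ∈ S) (ht : t ∈ T) : mul s t ∈ pSub mul S T :=
  Submodule.subset_span ⟨s, hs, t, ht, rfl⟩

theorem pSub_le {mul : L →ₗ[F] L →ₗ[F] L} {S T U : Submodule F L}
    (h : ∀ s ∈ S, ∀ t ∈ T, mul s t ∈ U) : pSub mul S T ≤ U := by
  refine Submodule.span_le.2 ?_
  rintro _ ⟨s, hs, t, ht, rfl⟩
  exact h s hs t ht

/-- In a left Leibniz algebra, `L^i · L^j ⊆ L^{i+j+1}`. -/
theorem pSub_lcs_le {mul : L →ₗ[F] L →ₗ[F] L}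
    (hL : ∀ x y z : L, mul x (mul y z) = mul (mul x y) z + mul y (mul x z)) (i j : ℕ) :
    pSub mul (lcs mul i) (lcs mul j) ≤ lcs mul (i + j + 1) := by
  induction i generalizing j with
  | zero => rw [Nat.zero_add]; exact le_rfl
  | succ i ih =>
    refine pSub_le fun w hw z hz => ?_
    suffices h : lcs mul (i + 1) ≤ (lcs mul (i + 1 + j + 1)).comap (mul.flip z) from h hw
    refine pSub_le fun x _ y hy => ?_
    have h₁ : mul x (mul y z) ∈ lcs mul (i + j + 1 + 1) :=
      mul_mem_pSub mul Submodule.mem_top (ih j (mul_mem_pSub mul hy hz))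
    have h₂ : mul y (mul x z) ∈ lcs mul (i + (j + 1) + 1) :=
      ih (j + 1) (mul_mem_pSub mul hy (mul_mem_pSub mul Submodule.mem_top hz))
    rw [Submodule.mem_comap, LinearMap.flip_apply, ← add_sub_cancel_right (mul (mul x y) z),
      ← hL x y z, Nat.add_right_comm i 1 j]
    exact Submodule.sub_mem _ h₁ h₂

/-- A homomorphism maps the lower central series into the lower central series. -/
theorem lcs_le_comap {mulL : L →ₗ[F] L →ₗ[F] L} {mulB : B →ₗ[F] B →ₗ[F] B} (π : L →ₗ[F] B)
    (hπ : ∀ x y, π (mulL x y) = mulB (π x) (π y)) (k : ℕ) :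
    lcs mulL k ≤ (lcs mulB k).comap π := by
  induction k with
  | zero => exact fun _ _ => Submodule.mem_top
  | succ k ih =>
    refine pSub_le fun x _ y hy => ?_
    rw [Submodule.mem_comap, hπ]
    exact mul_mem_pSub mulB Submodule.mem_top (ih hy)

end

theorem prop_2_1 {F A L B : Type*} [Field F]
    [AddCommGroup A] [Module F A] [AddCommGroup L] [Module F L]
    [AddCommGroup B] [Module F B]
    (mulA : A →ₗ[F] A →ₗ[F] A) (mulL : L →ₗ[F] L →ₗ[F] L) (mulB : B →ₗ[F] B →ₗ[F] B)
    -- the three algebras are Leibniz algebras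
    (hA : ∀ x y z : A, mulA x (mulA y z) = mulA (mulA x y) z + mulA y (mulA x z))
    (hL : ∀ x y z : L, mulL x (mulL y z) = mulL (mulL x y) z + mulL y (mulL x z))
    (hB : ∀ x y z : B, mulB x (mulB y z) = mulB (mulB x y) z + mulB y (mulB x z))
    -- `0 → A --σ--> L --π--> B → 0` is an extension of `A` by `B`
    (σ : A →ₗ[F] L) (π : L →ₗ[F] B)
    (hσmul : ∀ x y, σ (mulA x y) = mulL (σ x) (σ y))
    (hπmul : ∀ x y, π (mulL x y) = mulB (π x) (π y))
    (hσinj : Function.Injective σ) (hπsurj : Function.Surjective π)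
    (hexact : LinearMap.range σ = LinearMap.ker π)
    -- `B` is nilpotent of class `s`
    (s : ℕ) (hBnil : lcs mulB s = ⊥) (hBclass : ∀ m < s, lcs mulB m ≠ ⊥)
    -- the sequence `A_0 = A`, `A_{k+1} = σ⁻¹(σ(A_k)·L + L·σ(A_k))`
    (Aseq : ℕ → Submodule F A) (hA0 : Aseq 0 = ⊤)
    (hAsucc : ∀ k, Aseq (k + 1) =
      Submodule.comap σ
        (pSub mulL (Submodule.map σ (Aseq k)) ⊤ ⊔
          pSub mulL ⊤ (Submodule.map σ (Aseq k)))) :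
    (∀ k, lcs mulL (k + s) ≤ Submodule.map σ (Aseq k) ∧
      Submodule.map σ (Aseq k) ≤ lcs mulL k) ∧
    ((∃ u, lcs mulL u = ⊥) ↔ ∃ k, Aseq k = ⊥) := by
  have lower : ∀ k, lcs mulL (k + s) ≤ Submodule.map σ (Aseq k) := by
    intro k
    induction k with
    | zero =>
      rw [Nat.zero_add, hA0, Submodule.map_top, hexact, ← Submodule.comap_bot, ← hBnil]
      exact lcs_le_comap π hπmul s
    | succ k ih =>
      rw [Nat.add_right_comm, hAsucc, Submodule.map_comap_eq]
      refine pSub_le fun x hx y hy => ⟨?_, ?_⟩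
      · obtain ⟨a, -, rfl⟩ := ih hy
        have ha : π (σ a) = 0 := LinearMap.mem_ker.1 (hexact ▸ LinearMap.mem_range_self σ a)
        rw [hexact, SetLike.mem_coe, LinearMap.mem_ker, hπmul, ha, map_zero]
      · exact Submodule.mem_sup_right (mul_mem_pSub mulL hx (ih hy))
  have upper : ∀ k, Submodule.map σ (Aseq k) ≤ lcs mulL k := by
    intro k
    induction k with
    | zero => exact fun _ _ => Submodule.mem_top
    | succ k ih =>
      rw [hAsucc]
      refine (Submodule.map_comap_le _ _).trans (sup_le ?_ ?_)
      · exact pSub_le fun x hx y hy => pSub_lcs_le hL k 0 (mul_mem_pSub mulL (ih hx) hy)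
      · exact pSub_le fun x hx y hy => mul_mem_pSub mulL hx (ih hy)
  refine ⟨fun k => ⟨lower k, upper k⟩, ?_, ?_⟩
  · rintro ⟨u, hu⟩
    refine ⟨u, Submodule.map_injective_of_injective hσinj ?_⟩
    rw [Submodule.map_bot, ← le_bot_iff, ← hu]
    exact upper u
  · rintro ⟨k, hk⟩
    refine ⟨k + s, le_bot_iff.1 ((lower k).trans ?_)⟩
    rw [hk, Submodule.map_bot]

end Stmt1
end

section
/- Let A and B be Leibniz algebras, let (φ,φ') and (ψ,ψ') be pairs of maps B → End(A) that are lifts of the same pair, i.e., for each i ∈ B there exist m_i, m_i' ∈ A such that ψ(i)a = φ(i)a + m_i·a and ψ'(i)a = φ'(i)a + a·m_i' for all a ∈ A, and let N be an ideal of A which is both (φ,φ')-invariant and (ψ,ψ')-invariant. Then G(N,φ,φ') = G(N,ψ,ψ'). -/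
/-!
STATEMENT 3: Let `A` and `B` be Leibniz algebras, let `(φ,φ')` and `(ψ,ψ')` be
pairs of maps `B → End(A)` that are lifts of the same pair, and let `N` be an
ideal of `A` which is both `(φ,φ')`-invariant and `(ψ,ψ')`-invariant.  Then
`G(N,φ,φ') = G(N,ψ,ψ')`, where `G(N,φ,φ')` is the smallest `(φ,φ')`-invariant
ideal of `A` containing `A·N`, `N·A`, and all elements `φ(i)n`, `φ'(i)n`.
-/

namespace Stmt3

/-- `G(N,φ,φ')`: the smallest `(φ,φ')`-invariant ideal of `A` containing `A·N`,
`N·A`, and all elements `φ(i)n` and `φ'(i)n` for `i ∈ B`, `n ∈ N`. -/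
def Gideal {F A B : Type*} [Field F] [AddCommGroup A] [Module F A]
    (mulA : A →ₗ[F] A →ₗ[F] A) (φ φ' : B → Module.End F A)
    (N : Submodule F A) : Submodule F A :=
  sInf {P : Submodule F A |
    (∀ a n : A, n ∈ P → mulA a n ∈ P ∧ mulA n a ∈ P) ∧
    (∀ i : B, ∀ n ∈ P, φ i n ∈ P ∧ φ' i n ∈ P) ∧
    (∀ a n : A, n ∈ N → mulA a n ∈ P ∧ mulA n a ∈ P) ∧
    (∀ i : B, ∀ n ∈ N, φ i n ∈ P ∧ φ' i n ∈ P)}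

/-- A submodule absorbing products with elements of `N` absorbs the values of `φ` and `φ'` on `N`
if and only if it absorbs those of any other lift. -/
theorem forall_lift_mem_iff {F A B : Type*} [Field F] [AddCommGroup A] [Module F A]
    {mulA : A →ₗ[F] A →ₗ[F] A} {φ φ' ψ ψ' : B → Module.End F A}
    (hlift : ∀ i : B, ∃ m m' : A, ∀ a : A,
      ψ i a = φ i a + mulA m a ∧ ψ' i a = φ' i a + mulA a m')
    {N P : Submodule F A} (h : ∀ a n : A, n ∈ N → mulA a n ∈ P ∧ mulA n a ∈ P) :
    (∀ i : B, ∀ n ∈ N, φ i n ∈ P ∧ φ' i n ∈ P) ↔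
      ∀ i : B, ∀ n ∈ N, ψ i n ∈ P ∧ ψ' i n ∈ P := by
  refine forall₃_congr fun i n hn => ?_
  obtain ⟨m, m', hm⟩ := hlift i
  rw [(hm n).1, (hm n).2, P.add_mem_iff_left (h m n hn).1, P.add_mem_iff_left (h m' n hn).2]

theorem Gideal_eq_Gideal {F A B : Type*} [Field F]
    [AddCommGroup A] [Module F A] [AddCommGroup B] [Module F B]
    (mulA : A →ₗ[F] A →ₗ[F] A) (mulB : B →ₗ[F] B →ₗ[F] B)
    -- `A` and `B` are Leibniz algebras
    (hA : ∀ x y z : A, mulA x (mulA y z) = mulA (mulA x y) z + mulA y (mulA x z))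
    (hB : ∀ x y z : B, mulB x (mulB y z) = mulB (mulB x y) z + mulB y (mulB x z))
    -- the pairs of maps and the lift condition
    (φ φ' ψ ψ' : B → Module.End F A)
    (hlift : ∀ i : B, ∃ m m' : A, ∀ a : A,
      ψ i a = φ i a + mulA m a ∧ ψ' i a = φ' i a + mulA a m')
    -- `N` is an ideal of `A`, invariant under both pairs
    (N : Submodule F A)
    (hN : ∀ a n : A, n ∈ N → mulA a n ∈ N ∧ mulA n a ∈ N)
    (hNφ : ∀ i : B, ∀ n ∈ N, φ i n ∈ N ∧ φ' i n ∈ N)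
    (hNψ : ∀ i : B, ∀ n ∈ N, ψ i n ∈ N ∧ ψ' i n ∈ N) :
    Gideal mulA φ φ' N = Gideal mulA ψ ψ' N := by
  unfold Gideal
  congr 1
  ext P
  exact and_congr_right fun hP => and_congr (forall_lift_mem_iff hlift hP)
    (and_congr_right fun hNP => forall_lift_mem_iff hlift hNP)

end Stmt3
end

section
/- Let A and B be Leibniz algebras, let 0 → A --σ--> L --π--> B → 0 be an extension with section T : B → L, and let φ, φ' : B → End(A) be defined by φ(i)m = σ⁻¹(T(i)·σ(m)) and φ'(i)m = σ⁻¹(σ(m)·T(i)). Define A_0 = A, A_{k+1} = σ⁻¹(σ(A_k)·L + L·σ(A_k)), and define G_0^B A = A, G_{k+1}^B A = G(G_k^B A, φ, φ'). Then A_k = G_k^B A for all k ≥ 0. -/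
/-!
STATEMENT 4: Let `A` and `B` be Leibniz algebras, let `0 → A --σ--> L --π--> B → 0`
be an extension with section `T : B → L`, and let `φ, φ' : B → End(A)` be defined
by `φ(i)m = σ⁻¹(T(i)·σ(m))` and `φ'(i)m = σ⁻¹(σ(m)·T(i))`.  Define `A_0 = A`,
`A_{k+1} = σ⁻¹(σ(A_k)·L + L·σ(A_k))`, and define `G_0^B A = A`,
`G_{k+1}^B A = G(G_k^B A, φ, φ')`.  Then `A_k = G_k^B A` for all `k ≥ 0`.
-/

namespace Stmt4

/-- Subspace spanned by all products `s·t` with `s ∈ S`, `t ∈ T`. -/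
def pSub {F L : Type*} [Field F] [AddCommGroup L] [Module F L]
    (mul : L →ₗ[F] L →ₗ[F] L) (S T : Submodule F L) : Submodule F L :=
  Submodule.span F {z | ∃ s ∈ S, ∃ t ∈ T, z = mul s t}

/-- `G(N,φ,φ')`: the smallest `(φ,φ')`-invariant ideal of `A` containing `A·N`,
`N·A`, and all elements `φ(i)n` and `φ'(i)n` for `i ∈ B`, `n ∈ N`. -/
def Gideal {F A B : Type*} [Field F] [AddCommGroup A] [Module F A]
    (mulA : A →ₗ[F] A →ₗ[F] A) (φ φ' : B → Module.End F A)
    (N : Submodule F A) : Submodule F A :=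
  sInf {P : Submodule F A |
    (∀ a n : A, n ∈ P → mulA a n ∈ P ∧ mulA n a ∈ P) ∧
    (∀ i : B, ∀ n ∈ P, φ i n ∈ P ∧ φ' i n ∈ P) ∧
    (∀ a n : A, n ∈ N → mulA a n ∈ P ∧ mulA n a ∈ P) ∧
    (∀ i : B, ∀ n ∈ N, φ i n ∈ P ∧ φ' i n ∈ P)}

/-- A submodule is a two-sided ideal for the multiplication `mul`. -/
def IsTwoSided {F L : Type*} [Field F] [AddCommGroup L] [Module F L]
    (mul : L →ₗ[F] L →ₗ[F] L) (I : Submodule F L) : Prop :=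
  ∀ n ∈ I, ∀ l, mul n l ∈ I ∧ mul l n ∈ I

section

variable {F L : Type*} [Field F] [AddCommGroup L] [Module F L] {mul : L →ₗ[F] L →ₗ[F] L}

theorem pSub_sup_pSub_le_iff {I J : Submodule F L} :
    pSub mul I ⊤ ⊔ pSub mul ⊤ I ≤ J ↔ ∀ n ∈ I, ∀ l, mul n l ∈ J ∧ mul l n ∈ J := by
  simp only [pSub, sup_le_iff, Submodule.span_le]
  constructor
  · rintro ⟨h₁, h₂⟩ n hn l
    exact ⟨h₁ ⟨n, hn, l, trivial, rfl⟩, h₂ ⟨l, trivial, n, hn, rfl⟩⟩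
  · intro h
    constructor
    · rintro _ ⟨n, hn, l, -, rfl⟩
      exact (h n hn l).1
    · rintro _ ⟨l, -, n, hn, rfl⟩
      exact (h n hn l).2

theorem IsTwoSided.pSub_sup_pSub_le {I : Submodule F L} (hI : IsTwoSided mul I) :
    pSub mul I ⊤ ⊔ pSub mul ⊤ I ≤ I :=
  pSub_sup_pSub_le_iff.2 hI

theorem IsTwoSided.pSub_sup_pSub {I : Submodule F L} (hI : IsTwoSided mul I) :
    IsTwoSided mul (pSub mul I ⊤ ⊔ pSub mul ⊤ I) :=
  fun n hn => pSub_sup_pSub_le_iff.1 le_rfl n (hI.pSub_sup_pSub_le hn)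

theorem isTwoSided_ker {B : Type*} [AddCommGroup B] [Module F B]
    {mulB : B →ₗ[F] B →ₗ[F] B} {π : L →ₗ[F] B}
    (hπmul : ∀ x y, π (mul x y) = mulB (π x) (π y)) :
    IsTwoSided mul (LinearMap.ker π) := by
  intro n hn l
  simp_all

/-- Passing to `G(N,φ,φ')` corresponds to passing from `σ(N)` to `σ(N)·L + L·σ(N)`,
when `σ(N)` is an ideal of `L`. -/
theorem comap_pSub_sup_pSub_eq_Gideal {A B : Type*}
    [AddCommGroup A] [Module F A] [AddCommGroup B] [Module F B]
    {mulA : A →ₗ[F] A →ₗ[F] A} {σ : A →ₗ[F] L} {π : L →ₗ[F] B}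
    (hσmul : ∀ x y, σ (mulA x y) = mul (σ x) (σ y))
    (hσinj : Function.Injective σ) (hexact : LinearMap.range σ = LinearMap.ker π)
    {T : B →ₗ[F] L} (hT : ∀ b, π (T b) = b) {φ φ' : B → Module.End F A}
    (hφ : ∀ i m, σ (φ i m) = mul (T i) (σ m))
    (hφ' : ∀ i m, σ (φ' i m) = mul (σ m) (T i))
    {N : Submodule F A} (hN : IsTwoSided mul (N.map σ)) :
    (pSub mul (N.map σ) ⊤ ⊔ pSub mul ⊤ (N.map σ)).comap σ = Gideal mulA φ φ' N := by
  apply le_antisymm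
  · refine le_sInf fun P hP => ?_
    obtain ⟨-, -, hmul, hact⟩ := hP
    rw [← Submodule.comap_map_eq_of_injective hσinj P]
    refine Submodule.comap_mono (pSub_sup_pSub_le_iff.2 ?_)
    rintro _ ⟨n, hn, rfl⟩ l
    obtain ⟨a, ha⟩ : l - T (π l) ∈ LinearMap.range σ := by
      rw [hexact, LinearMap.mem_ker, map_sub, hT, sub_self]
    obtain ⟨b, rfl⟩ : ∃ b, l = σ a + T b := ⟨π l, by rw [ha, sub_add_cancel]⟩
    rw [map_add, map_add, LinearMap.add_apply, ← hσmul, ← hσmul, ← hφ, ← hφ',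
      ← map_add, ← map_add]
    exact ⟨Submodule.mem_map_of_mem (add_mem (hmul a n hn).2 (hact _ n hn).2),
      Submodule.mem_map_of_mem (add_mem (hmul a n hn).1 (hact _ n hn).1)⟩
  · have key := pSub_sup_pSub_le_iff.1 (le_refl (pSub mul (N.map σ) ⊤ ⊔ pSub mul ⊤ (N.map σ)))
    refine sInf_le ⟨fun a n hn => ?_, fun i n hn => ?_, fun a n hn => ?_, fun i n hn => ?_⟩ <;>
      simp only [Submodule.mem_comap, hσmul, hφ, hφ']
    · exact (hN.pSub_sup_pSub _ hn _).symm
    · exact (hN.pSub_sup_pSub _ hn _).symm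
    · exact (key _ (Submodule.mem_map_of_mem hn) _).symm
    · exact (key _ (Submodule.mem_map_of_mem hn) _).symm

end

theorem thm_3_1 {F A L B : Type*} [Field F]
    [AddCommGroup A] [Module F A] [AddCommGroup L] [Module F L]
    [AddCommGroup B] [Module F B]
    (mulA : A →ₗ[F] A →ₗ[F] A) (mulL : L →ₗ[F] L →ₗ[F] L) (mulB : B →ₗ[F] B →ₗ[F] B)
    -- the three algebras are Leibniz algebras
    (hA : ∀ x y z : A, mulA x (mulA y z) = mulA (mulA x y) z + mulA y (mulA x z))
    (hL : ∀ x y z : L, mulL x (mulL y z) = mulL (mulL x y) z + mulL y (mulL x z))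
    (hB : ∀ x y z : B, mulB x (mulB y z) = mulB (mulB x y) z + mulB y (mulB x z))
    -- `0 → A --σ--> L --π--> B → 0` is an extension of `A` by `B`
    (σ : A →ₗ[F] L) (π : L →ₗ[F] B)
    (hσmul : ∀ x y, σ (mulA x y) = mulL (σ x) (σ y))
    (hπmul : ∀ x y, π (mulL x y) = mulB (π x) (π y))
    (hσinj : Function.Injective σ) (hπsurj : Function.Surjective π)
    (hexact : LinearMap.range σ = LinearMap.ker π)
    -- `T` is a section of the extension
    (T : B →ₗ[F] L) (hT : ∀ b, π (T b) = b)
    -- `φ(i)m = σ⁻¹(T(i)·σ(m))` and `φ'(i)m = σ⁻¹(σ(m)·T(i))`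
    (φ φ' : B → Module.End F A)
    (hφ : ∀ i m, σ (φ i m) = mulL (T i) (σ m))
    (hφ' : ∀ i m, σ (φ' i m) = mulL (σ m) (T i))
    -- the sequence `A_0 = A`, `A_{k+1} = σ⁻¹(σ(A_k)·L + L·σ(A_k))`
    (Aseq : ℕ → Submodule F A) (hA0 : Aseq 0 = ⊤)
    (hAsucc : ∀ k, Aseq (k + 1) =
      Submodule.comap σ
        (pSub mulL (Submodule.map σ (Aseq k)) ⊤ ⊔
          pSub mulL ⊤ (Submodule.map σ (Aseq k))))
    -- the sequence `G_0^B A = A`, `G_{k+1}^B A = G(G_k^B A, φ, φ')`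
    (Gseq : ℕ → Submodule F A) (hG0 : Gseq 0 = ⊤)
    (hGsucc : ∀ k, Gseq (k + 1) = Gideal mulA φ φ' (Gseq k)) :
    ∀ k, Aseq k = Gseq k := by
  have isTwoSided_map : ∀ k, IsTwoSided mulL ((Aseq k).map σ) := by
    intro k
    induction k with
    | zero =>
      rw [hA0, Submodule.map_top, hexact]
      exact isTwoSided_ker hπmul
    | succ k ih =>
      rw [hAsucc, Submodule.map_comap_eq_of_le (ih.pSub_sup_pSub_le.trans LinearMap.map_le_range)]
      exact ih.pSub_sup_pSub
  intro k
  induction k with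
  | zero => rw [hA0, hG0]
  | succ k ih =>
    rw [hAsucc, hGsucc, ← ih]
    exact comap_pSub_sup_pSub_eq_Gideal hσmul hσinj hexact hT hφ hφ' (isTwoSided_map k)

end Stmt4
end

section
/- Let A and B be nilpotent Leibniz algebras, let 0 → A --σ--> L --π--> B → 0 be an extension with section T : B → L, and let φ, φ' : B → End(A) be defined by φ(i)m = σ⁻¹(T(i)·σ(m)) and φ'(i)m = σ⁻¹(σ(m)·T(i)). Define G_0^B A = A and G_{k+1}^B A = G(G_k^B A, φ, φ'). Then L is nilpotent if and only if B is nilpotent and G_u^B A = 0 for some u ≥ 1. -/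
/-!
STATEMENT 5: Let `A` and `B` be nilpotent Leibniz algebras, let
`0 → A --σ--> L --π--> B → 0` be an extension with section `T : B → L`, and let
`φ, φ' : B → End(A)` be defined by `φ(i)m = σ⁻¹(T(i)·σ(m))` and
`φ'(i)m = σ⁻¹(σ(m)·T(i))`.  Define `G_0^B A = A` and
`G_{k+1}^B A = G(G_k^B A, φ, φ')`.  Then `L` is nilpotent if and only if `B` is
nilpotent and `G_u^B A = 0` for some `u ≥ 1`.
-/

namespace Stmt5

/-- Subspace spanned by all products `s·t` with `s ∈ S`, `t ∈ T`. -/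
def pSub {F L : Type*} [Field F] [AddCommGroup L] [Module F L]
    (mul : L →ₗ[F] L →ₗ[F] L) (S T : Submodule F L) : Submodule F L :=
  Submodule.span F {z | ∃ s ∈ S, ∃ t ∈ T, z = mul s t}

/-- The lower central series: `L^0 = L`, `L^{k+1} = L·L^k`. -/
def lcs {F L : Type*} [Field F] [AddCommGroup L] [Module F L]
    (mul : L →ₗ[F] L →ₗ[F] L) : ℕ → Submodule F L
  | 0 => ⊤
  | k + 1 => pSub mul ⊤ (lcs mul k)

/-- `G(N,φ,φ')`: the smallest `(φ,φ')`-invariant ideal of `A` containing `A·N`,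
`N·A`, and all elements `φ(i)n` and `φ'(i)n` for `i ∈ B`, `n ∈ N`. -/
def Gideal {F A B : Type*} [Field F] [AddCommGroup A] [Module F A]
    (mulA : A →ₗ[F] A →ₗ[F] A) (φ φ' : B → Module.End F A)
    (N : Submodule F A) : Submodule F A :=
  sInf {P : Submodule F A |
    (∀ a n : A, n ∈ P → mulA a n ∈ P ∧ mulA n a ∈ P) ∧
    (∀ i : B, ∀ n ∈ P, φ i n ∈ P ∧ φ' i n ∈ P) ∧
    (∀ a n : A, n ∈ N → mulA a n ∈ P ∧ mulA n a ∈ P) ∧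
    (∀ i : B, ∀ n ∈ N, φ i n ∈ P ∧ φ' i n ∈ P)}

section LowerCentralSeries

variable {F L M : Type*} [Field F] [AddCommGroup L] [Module F L] [AddCommGroup M] [Module F M]
  {mul : L →ₗ[F] L →ₗ[F] L}

lemma mul_mem_lcs_succ {k : ℕ} (x : L) {y : L} (hy : y ∈ lcs mul k) :
    mul x y ∈ lcs mul (k + 1) :=
  Submodule.subset_span ⟨x, trivial, y, hy, rfl⟩

lemma lcs_succ_le_iff {k : ℕ} {P : Submodule F L} :
    lcs mul (k + 1) ≤ P ↔ ∀ x, ∀ y ∈ lcs mul k, mul x y ∈ P := by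
  refine ⟨fun h x y hy => h (mul_mem_lcs_succ x hy), fun h => Submodule.span_le.2 ?_⟩
  rintro _ ⟨x, -, y, hy, rfl⟩
  exact h x y hy

lemma lcs_succ_le (k : ℕ) : lcs mul (k + 1) ≤ lcs mul k := by
  induction k with
  | zero => exact le_top
  | succ k ih => exact lcs_succ_le_iff.2 fun x y hy => mul_mem_lcs_succ x (ih hy)

lemma lcs_mul_mem (hL : ∀ x y z : L, mul x (mul y z) = mul (mul x y) z + mul y (mul x z))
    (m : ℕ) : ∀ (n : ℕ) {x z : L}, x ∈ lcs mul m → z ∈ lcs mul n →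
      mul x z ∈ lcs mul (m + n + 1) := by
  induction m with
  | zero =>
    intro n x z _ hz
    simpa using mul_mem_lcs_succ x hz
  | succ m ih =>
    intro n x z hx hz
    have hle : lcs mul (m + 1) ≤ (lcs mul (m + 1 + n + 1)).comap (mul.flip z) := by
      refine lcs_succ_le_iff.2 fun x y hy => ?_
      have h₁ := mul_mem_lcs_succ x (ih n hy hz)
      have h₃ := ih (n + 1) hy (mul_mem_lcs_succ x hz)
      rw [Submodule.mem_comap, LinearMap.flip_apply, eq_sub_of_add_eq (hL x y z).symm]
      rw [show m + 1 + n + 1 = m + n + 1 + 1 by lia]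
      exact sub_mem h₁ h₃
    exact hle hx

lemma lcs_mul_mem_succ (hL : ∀ x y z : L, mul x (mul y z) = mul (mul x y) z + mul y (mul x z))
    {k : ℕ} {x : L} (y : L) (hx : x ∈ lcs mul k) : mul x y ∈ lcs mul (k + 1) :=
  lcs_mul_mem hL k 0 hx trivial

lemma lcs_le_comap {mulM : M →ₗ[F] M →ₗ[F] M} (f : L →ₗ[F] M)
    (hf : ∀ x y, f (mul x y) = mulM (f x) (f y)) (k : ℕ) :
    lcs mul k ≤ (lcs mulM k).comap f := by
  induction k with
  | zero => exact fun _ _ => trivial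
  | succ k ih =>
    refine lcs_succ_le_iff.2 fun x y hy => ?_
    rw [Submodule.mem_comap, hf]
    exact mul_mem_lcs_succ _ (ih hy)

end LowerCentralSeries

section Gideal

variable {F A B : Type*} [Field F] [AddCommGroup A] [Module F A]
  {mulA : A →ₗ[F] A →ₗ[F] A} {φ φ' : B → Module.End F A} {N : Submodule F A}

lemma mul_mem_Gideal (a : A) {n : A} (hn : n ∈ N) : mulA a n ∈ Gideal mulA φ φ' N :=
  Submodule.mem_sInf.2 fun _ hP => (hP.2.2.1 a n hn).1

lemma apply_mem_Gideal (i : B) {n : A} (hn : n ∈ N) : φ i n ∈ Gideal mulA φ φ' N :=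
  Submodule.mem_sInf.2 fun _ hP => (hP.2.2.2 i n hn).1

end Gideal

theorem nilpotent_iff {F A L B : Type*} [Field F]
    [AddCommGroup A] [Module F A] [AddCommGroup L] [Module F L]
    [AddCommGroup B] [Module F B]
    (mulA : A →ₗ[F] A →ₗ[F] A) (mulL : L →ₗ[F] L →ₗ[F] L) (mulB : B →ₗ[F] B →ₗ[F] B)
    -- the three algebras are Leibniz algebras
    (hA : ∀ x y z : A, mulA x (mulA y z) = mulA (mulA x y) z + mulA y (mulA x z))
    (hL : ∀ x y z : L, mulL x (mulL y z) = mulL (mulL x y) z + mulL y (mulL x z))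
    (hB : ∀ x y z : B, mulB x (mulB y z) = mulB (mulB x y) z + mulB y (mulB x z))
    -- `A` and `B` are nilpotent
    (hAnil : ∃ u, lcs mulA u = ⊥) (hBnil : ∃ u, lcs mulB u = ⊥)
    -- `0 → A --σ--> L --π--> B → 0` is an extension of `A` by `B`
    (σ : A →ₗ[F] L) (π : L →ₗ[F] B)
    (hσmul : ∀ x y, σ (mulA x y) = mulL (σ x) (σ y))
    (hπmul : ∀ x y, π (mulL x y) = mulB (π x) (π y))
    (hσinj : Function.Injective σ) (hπsurj : Function.Surjective π)
    (hexact : LinearMap.range σ = LinearMap.ker π)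
    -- `T` is a section of the extension
    (T : B →ₗ[F] L) (hT : ∀ b, π (T b) = b)
    -- `φ(i)m = σ⁻¹(T(i)·σ(m))` and `φ'(i)m = σ⁻¹(σ(m)·T(i))`
    (φ φ' : B → Module.End F A)
    (hφ : ∀ i m, σ (φ i m) = mulL (T i) (σ m))
    (hφ' : ∀ i m, σ (φ' i m) = mulL (σ m) (T i))
    -- the sequence `G_0^B A = A`, `G_{k+1}^B A = G(G_k^B A, φ, φ')`
    (Gseq : ℕ → Submodule F A) (hG0 : Gseq 0 = ⊤)
    (hGsucc : ∀ k, Gseq (k + 1) = Gideal mulA φ φ' (Gseq k)) :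
    (∃ u, lcs mulL u = ⊥) ↔ (∃ u, lcs mulB u = ⊥) ∧ ∃ u, 1 ≤ u ∧ Gseq u = ⊥ := by
  constructor
  · rintro ⟨u, hu⟩
    have hG (k : ℕ) : Gseq k ≤ (lcs mulL k).comap σ := by
      induction k with
      | zero => exact fun _ _ => trivial
      | succ k ih =>
        have hN {n : A} {j : ℕ} (hn : σ n ∈ lcs mulL j) :
            (∀ a, σ (mulA a n) ∈ lcs mulL (j + 1) ∧ σ (mulA n a) ∈ lcs mulL (j + 1)) ∧
            ∀ i, σ (φ i n) ∈ lcs mulL (j + 1) ∧ σ (φ' i n) ∈ lcs mulL (j + 1) := by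
          simp only [hσmul, hφ, hφ']
          exact ⟨fun _ => ⟨mul_mem_lcs_succ _ hn, lcs_mul_mem_succ hL _ hn⟩,
            fun _ => ⟨mul_mem_lcs_succ _ hn, lcs_mul_mem_succ hL _ hn⟩⟩
        rw [hGsucc]
        refine sInf_le ⟨fun a n hn => ?_, fun i n hn => ?_, fun a n hn => (hN (ih hn)).1 a,
          fun i n hn => (hN (ih hn)).2 i⟩
        · exact ((hN hn).1 a).imp (@lcs_succ_le _ _ _ _ _ mulL (k + 1) _) (@lcs_succ_le _ _ _ _ _ mulL (k + 1) _)
        · exact ((hN hn).2 i).imp (@lcs_succ_le _ _ _ _ _ mulL (k + 1) _) (@lcs_succ_le _ _ _ _ _ mulL (k + 1) _)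
    refine ⟨hBnil, u + 1, Nat.le_add_left 1 u, (Submodule.eq_bot_iff _).2 fun a ha => ?_⟩
    have h : σ a ∈ lcs mulL u := lcs_succ_le u (hG (u + 1) ha)
    rw [hu, Submodule.mem_bot] at h
    exact hσinj (h.trans (map_zero σ).symm)
  · rintro ⟨⟨v, hv⟩, u, -, hu⟩
    have hle (k : ℕ) : lcs mulL (v + k) ≤ (Gseq k).map σ := by
      induction k with
      | zero =>
        rw [hG0, Submodule.map_top, hexact]
        intro x hx
        have h : π x ∈ lcs mulB v := lcs_le_comap π hπmul v hx
        rwa [hv] at h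
      | succ k ih =>
        refine lcs_succ_le_iff.2 fun x y hy => ?_
        obtain ⟨n, hn, rfl⟩ := ih hy
        obtain ⟨a, ha⟩ : x - T (π x) ∈ LinearMap.range σ := by
          simp [hexact, hT]
        rw [hGsucc]
        refine ⟨φ (π x) n + mulA a n, add_mem (apply_mem_Gideal _ hn) (mul_mem_Gideal _ hn), ?_⟩
        rw [map_add, hφ, hσmul, ha, ← LinearMap.add_apply, ← map_add, add_sub_cancel]
    refine ⟨v + u, eq_bot_iff.2 ((hle u).trans ?_)⟩
    rw [hu, Submodule.map_bot]

end Stmt5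
end

section
/- Let A and B be nilpotent Leibniz algebras, let 0 → A --σ--> L --π--> B → 0 be an extension with section T, let φ, φ' : B → End(A) be defined by φ(i)m = σ⁻¹(T(i)·σ(m)) and φ'(i)m = σ⁻¹(σ(m)·T(i)), and suppose L is nilpotent. Then max(nil_B A, nil B) ≤ nil L ≤ nil_B A + nil B. -/
/-!
STATEMENT 6: Let `A` and `B` be nilpotent Leibniz algebras, let
`0 → A --σ--> L --π--> B → 0` be an extension with section `T`, let
`φ, φ' : B → End(A)` be defined by `φ(i)m = σ⁻¹(T(i)·σ(m))` and
`φ'(i)m = σ⁻¹(σ(m)·T(i))`, and suppose `L` is nilpotent.  Then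
`max(nil_B A, nil B) ≤ nil L ≤ nil_B A + nil B`.

Nilpotency classes are encoded by their defining property: `nil L = u` iff
`L^u = 0` and `L^{u-1} ≠ 0`, and `nil_B A = u` iff `G_u^B A = 0` and
`G_{u-1}^B A ≠ 0`.
-/

namespace Stmt6

/-- Subspace spanned by all products `s·t` with `s ∈ S`, `t ∈ T`. -/
def pSub {F L : Type*} [Field F] [AddCommGroup L] [Module F L]
    (mul : L →ₗ[F] L →ₗ[F] L) (S T : Submodule F L) : Submodule F L :=
  Submodule.span F {z | ∃ s ∈ S, ∃ t ∈ T, z = mul s t}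

/-- The lower central series: `L^0 = L`, `L^{k+1} = L·L^k`. -/
def lcs {F L : Type*} [Field F] [AddCommGroup L] [Module F L]
    (mul : L →ₗ[F] L →ₗ[F] L) : ℕ → Submodule F L
  | 0 => ⊤
  | k + 1 => pSub mul ⊤ (lcs mul k)

/-- `G(N,φ,φ')`: the smallest `(φ,φ')`-invariant ideal of `A` containing `A·N`,
`N·A`, and all elements `φ(i)n` and `φ'(i)n` for `i ∈ B`, `n ∈ N`. -/
def Gideal {F A B : Type*} [Field F] [AddCommGroup A] [Module F A]
    (mulA : A →ₗ[F] A →ₗ[F] A) (φ φ' : B → Module.End F A)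
    (N : Submodule F A) : Submodule F A :=
  sInf {P : Submodule F A |
    (∀ a n : A, n ∈ P → mulA a n ∈ P ∧ mulA n a ∈ P) ∧
    (∀ i : B, ∀ n ∈ P, φ i n ∈ P ∧ φ' i n ∈ P) ∧
    (∀ a n : A, n ∈ N → mulA a n ∈ P ∧ mulA n a ∈ P) ∧
    (∀ i : B, ∀ n ∈ N, φ i n ∈ P ∧ φ' i n ∈ P)}

section LowerCentralSeries

variable {F L : Type*} [Field F] [AddCommGroup L] [Module F L]

theorem pSub_le {mul : L →ₗ[F] L →ₗ[F] L} {S T P : Submodule F L}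
    (h : ∀ s ∈ S, ∀ t ∈ T, mul s t ∈ P) : pSub mul S T ≤ P := by
  refine Submodule.span_le.2 ?_
  rintro _ ⟨s, hs, t, ht, rfl⟩
  exact h s hs t ht

theorem mul_mem_lcs_succ (mul : L →ₗ[F] L →ₗ[F] L) {k : ℕ} (x : L) {y : L}
    (hy : y ∈ lcs mul k) : mul x y ∈ lcs mul (k + 1) :=
  Submodule.subset_span ⟨x, Submodule.mem_top, y, hy, rfl⟩

theorem lcs_antitone (mul : L →ₗ[F] L →ₗ[F] L) : Antitone (lcs mul) := by
  refine antitone_nat_of_succ_le fun k => ?_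
  induction k with
  | zero => exact le_top
  | succ k ih => exact pSub_le fun x _ y hy => mul_mem_lcs_succ mul x (ih hy)

/-- In a left Leibniz algebra, `L^i · L^j ⊆ L^{i+j+1}`. -/
theorem lcs_mul_lcs_mem {mul : L →ₗ[F] L →ₗ[F] L}
    (hL : ∀ x y z : L, mul x (mul y z) = mul (mul x y) z + mul y (mul x z))
    {i j : ℕ} {y z : L} (hy : y ∈ lcs mul i) (hz : z ∈ lcs mul j) :
    mul y z ∈ lcs mul (i + j + 1) := by
  induction i generalizing j y z with
  | zero => simpa using mul_mem_lcs_succ mul y hz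
  | succ i ih =>
    suffices h : lcs mul (i + 1) ≤ (lcs mul (i + 1 + j + 1)).comap (mul.flip z) from h hy
    refine pSub_le fun x _ w hw => ?_
    rw [Submodule.mem_comap, LinearMap.flip_apply, ← add_sub_cancel_right (mul (mul x w) z)
      (mul w (mul x z)), ← hL]
    refine sub_mem ?_ ?_
    · convert mul_mem_lcs_succ mul x (ih hw hz) using 2
      omega
    · convert ih hw (mul_mem_lcs_succ mul x hz) using 2
      omega

theorem lcs_mul_mem {mul : L →ₗ[F] L →ₗ[F] L}
    (hL : ∀ x y z : L, mul x (mul y z) = mul (mul x y) z + mul y (mul x z))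
    {k : ℕ} {y : L} (hy : y ∈ lcs mul k) (z : L) : mul y z ∈ lcs mul (k + 1) :=
  lcs_mul_lcs_mem (j := 0) hL hy Submodule.mem_top

variable {B : Type*} [AddCommGroup B] [Module F B]
  {mulL : L →ₗ[F] L →ₗ[F] L} {mulB : B →ₗ[F] B →ₗ[F] B} {π : L →ₗ[F] B}

theorem map_lcs_le (hπmul : ∀ x y, π (mulL x y) = mulB (π x) (π y)) (k : ℕ) :
    (lcs mulL k).map π ≤ lcs mulB k := by
  rw [Submodule.map_le_iff_le_comap]
  induction k with
  | zero => exact fun _ _ => Submodule.mem_top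
  | succ k ih =>
    refine pSub_le fun x _ y hy => ?_
    rw [Submodule.mem_comap, hπmul]
    exact mul_mem_lcs_succ mulB _ (ih hy)

theorem lcs_le_map (hπmul : ∀ x y, π (mulL x y) = mulB (π x) (π y))
    (hπsurj : Function.Surjective π) (k : ℕ) : lcs mulB k ≤ (lcs mulL k).map π := by
  induction k with
  | zero =>
    intro b _
    obtain ⟨x, rfl⟩ := hπsurj b
    exact ⟨x, Submodule.mem_top, rfl⟩
  | succ k ih =>
    refine pSub_le fun b _ c hc => ?_
    obtain ⟨x, rfl⟩ := hπsurj b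
    obtain ⟨y, hy, rfl⟩ := ih hc
    exact ⟨mulL x y, mul_mem_lcs_succ mulL x hy, hπmul x y⟩

end LowerCentralSeries

section Gideal

variable {F A B : Type*} [Field F] [AddCommGroup A] [Module F A]
  {mulA : A →ₗ[F] A →ₗ[F] A} {φ φ' : B → Module.End F A} {N : Submodule F A}

theorem mul_mem_Gideal (a : A) {n : A} (hn : n ∈ N) : mulA a n ∈ Gideal mulA φ φ' N :=
  Submodule.mem_sInf.2 fun _ hP => (hP.2.2.1 a n hn).1

theorem action_mem_Gideal (i : B) {n : A} (hn : n ∈ N) : φ i n ∈ Gideal mulA φ φ' N :=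
  Submodule.mem_sInf.2 fun _ hP => (hP.2.2.2 i n hn).1

variable {L : Type*} [AddCommGroup L] [Module F L] {mulL : L →ₗ[F] L →ₗ[F] L}
  {σ : A →ₗ[F] L} {T : B → L}

theorem Gideal_le_comap_lcs
    (hL : ∀ x y z : L, mulL x (mulL y z) = mulL (mulL x y) z + mulL y (mulL x z))
    (hσmul : ∀ x y, σ (mulA x y) = mulL (σ x) (σ y))
    (hφ : ∀ i m, σ (φ i m) = mulL (T i) (σ m))
    (hφ' : ∀ i m, σ (φ' i m) = mulL (σ m) (T i))
    {k : ℕ} (hN : N ≤ (lcs mulL k).comap σ) :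
    Gideal mulA φ φ' N ≤ (lcs mulL (k + 1)).comap σ := by
  have hmul (a n : A) (hn : σ n ∈ lcs mulL k) :
      σ (mulA a n) ∈ lcs mulL (k + 1) ∧ σ (mulA n a) ∈ lcs mulL (k + 1) := by
    rw [hσmul, hσmul]
    exact ⟨mul_mem_lcs_succ mulL _ hn, lcs_mul_mem hL hn _⟩
  have hact (i : B) (n : A) (hn : σ n ∈ lcs mulL k) :
      σ (φ i n) ∈ lcs mulL (k + 1) ∧ σ (φ' i n) ∈ lcs mulL (k + 1) := by
    rw [hφ, hφ']
    exact ⟨mul_mem_lcs_succ mulL _ hn, lcs_mul_mem hL hn _⟩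
  have hle : lcs mulL (k + 1) ≤ lcs mulL k := lcs_antitone mulL k.le_succ
  exact sInf_le ⟨fun a n hn => hmul a n (hle hn), fun i n hn => hact i n (hle hn),
    fun a n hn => hmul a n (hN hn), fun i n hn => hact i n (hN hn)⟩

theorem mul_mem_map_Gideal [AddCommGroup B] [Module F B] {π : L →ₗ[F] B}
    (hσmul : ∀ x y, σ (mulA x y) = mulL (σ x) (σ y))
    (hexact : LinearMap.range σ = LinearMap.ker π) (hT : ∀ b, π (T b) = b)
    (hφ : ∀ i m, σ (φ i m) = mulL (T i) (σ m)) (x : L) {n : A} (hn : n ∈ N) :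
    mulL x (σ n) ∈ (Gideal mulA φ φ' N).map σ := by
  have hx : x - T (π x) ∈ LinearMap.range σ := by
    rw [hexact, LinearMap.mem_ker, map_sub, hT, sub_self]
  obtain ⟨a, ha⟩ := hx
  refine ⟨mulA a n + φ (π x) n,
    add_mem (mul_mem_Gideal a hn) (action_mem_Gideal (π x) hn), ?_⟩
  rw [map_add, hσmul, hφ, ha, ← LinearMap.add_apply, ← map_add, sub_add_cancel]

end Gideal

theorem nil_class_bounds {F A L B : Type*} [Field F]
    [AddCommGroup A] [Module F A] [AddCommGroup L] [Module F L]
    [AddCommGroup B] [Module F B]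
    (mulA : A →ₗ[F] A →ₗ[F] A) (mulL : L →ₗ[F] L →ₗ[F] L) (mulB : B →ₗ[F] B →ₗ[F] B)
    -- the three algebras are Leibniz algebras
    (hA : ∀ x y z : A, mulA x (mulA y z) = mulA (mulA x y) z + mulA y (mulA x z))
    (hL : ∀ x y z : L, mulL x (mulL y z) = mulL (mulL x y) z + mulL y (mulL x z))
    (hB : ∀ x y z : B, mulB x (mulB y z) = mulB (mulB x y) z + mulB y (mulB x z))
    -- `A` is nilpotent
    (hAnil : ∃ u, lcs mulA u = ⊥)
    -- `0 → A --σ--> L --π--> B → 0` is an extension of `A` by `B`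
    (σ : A →ₗ[F] L) (π : L →ₗ[F] B)
    (hσmul : ∀ x y, σ (mulA x y) = mulL (σ x) (σ y))
    (hπmul : ∀ x y, π (mulL x y) = mulB (π x) (π y))
    (hσinj : Function.Injective σ) (hπsurj : Function.Surjective π)
    (hexact : LinearMap.range σ = LinearMap.ker π)
    -- `T` is a section of the extension
    (T : B →ₗ[F] L) (hT : ∀ b, π (T b) = b)
    -- `φ(i)m = σ⁻¹(T(i)·σ(m))` and `φ'(i)m = σ⁻¹(σ(m)·T(i))`
    (φ φ' : B → Module.End F A)
    (hφ : ∀ i m, σ (φ i m) = mulL (T i) (σ m))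
    (hφ' : ∀ i m, σ (φ' i m) = mulL (σ m) (T i))
    -- the sequence `G_0^B A = A`, `G_{k+1}^B A = G(G_k^B A, φ, φ')`
    (Gseq : ℕ → Submodule F A) (hG0 : Gseq 0 = ⊤)
    (hGsucc : ∀ k, Gseq (k + 1) = Gideal mulA φ φ' (Gseq k))
    -- `B` is nilpotent of class `uB`, `L` is nilpotent of class `uL`,
    -- and `A` is `B`-nilpotent of class `uA`
    (uL uB uA : ℕ)
    (hLnil : lcs mulL uL = ⊥) (hLclass : lcs mulL (uL - 1) ≠ ⊥)
    (hBnil : lcs mulB uB = ⊥) (hBclass : lcs mulB (uB - 1) ≠ ⊥)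
    (hGnil : Gseq uA = ⊥) (hGclass : Gseq (uA - 1) ≠ ⊥) :
    max uA uB ≤ uL ∧ uL ≤ uA + uB := by
  have hGL (k : ℕ) : Gseq k ≤ (lcs mulL k).comap σ := by
    induction k with
    | zero => exact fun _ _ => Submodule.mem_top
    | succ k ih =>
      rw [hGsucc]
      exact Gideal_le_comap_lcs hL hσmul hφ hφ' ih
  have hLG (k : ℕ) : lcs mulL (uB + k) ≤ (Gseq k).map σ := by
    induction k with
    | zero =>
      rw [hG0, Submodule.map_top, hexact, LinearMap.le_ker_iff_map, eq_bot_iff, ← hBnil]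
      exact map_lcs_le hπmul uB
    | succ k ih =>
      refine pSub_le fun x _ y hy => ?_
      obtain ⟨n, hn, rfl⟩ := ih hy
      rw [hGsucc]
      exact mul_mem_map_Gideal hσmul hexact hT hφ x hn
  have hLbot {k : ℕ} (hk : uL ≤ k) : lcs mulL k = ⊥ :=
    eq_bot_iff.2 (hLnil ▸ lcs_antitone mulL hk)
  refine ⟨max_le ?_ ?_, ?_⟩
  · by_contra! h
    refine hGclass (eq_bot_iff.2 ((hGL (uA - 1)).trans_eq ?_))
    rw [hLbot (Nat.le_sub_one_of_lt h), Submodule.comap_bot, LinearMap.ker_eq_bot.2 hσinj]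
  · by_contra! h
    refine hBclass (eq_bot_iff.2 ((lcs_le_map hπmul hπsurj (uB - 1)).trans_eq ?_))
    rw [hLbot (Nat.le_sub_one_of_lt h), Submodule.map_bot]
  · by_contra! h
    refine hLclass (eq_bot_iff.2 ((lcs_antitone mulL ?_).trans ((hLG uA).trans_eq ?_)))
    · omega
    · rw [hGnil, Submodule.map_bot]

end Stmt6
end

section
/- Let A and B be nilpotent Leibniz algebras. Let 0 → A --σ₁--> L₁ --π₁--> B → 0 and 0 → A --σ₂--> L₂ --π₂--> B → 0 be extensions of A by B with sections T₁ and T₂, and for j = 1,2 define φⱼ(i)m = σⱼ⁻¹(Tⱼ(i)·σⱼ(m)) and φⱼ'(i)m = σⱼ⁻¹(σⱼ(m)·Tⱼ(i)). Suppose that for every i ∈ B there exist m_i, m_i' ∈ A such that φ₂(i)a = φ₁(i)a + m_i·a and φ₂'(i)a = φ₁'(i)a + a·m_i' for all a ∈ A (i.e., the two extensions correspond to lifts of the same pair (Φ,Φ')). Then L₁ is nilpotent if and only if L₂ is nilpotent. -/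
/-!
STATEMENT 7: Let `A` and `B` be nilpotent Leibniz algebras.  Let
`0 → A --σ₁--> L₁ --π₁--> B → 0` and `0 → A --σ₂--> L₂ --π₂--> B → 0` be
extensions of `A` by `B` with sections `T₁` and `T₂`, and for `j = 1,2` define
`φⱼ(i)m = σⱼ⁻¹(Tⱼ(i)·σⱼ(m))` and `φⱼ'(i)m = σⱼ⁻¹(σⱼ(m)·Tⱼ(i))`.  Suppose the
two extensions correspond to lifts of the same pair `(Φ,Φ')`.  Then `L₁` is
nilpotent if and only if `L₂` is nilpotent.
-/

namespace Stmt7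

/-- Subspace spanned by all products `s·t` with `s ∈ S`, `t ∈ T`. -/
def pSub {F L : Type*} [Field F] [AddCommGroup L] [Module F L]
    (mul : L →ₗ[F] L →ₗ[F] L) (S T : Submodule F L) : Submodule F L :=
  Submodule.span F {z | ∃ s ∈ S, ∃ t ∈ T, z = mul s t}

/-- The lower central series: `L^0 = L`, `L^{k+1} = L·L^k`. -/
def lcs {F L : Type*} [Field F] [AddCommGroup L] [Module F L]
    (mul : L →ₗ[F] L →ₗ[F] L) : ℕ → Submodule F L
  | 0 => ⊤
  | k + 1 => pSub mul ⊤ (lcs mul k)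

theorem mul_mem_lcs_succ {F L : Type*} [Field F] [AddCommGroup L] [Module F L]
    (mul : L →ₗ[F] L →ₗ[F] L) {k : ℕ} (x : L) {y : L} (hy : y ∈ lcs mul k) :
    mul x y ∈ lcs mul (k + 1) :=
  Submodule.subset_span ⟨x, Submodule.mem_top, y, hy, rfl⟩

theorem lcs_succ_le {F L : Type*} [Field F] [AddCommGroup L] [Module F L]
    (mul : L →ₗ[F] L →ₗ[F] L) {k : ℕ} {S : Submodule F L}
    (h : ∀ x, ∀ y ∈ lcs mul k, mul x y ∈ S) : lcs mul (k + 1) ≤ S := by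
  refine Submodule.span_le.2 ?_
  rintro _ ⟨x, -, y, hy, rfl⟩
  exact h x y hy

theorem lcs_le_comap {F L B : Type*} [Field F] [AddCommGroup L] [Module F L]
    [AddCommGroup B] [Module F B] (mulL : L →ₗ[F] L →ₗ[F] L) (mulB : B →ₗ[F] B →ₗ[F] B)
    (π : L →ₗ[F] B) (hπ : ∀ x y, π (mulL x y) = mulB (π x) (π y)) (k : ℕ) :
    lcs mulL k ≤ (lcs mulB k).comap π := by
  induction k with
  | zero => exact fun _ _ => Submodule.mem_top
  | succ k ih =>
    refine lcs_succ_le mulL fun x y hy => ?_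
    rw [Submodule.mem_comap, hπ]
    exact mul_mem_lcs_succ mulB _ (ih hy)

/-- If the left actions of two extensions of a nilpotent algebra `B` by `A` differ by left
multiplications of `A`, then nilpotency passes from the first extension to the second. -/
theorem nilpotent_of_nilpotent {F A L₁ L₂ B : Type*} [Field F]
    [AddCommGroup A] [Module F A] [AddCommGroup L₁] [Module F L₁]
    [AddCommGroup L₂] [Module F L₂] [AddCommGroup B] [Module F B]
    (mulA : A →ₗ[F] A →ₗ[F] A) (mulL₁ : L₁ →ₗ[F] L₁ →ₗ[F] L₁)
    (mulL₂ : L₂ →ₗ[F] L₂ →ₗ[F] L₂) (mulB : B →ₗ[F] B →ₗ[F] B)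
    (hBnil : ∃ u, lcs mulB u = ⊥)
    (σ₁ : A →ₗ[F] L₁) (hσ₁mul : ∀ x y, σ₁ (mulA x y) = mulL₁ (σ₁ x) (σ₁ y))
    (hσ₁inj : Function.Injective σ₁) (T₁ : B →ₗ[F] L₁)
    (σ₂ : A →ₗ[F] L₂) (π₂ : L₂ →ₗ[F] B)
    (hσ₂mul : ∀ x y, σ₂ (mulA x y) = mulL₂ (σ₂ x) (σ₂ y))
    (hπ₂mul : ∀ x y, π₂ (mulL₂ x y) = mulB (π₂ x) (π₂ y))
    (hexact₂ : LinearMap.range σ₂ = LinearMap.ker π₂)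
    (T₂ : B →ₗ[F] L₂) (hT₂ : ∀ b, π₂ (T₂ b) = b)
    (φ₁ φ₂ : B → Module.End F A)
    (hφ₁ : ∀ i m, σ₁ (φ₁ i m) = mulL₁ (T₁ i) (σ₁ m))
    (hφ₂ : ∀ i m, σ₂ (φ₂ i m) = mulL₂ (T₂ i) (σ₂ m))
    (hlift : ∀ i : B, ∃ m : A, ∀ a : A, φ₂ i a = φ₁ i a + mulA m a)
    (hnil : ∃ u, lcs mulL₁ u = ⊥) : ∃ u, lcs mulL₂ u = ⊥ := by
  obtain ⟨u, hu⟩ := hBnil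
  obtain ⟨v, hv⟩ := hnil
  have key : ∀ k, lcs mulL₂ (u + k) ≤ ((lcs mulL₁ k).comap σ₁).map σ₂ := by
    intro k
    induction k with
    | zero =>
      intro x hx
      have hx' : x ∈ LinearMap.range σ₂ := by
        simpa [hexact₂, hu] using lcs_le_comap mulL₂ mulB π₂ hπ₂mul u hx
      obtain ⟨a, rfl⟩ := hx'
      exact ⟨a, Submodule.mem_top, rfl⟩
    | succ k ih =>
      refine lcs_succ_le mulL₂ fun x y hy => ?_
      obtain ⟨a, ha, rfl⟩ := ih hy
      have hx : x - T₂ (π₂ x) ∈ LinearMap.range σ₂ := by simp [hexact₂, hT₂]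
      obtain ⟨c, hc⟩ := hx
      obtain ⟨m, hm⟩ := hlift (π₂ x)
      refine ⟨φ₂ (π₂ x) a + mulA c a, ?_, ?_⟩
      · simp only [SetLike.mem_coe, Submodule.mem_comap, hm, map_add, hφ₁, hσ₁mul]
        exact add_mem (add_mem (mul_mem_lcs_succ mulL₁ _ ha) (mul_mem_lcs_succ mulL₁ _ ha))
          (mul_mem_lcs_succ mulL₁ _ ha)
      · simp [hφ₂, hσ₂mul, hc]
  refine ⟨u + v, le_bot_iff.1 ((key v).trans ?_)⟩
  rw [hv, Submodule.comap_bot, LinearMap.ker_eq_bot.2 hσ₁inj, Submodule.map_bot]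

theorem nilpotent_iff_nilpotent {F A L₁ L₂ B : Type*} [Field F]
    [AddCommGroup A] [Module F A] [AddCommGroup L₁] [Module F L₁]
    [AddCommGroup L₂] [Module F L₂] [AddCommGroup B] [Module F B]
    (mulA : A →ₗ[F] A →ₗ[F] A) (mulL₁ : L₁ →ₗ[F] L₁ →ₗ[F] L₁)
    (mulL₂ : L₂ →ₗ[F] L₂ →ₗ[F] L₂) (mulB : B →ₗ[F] B →ₗ[F] B)
    -- the algebras are Leibniz algebras
    (hA : ∀ x y z : A, mulA x (mulA y z) = mulA (mulA x y) z + mulA y (mulA x z))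
    (hL₁ : ∀ x y z : L₁, mulL₁ x (mulL₁ y z) = mulL₁ (mulL₁ x y) z + mulL₁ y (mulL₁ x z))
    (hL₂ : ∀ x y z : L₂, mulL₂ x (mulL₂ y z) = mulL₂ (mulL₂ x y) z + mulL₂ y (mulL₂ x z))
    (hB : ∀ x y z : B, mulB x (mulB y z) = mulB (mulB x y) z + mulB y (mulB x z))
    -- `A` and `B` are nilpotent
    (hAnil : ∃ u, lcs mulA u = ⊥) (hBnil : ∃ u, lcs mulB u = ⊥)
    -- `0 → A --σ₁--> L₁ --π₁--> B → 0` is an extension of `A` by `B` with section `T₁`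
    (σ₁ : A →ₗ[F] L₁) (π₁ : L₁ →ₗ[F] B)
    (hσ₁mul : ∀ x y, σ₁ (mulA x y) = mulL₁ (σ₁ x) (σ₁ y))
    (hπ₁mul : ∀ x y, π₁ (mulL₁ x y) = mulB (π₁ x) (π₁ y))
    (hσ₁inj : Function.Injective σ₁) (hπ₁surj : Function.Surjective π₁)
    (hexact₁ : LinearMap.range σ₁ = LinearMap.ker π₁)
    (T₁ : B →ₗ[F] L₁) (hT₁ : ∀ b, π₁ (T₁ b) = b)
    -- `0 → A --σ₂--> L₂ --π₂--> B → 0` is an extension of `A` by `B` with section `T₂`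
    (σ₂ : A →ₗ[F] L₂) (π₂ : L₂ →ₗ[F] B)
    (hσ₂mul : ∀ x y, σ₂ (mulA x y) = mulL₂ (σ₂ x) (σ₂ y))
    (hπ₂mul : ∀ x y, π₂ (mulL₂ x y) = mulB (π₂ x) (π₂ y))
    (hσ₂inj : Function.Injective σ₂) (hπ₂surj : Function.Surjective π₂)
    (hexact₂ : LinearMap.range σ₂ = LinearMap.ker π₂)
    (T₂ : B →ₗ[F] L₂) (hT₂ : ∀ b, π₂ (T₂ b) = b)
    -- `φⱼ(i)m = σⱼ⁻¹(Tⱼ(i)·σⱼ(m))` and `φⱼ'(i)m = σⱼ⁻¹(σⱼ(m)·Tⱼ(i))`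
    (φ₁ φ₁' φ₂ φ₂' : B → Module.End F A)
    (hφ₁ : ∀ i m, σ₁ (φ₁ i m) = mulL₁ (T₁ i) (σ₁ m))
    (hφ₁' : ∀ i m, σ₁ (φ₁' i m) = mulL₁ (σ₁ m) (T₁ i))
    (hφ₂ : ∀ i m, σ₂ (φ₂ i m) = mulL₂ (T₂ i) (σ₂ m))
    (hφ₂' : ∀ i m, σ₂ (φ₂' i m) = mulL₂ (σ₂ m) (T₂ i))
    -- the two extensions correspond to lifts of the same pair `(Φ,Φ')`
    (hlift : ∀ i : B, ∃ m m' : A, ∀ a : A,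
      φ₂ i a = φ₁ i a + mulA m a ∧ φ₂' i a = φ₁' i a + mulA a m') :
    (∃ u, lcs mulL₁ u = ⊥) ↔ (∃ u, lcs mulL₂ u = ⊥) := by
  constructor
  · refine nilpotent_of_nilpotent mulA mulL₁ mulL₂ mulB hBnil σ₁ hσ₁mul hσ₁inj T₁ σ₂ π₂ hσ₂mul
      hπ₂mul hexact₂ T₂ hT₂ φ₁ φ₂ hφ₁ hφ₂ fun i => ?_
    obtain ⟨m, _, h⟩ := hlift i
    exact ⟨m, fun a => (h a).1⟩
  · refine nilpotent_of_nilpotent mulA mulL₂ mulL₁ mulB hBnil σ₂ hσ₂mul hσ₂inj T₂ σ₁ π₁ hσ₁mul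
      hπ₁mul hexact₁ T₁ hT₁ φ₂ φ₁ hφ₂ hφ₁ fun i => ?_
    obtain ⟨m, _, h⟩ := hlift i
    exact ⟨-m, fun a => by simp [(h a).1]⟩

end Stmt7
end

section
/- Let D be a diassociative algebra. Then for all natural numbers n, the three terms D^{{n}}, D^{<n>}, and D^n of the left, right, and general lower central series of D coincide. -/
/-!
STATEMENT 8: Let `D` be a diassociative algebra.  Then for all natural numbers
`n`, the three terms `D^{{n}}`, `D^{<n>}`, and `D^n` of the left, right, and
general lower central series of `D` coincide.
-/

namespace Stmt8

variable {F D : Type*} [Field F] [AddCommGroup D] [Module F D]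

/-- Subspace spanned by all products `s*t` with `s ∈ S`, `t ∈ T`. -/
def pSub (mul : D →ₗ[F] D →ₗ[F] D) (S T : Submodule F D) : Submodule F D :=
  Submodule.span F {z | ∃ s ∈ S, ∃ t ∈ T, z = mul s t}

/-- `S ◊ T = S⊣T + S⊢T` for subspaces `S`, `T`. -/
def dSub (ml mr : D →ₗ[F] D →ₗ[F] D) (S T : Submodule F D) : Submodule F D :=
  pSub ml S T ⊔ pSub mr S T

/-- The left lower central series: `D^{{0}} = D`, `D^{{k+1}} = D ◊ D^{{k}}`. -/
def leftS (ml mr : D →ₗ[F] D →ₗ[F] D) : ℕ → Submodule F D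
  | 0 => ⊤
  | k + 1 => dSub ml mr ⊤ (leftS ml mr k)

/-- The right lower central series: `D^{<0>} = D`, `D^{<k+1>} = D^{<k>} ◊ D`. -/
def rightS (ml mr : D →ₗ[F] D →ₗ[F] D) : ℕ → Submodule F D
  | 0 => ⊤
  | k + 1 => dSub ml mr (rightS ml mr k) ⊤

/-- The general lower central series:
`D^0 = D`, `D^{k+1} = Σ_{i=0}^{k} D^i ◊ D^{k-i}`. -/
def genS (ml mr : D →ₗ[F] D →ₗ[F] D) : ℕ → Submodule F D
  | 0 => ⊤
  | k + 1 => (Finset.range (k + 1)).attach.sup fun i =>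
      have _h1 : i.1 < k + 1 := Finset.mem_range.mp i.2
      dSub ml mr (genS ml mr i.1) (genS ml mr (k - i.1))
  termination_by n => n
  decreasing_by
  · exact _h1
  · omega

theorem dSub_le_iff {ml mr : D →ₗ[F] D →ₗ[F] D} {S T U : Submodule F D} :
    dSub ml mr S T ≤ U ↔ ∀ s ∈ S, ∀ t ∈ T, ml s t ∈ U ∧ mr s t ∈ U := by
  simp only [dSub, pSub, sup_le_iff, Submodule.span_le]
  constructor
  · rintro ⟨hl, hr⟩ s hs t ht
    exact ⟨hl ⟨s, hs, t, ht, rfl⟩, hr ⟨s, hs, t, ht, rfl⟩⟩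
  · intro h
    constructor
    · rintro _ ⟨s, hs, t, ht, rfl⟩
      exact (h s hs t ht).1
    · rintro _ ⟨s, hs, t, ht, rfl⟩
      exact (h s hs t ht).2

theorem left_mem_dSub {ml mr : D →ₗ[F] D →ₗ[F] D} {S T : Submodule F D} {s t : D}
    (hs : s ∈ S) (ht : t ∈ T) : ml s t ∈ dSub ml mr S T :=
  (dSub_le_iff.mp le_rfl s hs t ht).1

theorem right_mem_dSub {ml mr : D →ₗ[F] D →ₗ[F] D} {S T : Submodule F D} {s t : D}
    (hs : s ∈ S) (ht : t ∈ T) : mr s t ∈ dSub ml mr S T :=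
  (dSub_le_iff.mp le_rfl s hs t ht).2

/-- In a diassociative algebra, the operation `◊` on subspaces is associative. -/
theorem dSub_assoc {ml mr : D →ₗ[F] D →ₗ[F] D}
    (hassocl : ∀ x y z : D, ml (ml x y) z = ml x (ml y z))
    (hassocr : ∀ x y z : D, mr (mr x y) z = mr x (mr y z))
    (hD1 : ∀ x y z : D, ml x (ml y z) = ml x (mr y z))
    (hD2 : ∀ x y z : D, ml (mr x y) z = mr x (ml y z))
    (hD3 : ∀ x y z : D, mr (ml x y) z = mr (mr x y) z)
    (S T U : Submodule F D) :
    dSub ml mr (dSub ml mr S T) U = dSub ml mr S (dSub ml mr T U) := by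
  apply le_antisymm
  · refine dSub_le_iff.mpr fun a ha u hu => ?_
    set V := dSub ml mr S (dSub ml mr T U)
    have key : dSub ml mr S T ≤ V.comap (ml.flip u) ⊓ V.comap (mr.flip u) := by
      refine dSub_le_iff.mpr fun s hs t ht => ?_
      simp only [Submodule.mem_inf, Submodule.mem_comap, LinearMap.flip_apply, hassocl, hD2, hD3,
        hassocr]
      have hl := left_mem_dSub (ml := ml) (mr := mr) ht hu
      have hr := right_mem_dSub (ml := ml) (mr := mr) ht hu
      exact ⟨⟨left_mem_dSub hs hl, right_mem_dSub hs hr⟩,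
        right_mem_dSub hs hl, right_mem_dSub hs hr⟩
    exact key ha
  · refine dSub_le_iff.mpr fun s hs a ha => ?_
    set V := dSub ml mr (dSub ml mr S T) U
    have key : dSub ml mr T U ≤ V.comap (ml s) ⊓ V.comap (mr s) := by
      refine dSub_le_iff.mpr fun t ht u hu => ?_
      simp only [Submodule.mem_inf, Submodule.mem_comap, ← hD1, ← hassocl, ← hD2, ← hassocr]
      have hl := left_mem_dSub (ml := ml) (mr := mr) hs ht
      have hr := right_mem_dSub (ml := ml) (mr := mr) hs ht
      exact ⟨⟨left_mem_dSub hl hu, left_mem_dSub hr hu⟩,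
        left_mem_dSub hl hu, right_mem_dSub hr hu⟩
    exact key ha

theorem dSub_leftS {ml mr : D →ₗ[F] D →ₗ[F] D}
    (hassoc : ∀ S T U : Submodule F D,
      dSub ml mr (dSub ml mr S T) U = dSub ml mr S (dSub ml mr T U)) (i j : ℕ) :
    dSub ml mr (leftS ml mr i) (leftS ml mr j) = leftS ml mr (i + j + 1) := by
  induction i with
  | zero => rw [Nat.zero_add]; rfl
  | succ i ih => rw [leftS, hassoc, ih, Nat.add_right_comm i 1 j]; rfl

theorem rightS_eq_leftS {ml mr : D →ₗ[F] D →ₗ[F] D}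
    (hassoc : ∀ S T U : Submodule F D,
      dSub ml mr (dSub ml mr S T) U = dSub ml mr S (dSub ml mr T U)) (n : ℕ) :
    rightS ml mr n = leftS ml mr n := by
  induction n with
  | zero => rfl
  | succ n ih => rw [rightS, ih]; exact dSub_leftS hassoc n 0

theorem genS_eq_leftS {ml mr : D →ₗ[F] D →ₗ[F] D}
    (hassoc : ∀ S T U : Submodule F D,
      dSub ml mr (dSub ml mr S T) U = dSub ml mr S (dSub ml mr T U)) (n : ℕ) :
    genS ml mr n = leftS ml mr n := by
  induction n using Nat.strong_induction_on with
  | _ n ih =>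
    cases n with
    | zero => rw [genS, leftS]
    | succ k =>
      have hterm : ∀ i < k + 1,
          dSub ml mr (genS ml mr i) (genS ml mr (k - i)) = leftS ml mr (k + 1) := by
        intro i hi
        rw [ih i hi, ih (k - i) (by omega), dSub_leftS hassoc,
          Nat.add_sub_cancel' (Nat.le_of_lt_succ hi)]
      rw [genS]
      refine (Finset.sup_congr rfl fun i _ => hterm i.1 (Finset.mem_range.mp i.2)).trans ?_
      exact Finset.sup_const (by simp) _

/-- In a diassociative algebra, `D^{{n}} = D^{<n>} = D^n` for all `n`. -/
theorem leftS_eq_rightS_eq_genS (ml mr : D →ₗ[F] D →ₗ[F] D)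
    -- `⊣ = ml` and `⊢ = mr` are associative
    (hassocl : ∀ x y z : D, ml (ml x y) z = ml x (ml y z))
    (hassocr : ∀ x y z : D, mr (mr x y) z = mr x (mr y z))
    -- D1: `x⊣(y⊣z) = x⊣(y⊢z)`
    (hD1 : ∀ x y z : D, ml x (ml y z) = ml x (mr y z))
    -- D2: `(x⊢y)⊣z = x⊢(y⊣z)`
    (hD2 : ∀ x y z : D, ml (mr x y) z = mr x (ml y z))
    -- D3: `(x⊣y)⊢z = (x⊢y)⊢z`
    (hD3 : ∀ x y z : D, mr (ml x y) z = mr (mr x y) z)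
    (n : ℕ) :
    leftS ml mr n = rightS ml mr n ∧ rightS ml mr n = genS ml mr n := by
  have hassoc := dSub_assoc hassocl hassocr hD1 hD2 hD3
  rw [rightS_eq_leftS hassoc, genS_eq_leftS hassoc]
  exact ⟨rfl, rfl⟩

end Stmt8
end

section
/- Let A and B be diassociative algebras with B nilpotent of class s, and let 0 → A --σ--> L --π--> B → 0 be an extension of A by B. Define subspaces A_k of A by A_0 = A and A_{k+1} = σ⁻¹(σ(A_k)◊L + L◊σ(A_k)). Then L^{k+s} ⊆ σ(A_k) ⊆ L^k for all k ≥ 0, where L^k is the general lower central series. Consequently, L is nilpotent if and only if A_k = 0 for some k. -/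
/-!
STATEMENT 10: Let `A` and `B` be diassociative algebras with `B` nilpotent of
class `s`, and let `0 → A --σ--> L --π--> B → 0` be an extension of `A` by `B`.
Define subspaces `A_k` of `A` by `A_0 = A` and
`A_{k+1} = σ⁻¹(σ(A_k)◊L + L◊σ(A_k))`.  Then `L^{k+s} ⊆ σ(A_k) ⊆ L^k` for all
`k ≥ 0`, where `L^k` is the general lower central series.  Consequently, `L` is
nilpotent if and only if `A_k = 0` for some `k`.
-/

namespace Stmt10

variable {F : Type*} [Field F]

/-- Subspace spanned by all products `s*t` with `s ∈ S`, `t ∈ T`. -/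
def pSub {D : Type*} [AddCommGroup D] [Module F D]
    (mul : D →ₗ[F] D →ₗ[F] D) (S T : Submodule F D) : Submodule F D :=
  Submodule.span F {z | ∃ s ∈ S, ∃ t ∈ T, z = mul s t}

/-- `S ◊ T = S⊣T + S⊢T` for subspaces `S`, `T`. -/
def dSub {D : Type*} [AddCommGroup D] [Module F D]
    (ml mr : D →ₗ[F] D →ₗ[F] D) (S T : Submodule F D) : Submodule F D :=
  pSub ml S T ⊔ pSub mr S T

/-- The general lower central series:
`D^0 = D`, `D^{k+1} = Σ_{i=0}^{k} D^i ◊ D^{k-i}`. -/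
def genS {D : Type*} [AddCommGroup D] [Module F D]
    (ml mr : D →ₗ[F] D →ₗ[F] D) : ℕ → Submodule F D
  | 0 => ⊤
  | k + 1 => (Finset.range (k + 1)).attach.sup fun i =>
      have _h1 : i.1 < k + 1 := Finset.mem_range.mp i.2
      dSub ml mr (genS ml mr i.1) (genS ml mr (k - i.1))
  termination_by n => n
  decreasing_by
  · exact _h1
  · omega

/-- `(ml, mr) = (⊣, ⊢)` makes `D` a diassociative algebra. -/
def IsDias {D : Type*} [AddCommGroup D] [Module F D]
    (ml mr : D →ₗ[F] D →ₗ[F] D) : Prop :=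
  (∀ x y z : D, ml (ml x y) z = ml x (ml y z)) ∧
  (∀ x y z : D, mr (mr x y) z = mr x (mr y z)) ∧
  (∀ x y z : D, ml x (ml y z) = ml x (mr y z)) ∧
  (∀ x y z : D, ml (mr x y) z = mr x (ml y z)) ∧
  (∀ x y z : D, mr (ml x y) z = mr (mr x y) z)

section Products

variable {D : Type*} [AddCommGroup D] [Module F D]

lemma pSub_le {mul : D →ₗ[F] D →ₗ[F] D} {S T U : Submodule F D}
    (h : ∀ x ∈ S, ∀ y ∈ T, mul x y ∈ U) : pSub mul S T ≤ U := by
  refine Submodule.span_le.2 ?_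
  rintro _ ⟨x, hx, y, hy, rfl⟩
  exact h x hx y hy

lemma mul_mem_pSub {mul : D →ₗ[F] D →ₗ[F] D} {S T : Submodule F D} {x y : D}
    (hx : x ∈ S) (hy : y ∈ T) : mul x y ∈ pSub mul S T :=
  Submodule.subset_span ⟨x, hx, y, hy, rfl⟩

lemma pSub_mono {mul : D →ₗ[F] D →ₗ[F] D} {S S' T T' : Submodule F D}
    (hS : S ≤ S') (hT : T ≤ T') : pSub mul S T ≤ pSub mul S' T' :=
  pSub_le fun _ hx _ hy => mul_mem_pSub (hS hx) (hT hy)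

lemma dSub_le {ml mr : D →ₗ[F] D →ₗ[F] D} {S T U : Submodule F D}
    (hl : ∀ x ∈ S, ∀ y ∈ T, ml x y ∈ U) (hr : ∀ x ∈ S, ∀ y ∈ T, mr x y ∈ U) :
    dSub ml mr S T ≤ U :=
  sup_le (pSub_le hl) (pSub_le hr)

lemma dSub_mono {ml mr : D →ₗ[F] D →ₗ[F] D} {S S' T T' : Submodule F D}
    (hS : S ≤ S') (hT : T ≤ T') : dSub ml mr S T ≤ dSub ml mr S' T' :=
  sup_le_sup (pSub_mono hS hT) (pSub_mono hS hT)

lemma genS_zero (ml mr : D →ₗ[F] D →ₗ[F] D) : genS ml mr 0 = ⊤ := by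
  rw [genS]

lemma genS_succ_le {ml mr : D →ₗ[F] D →ₗ[F] D} {k : ℕ} {U : Submodule F D}
    (h : ∀ i j, i + j = k → dSub ml mr (genS ml mr i) (genS ml mr j) ≤ U) :
    genS ml mr (k + 1) ≤ U := by
  rw [genS]
  refine Finset.sup_le fun i _ => h _ _ ?_
  have := Finset.mem_range.1 i.2
  omega

lemma dSub_genS_le (ml mr : D →ₗ[F] D →ₗ[F] D) (i j : ℕ) :
    dSub ml mr (genS ml mr i) (genS ml mr j) ≤ genS ml mr (i + j + 1) := by
  conv_rhs => rw [genS]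
  have hi : i ∈ Finset.range (i + j + 1) := Finset.mem_range.2 (by omega)
  have h := Finset.le_sup (f := fun a : Finset.range (i + j + 1) =>
    dSub ml mr (genS ml mr a.1) (genS ml mr (i + j - a.1)))
    (Finset.mem_attach _ ⟨i, hi⟩)
  simpa using h

/-- The one-sided series `R 0 = D`, `R (k + 1) = R k ⊣ D + D ⊢ R k`. -/
def sideS (ml mr : D →ₗ[F] D →ₗ[F] D) : ℕ → Submodule F D
  | 0 => ⊤
  | k + 1 => pSub ml (sideS ml mr k) ⊤ ⊔ pSub mr ⊤ (sideS ml mr k)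

lemma ml_mem_sideS {ml mr : D →ₗ[F] D →ₗ[F] D} {k : ℕ} {x : D}
    (hx : x ∈ sideS ml mr k) (y : D) : ml x y ∈ sideS ml mr (k + 1) :=
  Submodule.mem_sup_left (mul_mem_pSub hx Submodule.mem_top)

lemma mr_mem_sideS {ml mr : D →ₗ[F] D →ₗ[F] D} {k : ℕ} {y : D}
    (x : D) (hy : y ∈ sideS ml mr k) : mr x y ∈ sideS ml mr (k + 1) :=
  Submodule.mem_sup_right (mul_mem_pSub Submodule.mem_top hy)

lemma sideS_succ_le {ml mr : D →ₗ[F] D →ₗ[F] D} {k : ℕ} {U : Submodule F D}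
    (hl : ∀ x ∈ sideS ml mr k, ∀ y, ml x y ∈ U)
    (hr : ∀ x, ∀ y ∈ sideS ml mr k, mr x y ∈ U) : sideS ml mr (k + 1) ≤ U :=
  sup_le (pSub_le fun x hx y _ => hl x hx y) (pSub_le fun x _ y hy => hr x y hy)

lemma mr_mem_sideS_add {ml mr : D →ₗ[F] D →ₗ[F] D} (h : IsDias ml mr) (i : ℕ) :
    ∀ j, ∀ x ∈ sideS ml mr i, ∀ y ∈ sideS ml mr j, mr x y ∈ sideS ml mr (i + j + 1) := by
  obtain ⟨-, hrr, -, -, hlr⟩ := h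
  induction i with
  | zero =>
    intro j x _ y hy
    simpa using mr_mem_sideS x hy
  | succ i ih =>
    intro j x hx y hy
    have hle : sideS ml mr (i + 1) ≤
        (sideS ml mr (i + 1 + j + 1)).comap (mr.flip y) := by
      refine sideS_succ_le (fun x' hx' l => ?_) (fun l x' hx' => ?_)
      · have := ih (j + 1) x' hx' _ (mr_mem_sideS l hy)
        rw [Submodule.mem_comap, LinearMap.flip_apply, hlr, hrr]
        rwa [show i + (j + 1) + 1 = i + 1 + j + 1 by omega] at this
      · have := mr_mem_sideS l (ih j x' hx' y hy)
        rw [Submodule.mem_comap, LinearMap.flip_apply, hrr]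
        rwa [show i + j + 1 + 1 = i + 1 + j + 1 by omega] at this
    exact hle hx

lemma ml_mem_sideS_add {ml mr : D →ₗ[F] D →ₗ[F] D} (h : IsDias ml mr) (j : ℕ) :
    ∀ i, ∀ x ∈ sideS ml mr i, ∀ y ∈ sideS ml mr j, ml x y ∈ sideS ml mr (i + j + 1) := by
  obtain ⟨hll, -, hlr, -, -⟩ := h
  induction j with
  | zero =>
    intro i x hx y _
    exact ml_mem_sideS hx y
  | succ j ih =>
    intro i x hx y hy
    have hle : sideS ml mr (j + 1) ≤
        (sideS ml mr (i + (j + 1) + 1)).comap (ml x) := by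
      refine sideS_succ_le (fun y' hy' l => ?_) (fun l y' hy' => ?_)
      · rw [Submodule.mem_comap, ← hll]
        exact ml_mem_sideS (ih i x hx y' hy') l
      · have := ih (i + 1) _ (ml_mem_sideS hx l) y' hy'
        rw [Submodule.mem_comap, ← hlr, ← hll]
        rwa [show i + 1 + j + 1 = i + (j + 1) + 1 by omega] at this
    exact hle hy

/-- In a diassociative algebra the general lower central series is contained in the one-sided
series. -/
lemma genS_le_sideS {ml mr : D →ₗ[F] D →ₗ[F] D} (h : IsDias ml mr) (k : ℕ) :
    genS ml mr k ≤ sideS ml mr k := by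
  induction k using Nat.strong_induction_on with
  | _ k ih =>
    cases k with
    | zero => exact le_top
    | succ k =>
      refine genS_succ_le ?_
      rintro i j rfl
      have hi := ih i (by omega)
      have hj := ih j (by omega)
      exact dSub_le (fun x hx y hy => ml_mem_sideS_add h j i x (hi hx) y (hj hy))
        (fun x hx y hy => mr_mem_sideS_add h i j x (hi hx) y (hj hy))

lemma sideS_le_genS (ml mr : D →ₗ[F] D →ₗ[F] D) (k : ℕ) :
    sideS ml mr k ≤ genS ml mr k := by
  induction k with
  | zero => rw [genS_zero]; exact le_top
  | succ k ih =>
    have h1 := dSub_genS_le ml mr k 0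
    have h2 := dSub_genS_le ml mr 0 k
    rw [genS_zero] at h1 h2
    rw [Nat.zero_add] at h2
    exact sup_le ((pSub_mono ih le_rfl).trans (le_sup_left.trans h1))
      ((pSub_mono le_rfl ih).trans (le_sup_right.trans h2))

/-- In a diassociative algebra `D^{k+1} = D^k ⊣ D + D ⊢ D^k`. -/
lemma genS_succ_eq {ml mr : D →ₗ[F] D →ₗ[F] D} (h : IsDias ml mr) (k : ℕ) :
    genS ml mr (k + 1) = pSub ml (genS ml mr k) ⊤ ⊔ pSub mr ⊤ (genS ml mr k) := by
  have heq k : genS ml mr k = sideS ml mr k :=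
    (genS_le_sideS h k).antisymm (sideS_le_genS ml mr k)
  rw [heq, heq, sideS]

lemma genS_le_comap {E : Type*} [AddCommGroup E] [Module F E]
    {ml mr : D →ₗ[F] D →ₗ[F] D} {ml' mr' : E →ₗ[F] E →ₗ[F] E} (f : D →ₗ[F] E)
    (hl : ∀ x y, f (ml x y) = ml' (f x) (f y))
    (hr : ∀ x y, f (mr x y) = mr' (f x) (f y)) (k : ℕ) :
    genS ml mr k ≤ (genS ml' mr' k).comap f := by
  induction k using Nat.strong_induction_on with
  | _ k ih =>
    cases k with
    | zero => rw [genS_zero ml', Submodule.comap_top]; exact le_top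
    | succ k =>
      refine genS_succ_le ?_
      rintro i j rfl
      have hi := ih i (by omega)
      have hj := ih j (by omega)
      have hle := dSub_genS_le ml' mr' i j
      refine dSub_le (fun x hx y hy => hle ?_) (fun x hx y hy => hle ?_)
      · rw [hl]
        exact Submodule.mem_sup_left (mul_mem_pSub (hi hx) (hj hy))
      · rw [hr]
        exact Submodule.mem_sup_right (mul_mem_pSub (hi hx) (hj hy))

end Products

theorem prop_dias {A L B : Type*}
    [AddCommGroup A] [Module F A] [AddCommGroup L] [Module F L]
    [AddCommGroup B] [Module F B]
    (mlA mrA : A →ₗ[F] A →ₗ[F] A) (mlL mrL : L →ₗ[F] L →ₗ[F] L)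
    (mlB mrB : B →ₗ[F] B →ₗ[F] B)
    -- the three algebras are diassociative algebras
    (hA : IsDias mlA mrA) (hL : IsDias mlL mrL) (hB : IsDias mlB mrB)
    -- `0 → A --σ--> L --π--> B → 0` is an extension of `A` by `B`
    (σ : A →ₗ[F] L) (π : L →ₗ[F] B)
    (hσl : ∀ x y, σ (mlA x y) = mlL (σ x) (σ y))
    (hσr : ∀ x y, σ (mrA x y) = mrL (σ x) (σ y))
    (hπl : ∀ x y, π (mlL x y) = mlB (π x) (π y))
    (hπr : ∀ x y, π (mrL x y) = mrB (π x) (π y))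
    (hσinj : Function.Injective σ) (hπsurj : Function.Surjective π)
    (hexact : LinearMap.range σ = LinearMap.ker π)
    -- `B` is nilpotent of class `s`
    (s : ℕ) (hBnil : genS mlB mrB s = ⊥) (hBclass : ∀ m < s, genS mlB mrB m ≠ ⊥)
    -- the sequence `A_0 = A`, `A_{k+1} = σ⁻¹(σ(A_k)◊L + L◊σ(A_k))`
    (Aseq : ℕ → Submodule F A) (hA0 : Aseq 0 = ⊤)
    (hAsucc : ∀ k, Aseq (k + 1) =
      Submodule.comap σ
        (dSub mlL mrL (Submodule.map σ (Aseq k)) ⊤ ⊔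
          dSub mlL mrL ⊤ (Submodule.map σ (Aseq k)))) :
    (∀ k, genS mlL mrL (k + s) ≤ Submodule.map σ (Aseq k) ∧
      Submodule.map σ (Aseq k) ≤ genS mlL mrL k) ∧
    ((∃ u, genS mlL mrL u = ⊥) ↔ ∃ k, Aseq k = ⊥) := by
  have hker : ∀ k, (Aseq k).map σ ≤ LinearMap.ker π := fun k =>
    hexact ▸ LinearMap.map_le_range
  have hlower : ∀ k, genS mlL mrL (k + s) ≤ (Aseq k).map σ := by
    intro k
    induction k with
    | zero =>
      rw [hA0, Submodule.map_top, hexact, Nat.zero_add]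
      have := genS_le_comap π hπl hπr s
      rwa [hBnil] at this
    | succ k ih =>
      rw [hAsucc, Submodule.map_comap_eq, hexact, Nat.add_right_comm,
        genS_succ_eq hL]
      refine sup_le (le_inf ?_ ?_) (le_inf ?_ ?_)
      · refine pSub_le fun x hx y _ => ?_
        have hx0 : π x = 0 := hker k (ih hx)
        simp [hπl, hx0]
      · exact (pSub_mono ih le_rfl).trans (le_sup_left.trans le_sup_left)
      · refine pSub_le fun x _ y hy => ?_
        have hy0 : π y = 0 := hker k (ih hy)
        simp [hπr, hy0]
      · exact (pSub_mono le_rfl ih).trans (le_sup_right.trans le_sup_right)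
  have hupper : ∀ k, (Aseq k).map σ ≤ genS mlL mrL k := by
    intro k
    induction k with
    | zero => rw [genS_zero]; exact le_top
    | succ k ih =>
      have h1 := dSub_genS_le mlL mrL k 0
      have h2 := dSub_genS_le mlL mrL 0 k
      rw [genS_zero] at h1 h2
      rw [Nat.zero_add] at h2
      rw [hAsucc]
      exact (Submodule.map_comap_le _ _).trans
        (sup_le ((dSub_mono ih le_rfl).trans h1) ((dSub_mono le_rfl ih).trans h2))
  refine ⟨fun k => ⟨hlower k, hupper k⟩, ?_, ?_⟩
  · rintro ⟨u, hu⟩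
    refine ⟨u, Submodule.map_injective_of_injective hσinj ?_⟩
    rw [Submodule.map_bot]
    exact le_bot_iff.1 (hu ▸ hupper u)
  · rintro ⟨k, hk⟩
    refine ⟨k + s, le_bot_iff.1 ?_⟩
    have := hlower k
    rwa [hk, Submodule.map_bot] at this

end Stmt10
end

section
/- Let A and B be diassociative algebras, let φ and ψ be tuples (φ_⊣, φ_⊢, φ'_⊣, φ'_⊢) and (ψ_⊣, ψ_⊢, ψ'_⊣, ψ'_⊢) of maps B → End(A) that are lifts of the same tuple, i.e., for each i ∈ B and * ∈ {⊣,⊢} there exist m_{*,i}, m'_{*,i} ∈ A with ψ_*(i)a = φ_*(i)a + m_{*,i}*a and ψ'_*(i)a = φ'_*(i)a + a*m'_{*,i} for all a ∈ A, and let N be an ideal of A which is both φ-invariant and ψ-invariant. Then G(N,φ) = G(N,ψ). -/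
/-!
STATEMENT 12: Let `A` and `B` be diassociative algebras, let `φ` and `ψ` be
tuples `(φ_⊣, φ_⊢, φ'_⊣, φ'_⊢)` and `(ψ_⊣, ψ_⊢, ψ'_⊣, ψ'_⊢)` of maps
`B → End(A)` that are lifts of the same tuple, and let `N` be an ideal of `A`
which is both `φ`-invariant and `ψ`-invariant.  Then `G(N,φ) = G(N,ψ)`, where
`G(N,φ)` is the smallest `φ`-invariant ideal of `A` containing `N⊣A`, `N⊢A`,
`A⊣N`, `A⊢N`, and all elements `φ_*(i)n`, `φ'_*(i)n`.
-/

namespace Stmt12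

variable {F : Type*} [Field F]

/-- `(ml, mr) = (⊣, ⊢)` makes `D` a diassociative algebra. -/
def IsDias {D : Type*} [AddCommGroup D] [Module F D]
    (ml mr : D →ₗ[F] D →ₗ[F] D) : Prop :=
  (∀ x y z : D, ml (ml x y) z = ml x (ml y z)) ∧
  (∀ x y z : D, mr (mr x y) z = mr x (mr y z)) ∧
  (∀ x y z : D, ml x (ml y z) = ml x (mr y z)) ∧
  (∀ x y z : D, ml (mr x y) z = mr x (ml y z)) ∧
  (∀ x y z : D, mr (ml x y) z = mr (mr x y) z)

/-- `G(N,φ)`: the smallest `φ`-invariant ideal of `A` containing `N⊣A`, `N⊢A`,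
`A⊣N`, `A⊢N`, and all elements `φ_*(i)n`, `φ'_*(i)n` for `i ∈ B`, `n ∈ N`,
`* ∈ {⊣,⊢}`. -/
def GidealD {A B : Type*} [AddCommGroup A] [Module F A]
    (mlA mrA : A →ₗ[F] A →ₗ[F] A) (φl φr φl' φr' : B → Module.End F A)
    (N : Submodule F A) : Submodule F A :=
  sInf {P : Submodule F A |
    (∀ a n : A, n ∈ P →
      mlA a n ∈ P ∧ mlA n a ∈ P ∧ mrA a n ∈ P ∧ mrA n a ∈ P) ∧
    (∀ i : B, ∀ n ∈ P, φl i n ∈ P ∧ φr i n ∈ P ∧ φl' i n ∈ P ∧ φr' i n ∈ P) ∧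
    (∀ a n : A, n ∈ N →
      mlA a n ∈ P ∧ mlA n a ∈ P ∧ mrA a n ∈ P ∧ mrA n a ∈ P) ∧
    (∀ i : B, ∀ n ∈ N, φl i n ∈ P ∧ φr i n ∈ P ∧ φl' i n ∈ P ∧ φr' i n ∈ P)}

/-- If the products of `Q` with the algebra land in `P`, then two lifts of the same tuple
map `Q` into `P` simultaneously. -/
theorem mapsTo_lift_iff {A B : Type*} [AddCommGroup A] [Module F A]
    {mlA mrA : A →ₗ[F] A →ₗ[F] A} {φl φr φl' φr' ψl ψr ψl' ψr' : B → Module.End F A}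
    (hlift : ∀ i : B, ∃ ml' mr' nl' nr' : A, ∀ a : A,
      ψl i a = φl i a + mlA ml' a ∧ ψr i a = φr i a + mrA mr' a ∧
      ψl' i a = φl' i a + mlA a nl' ∧ ψr' i a = φr' i a + mrA a nr')
    {P Q : Submodule F A}
    (h : ∀ a n : A, n ∈ Q → mlA a n ∈ P ∧ mlA n a ∈ P ∧ mrA a n ∈ P ∧ mrA n a ∈ P) :
    (∀ i : B, ∀ n ∈ Q, φl i n ∈ P ∧ φr i n ∈ P ∧ φl' i n ∈ P ∧ φr' i n ∈ P) ↔
      ∀ i : B, ∀ n ∈ Q, ψl i n ∈ P ∧ ψr i n ∈ P ∧ ψl' i n ∈ P ∧ ψr' i n ∈ P := by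
  refine forall_congr' fun i => forall₂_congr fun n hn => ?_
  obtain ⟨a, b, c, d, hi⟩ := hlift i
  obtain ⟨h₁, h₂, h₃, h₄⟩ := hi n
  rw [h₁, h₂, h₃, h₄, P.add_mem_iff_left (h a n hn).1, P.add_mem_iff_left (h b n hn).2.2.1,
    P.add_mem_iff_left (h c n hn).2.1, P.add_mem_iff_left (h d n hn).2.2.2]

theorem GidealD_eq_GidealD {A B : Type*}
    [AddCommGroup A] [Module F A] [AddCommGroup B] [Module F B]
    (mlA mrA : A →ₗ[F] A →ₗ[F] A) (mlB mrB : B →ₗ[F] B →ₗ[F] B)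
    -- `A` and `B` are diassociative algebras
    (hA : IsDias mlA mrA) (hB : IsDias mlB mrB)
    -- the tuples `φ = (φl, φr, φl', φr')` and `ψ = (ψl, ψr, ψl', ψr')`
    (φl φr φl' φr' ψl ψr ψl' ψr' : B → Module.End F A)
    -- the two tuples are lifts of the same tuple
    (hlift : ∀ i : B, ∃ ml' mr' nl' nr' : A, ∀ a : A,
      ψl i a = φl i a + mlA ml' a ∧ ψr i a = φr i a + mrA mr' a ∧
      ψl' i a = φl' i a + mlA a nl' ∧ ψr' i a = φr' i a + mrA a nr')
    -- `N` is an ideal of `A`, invariant under both tuples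
    (N : Submodule F A)
    (hN : ∀ a n : A, n ∈ N →
      mlA a n ∈ N ∧ mlA n a ∈ N ∧ mrA a n ∈ N ∧ mrA n a ∈ N)
    (hNφ : ∀ i : B, ∀ n ∈ N, φl i n ∈ N ∧ φr i n ∈ N ∧ φl' i n ∈ N ∧ φr' i n ∈ N)
    (hNψ : ∀ i : B, ∀ n ∈ N, ψl i n ∈ N ∧ ψr i n ∈ N ∧ ψl' i n ∈ N ∧ ψr' i n ∈ N) :
    GidealD mlA mrA φl φr φl' φr' N = GidealD mlA mrA ψl ψr ψl' ψr' N := by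
  unfold GidealD
  congr 1
  ext P
  exact and_congr_right fun hP => by
    rw [mapsTo_lift_iff hlift hP]
    exact and_congr_right fun _ => and_congr_right fun hNP => mapsTo_lift_iff hlift hNP

end Stmt12
end

section
/- Let A and B be diassociative algebras, let 0 → A --σ--> L --π--> B → 0 be an extension with section T : B → L, and define φ_*(i)m = σ⁻¹(T(i)*σ(m)) and φ'_*(i)m = σ⁻¹(σ(m)*T(i)) for * ∈ {⊣,⊢}. Define A_0 = A, A_{k+1} = σ⁻¹(σ(A_k)◊L + L◊σ(A_k)), and define G_0^B A = A, G_{k+1}^B A = G(G_k^B A, φ) where φ = (φ_⊣, φ_⊢, φ'_⊣, φ'_⊢). Then A_k = G_k^B A for all k ≥ 0. -/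
/-!
STATEMENT 13: Let `A` and `B` be diassociative algebras, let
`0 → A --σ--> L --π--> B → 0` be an extension with section `T : B → L`, and
define `φ_*(i)m = σ⁻¹(T(i)*σ(m))` and `φ'_*(i)m = σ⁻¹(σ(m)*T(i))` for
`* ∈ {⊣,⊢}`.  Define `A_0 = A`, `A_{k+1} = σ⁻¹(σ(A_k)◊L + L◊σ(A_k))`, and
define `G_0^B A = A`, `G_{k+1}^B A = G(G_k^B A, φ)` where
`φ = (φ_⊣, φ_⊢, φ'_⊣, φ'_⊢)`.  Then `A_k = G_k^B A` for all `k ≥ 0`.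
-/

namespace Stmt13

variable {F : Type*} [Field F]

/-- Subspace spanned by all products `s*t` with `s ∈ S`, `t ∈ T`. -/
def pSub {D : Type*} [AddCommGroup D] [Module F D]
    (mul : D →ₗ[F] D →ₗ[F] D) (S T : Submodule F D) : Submodule F D :=
  Submodule.span F {z | ∃ s ∈ S, ∃ t ∈ T, z = mul s t}

/-- `S ◊ T = S⊣T + S⊢T` for subspaces `S`, `T`. -/
def dSub {D : Type*} [AddCommGroup D] [Module F D]
    (ml mr : D →ₗ[F] D →ₗ[F] D) (S T : Submodule F D) : Submodule F D :=
  pSub ml S T ⊔ pSub mr S T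

/-- `(ml, mr) = (⊣, ⊢)` makes `D` a diassociative algebra. -/
def IsDias {D : Type*} [AddCommGroup D] [Module F D]
    (ml mr : D →ₗ[F] D →ₗ[F] D) : Prop :=
  (∀ x y z : D, ml (ml x y) z = ml x (ml y z)) ∧
  (∀ x y z : D, mr (mr x y) z = mr x (mr y z)) ∧
  (∀ x y z : D, ml x (ml y z) = ml x (mr y z)) ∧
  (∀ x y z : D, ml (mr x y) z = mr x (ml y z)) ∧
  (∀ x y z : D, mr (ml x y) z = mr (mr x y) z)

/-- `G(N,φ)`: the smallest `φ`-invariant ideal of `A` containing `N⊣A`, `N⊢A`,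
`A⊣N`, `A⊢N`, and all elements `φ_*(i)n`, `φ'_*(i)n` for `i ∈ B`, `n ∈ N`,
`* ∈ {⊣,⊢}`. -/
def GidealD {A B : Type*} [AddCommGroup A] [Module F A]
    (mlA mrA : A →ₗ[F] A →ₗ[F] A) (φl φr φl' φr' : B → Module.End F A)
    (N : Submodule F A) : Submodule F A :=
  sInf {P : Submodule F A |
    (∀ a n : A, n ∈ P →
      mlA a n ∈ P ∧ mlA n a ∈ P ∧ mrA a n ∈ P ∧ mrA n a ∈ P) ∧
    (∀ i : B, ∀ n ∈ P, φl i n ∈ P ∧ φr i n ∈ P ∧ φl' i n ∈ P ∧ φr' i n ∈ P) ∧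
    (∀ a n : A, n ∈ N →
      mlA a n ∈ P ∧ mlA n a ∈ P ∧ mrA a n ∈ P ∧ mrA n a ∈ P) ∧
    (∀ i : B, ∀ n ∈ N, φl i n ∈ P ∧ φr i n ∈ P ∧ φl' i n ∈ P ∧ φr' i n ∈ P)}

/-- `P` contains `N * A`, `A * N`, and all `φ_*(i) n`, `φ'_*(i) n` for `n ∈ N`. -/
def Absorbs {A B : Type*} [AddCommGroup A] [Module F A]
    (mlA mrA : A →ₗ[F] A →ₗ[F] A) (φl φr φl' φr' : B → Module.End F A)
    (N P : Submodule F A) : Prop :=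
  (∀ a n : A, n ∈ N →
    mlA a n ∈ P ∧ mlA n a ∈ P ∧ mrA a n ∈ P ∧ mrA n a ∈ P) ∧
  (∀ i : B, ∀ n ∈ N, φl i n ∈ P ∧ φr i n ∈ P ∧ φl' i n ∈ P ∧ φr' i n ∈ P)

theorem Absorbs.mono_left {A B : Type*} [AddCommGroup A] [Module F A]
    {mlA mrA : A →ₗ[F] A →ₗ[F] A} {φl φr φl' φr' : B → Module.End F A}
    {N M P : Submodule F A} (h : Absorbs mlA mrA φl φr φl' φr' N P) (hM : M ≤ N) :
    Absorbs mlA mrA φl φr φl' φr' M P :=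
  ⟨fun a n hn => h.1 a n (hM hn), fun i n hn => h.2 i n (hM hn)⟩

theorem dSub_le_iff {D : Type*} [AddCommGroup D] [Module F D]
    {ml mr : D →ₗ[F] D →ₗ[F] D} {S T P : Submodule F D} :
    dSub ml mr S T ≤ P ↔ ∀ s ∈ S, ∀ t ∈ T, ml s t ∈ P ∧ mr s t ∈ P := by
  simp only [dSub, pSub, sup_le_iff, Submodule.span_le]
  constructor
  · rintro ⟨h₁, h₂⟩ s hs t ht
    exact ⟨h₁ ⟨s, hs, t, ht, rfl⟩, h₂ ⟨s, hs, t, ht, rfl⟩⟩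
  · intro h
    constructor
    · rintro _ ⟨s, hs, t, ht, rfl⟩
      exact (h s hs t ht).1
    · rintro _ ⟨s, hs, t, ht, rfl⟩
      exact (h s hs t ht).2

theorem thm_dias {A L B : Type*}
    [AddCommGroup A] [Module F A] [AddCommGroup L] [Module F L]
    [AddCommGroup B] [Module F B]
    (mlA mrA : A →ₗ[F] A →ₗ[F] A) (mlL mrL : L →ₗ[F] L →ₗ[F] L)
    (mlB mrB : B →ₗ[F] B →ₗ[F] B)
    -- the three algebras are diassociative algebras
    (hA : IsDias mlA mrA) (hL : IsDias mlL mrL) (hB : IsDias mlB mrB)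
    -- `0 → A --σ--> L --π--> B → 0` is an extension of `A` by `B`
    (σ : A →ₗ[F] L) (π : L →ₗ[F] B)
    (hσl : ∀ x y, σ (mlA x y) = mlL (σ x) (σ y))
    (hσr : ∀ x y, σ (mrA x y) = mrL (σ x) (σ y))
    (hπl : ∀ x y, π (mlL x y) = mlB (π x) (π y))
    (hπr : ∀ x y, π (mrL x y) = mrB (π x) (π y))
    (hσinj : Function.Injective σ) (hπsurj : Function.Surjective π)
    (hexact : LinearMap.range σ = LinearMap.ker π)
    -- `T` is a section of the extension
    (T : B →ₗ[F] L) (hT : ∀ b, π (T b) = b)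
    -- `φ_*(i)m = σ⁻¹(T(i)*σ(m))` and `φ'_*(i)m = σ⁻¹(σ(m)*T(i))` for `* ∈ {⊣,⊢}`
    (φl φr φl' φr' : B → Module.End F A)
    (hφl : ∀ i m, σ (φl i m) = mlL (T i) (σ m))
    (hφr : ∀ i m, σ (φr i m) = mrL (T i) (σ m))
    (hφl' : ∀ i m, σ (φl' i m) = mlL (σ m) (T i))
    (hφr' : ∀ i m, σ (φr' i m) = mrL (σ m) (T i))
    -- the sequence `A_0 = A`, `A_{k+1} = σ⁻¹(σ(A_k)◊L + L◊σ(A_k))`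
    (Aseq : ℕ → Submodule F A) (hA0 : Aseq 0 = ⊤)
    (hAsucc : ∀ k, Aseq (k + 1) =
      Submodule.comap σ
        (dSub mlL mrL (Submodule.map σ (Aseq k)) ⊤ ⊔
          dSub mlL mrL ⊤ (Submodule.map σ (Aseq k))))
    -- the sequence `G_0^B A = A`, `G_{k+1}^B A = G(G_k^B A, φ)`
    (Gseq : ℕ → Submodule F A) (hG0 : Gseq 0 = ⊤)
    (hGsucc : ∀ k, Gseq (k + 1) = GidealD mlA mrA φl φr φl' φr' (Gseq k)) :
    ∀ k, Aseq k = Gseq k := by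
  have decomp (l : L) : ∃ a, l = σ a + T (π l) := by
    have hl : l - T (π l) ∈ LinearMap.range σ := by
      rw [hexact, LinearMap.mem_ker, map_sub, hT, sub_self]
    obtain ⟨a, ha⟩ := hl
    exact ⟨a, by rw [ha, sub_add_cancel]⟩
  have comap_le (N P : Submodule F A) (h : Absorbs mlA mrA φl φr φl' φr' N P) :
      Submodule.comap σ (dSub mlL mrL (Submodule.map σ N) ⊤ ⊔
        dSub mlL mrL ⊤ (Submodule.map σ N)) ≤ P := by
    rw [← Submodule.comap_map_eq_of_injective hσinj P]
    refine Submodule.comap_mono (sup_le (dSub_le_iff.2 ?_) (dSub_le_iff.2 ?_))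
    · rintro _ ⟨n, hn, rfl⟩ l -
      obtain ⟨a, ha⟩ := decomp l
      obtain ⟨-, h₁, -, h₂⟩ := h.1 a n hn
      obtain ⟨-, -, h₃, h₄⟩ := h.2 (π l) n hn
      rw [ha, map_add, map_add, ← hσl, ← hσr, ← hφl', ← hφr', ← map_add, ← map_add]
      exact ⟨Submodule.mem_map_of_mem (P.add_mem h₁ h₃),
        Submodule.mem_map_of_mem (P.add_mem h₂ h₄)⟩
    · rintro l - _ ⟨n, hn, rfl⟩
      obtain ⟨a, ha⟩ := decomp l
      obtain ⟨h₁, -, h₂, -⟩ := h.1 a n hn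
      obtain ⟨h₃, h₄, -, -⟩ := h.2 (π l) n hn
      rw [ha, map_add, map_add, LinearMap.add_apply, LinearMap.add_apply,
        ← hσl, ← hσr, ← hφl, ← hφr, ← map_add, ← map_add]
      exact ⟨Submodule.mem_map_of_mem (P.add_mem h₁ h₃),
        Submodule.mem_map_of_mem (P.add_mem h₂ h₄)⟩
  have absorbs_comap (N : Submodule F A) : Absorbs mlA mrA φl φr φl' φr' N
      (Submodule.comap σ (dSub mlL mrL (Submodule.map σ N) ⊤ ⊔
        dSub mlL mrL ⊤ (Submodule.map σ N))) := by
    have right (n : A) (hn : n ∈ N) (l : L) := dSub_le_iff.1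
      (le_sup_left : dSub mlL mrL (Submodule.map σ N) ⊤ ≤ _ ⊔
        dSub mlL mrL ⊤ (Submodule.map σ N))
      (σ n) (Submodule.mem_map_of_mem hn) l Submodule.mem_top
    have left (n : A) (hn : n ∈ N) (l : L) := dSub_le_iff.1
      (le_sup_right : dSub mlL mrL ⊤ (Submodule.map σ N) ≤
        dSub mlL mrL (Submodule.map σ N) ⊤ ⊔ _)
      l Submodule.mem_top (σ n) (Submodule.mem_map_of_mem hn)
    simp only [Absorbs, Submodule.mem_comap, hσl, hσr, hφl, hφr, hφl', hφr']
    exact ⟨fun a n hn => ⟨(left n hn _).1, (right n hn _).1, (left n hn _).2, (right n hn _).2⟩,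
      fun i n hn => ⟨(left n hn _).1, (left n hn _).2, (right n hn _).1, (right n hn _).2⟩⟩
  suffices h : ∀ k, Aseq k = Gseq k ∧ Absorbs mlA mrA φl φr φl' φr' (Aseq k) (Aseq k) from
    fun k => (h k).1
  intro k
  induction k with
  | zero => simp [hA0, hG0, Absorbs]
  | succ k ih =>
    obtain ⟨heq, hinv⟩ := ih
    have habs := absorbs_comap (Aseq k)
    have hself := habs.mono_left (comap_le _ _ hinv)
    rw [hGsucc, ← heq, hAsucc]
    refine ⟨le_antisymm (le_sInf ?_) (sInf_le ⟨hself.1, hself.2, habs.1, habs.2⟩), hself⟩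
    rintro P ⟨-, -, h₁, h₂⟩
    exact comap_le _ _ ⟨h₁, h₂⟩

end Stmt13
end

section
/- Let A and B be nilpotent diassociative algebras, let 0 → A --σ--> L --π--> B → 0 be an extension with section T, define φ_*(i)m = σ⁻¹(T(i)*σ(m)) and φ'_*(i)m = σ⁻¹(σ(m)*T(i)) for * ∈ {⊣,⊢}, and define G_0^B A = A, G_{k+1}^B A = G(G_k^B A, φ) where φ = (φ_⊣, φ_⊢, φ'_⊣, φ'_⊢). Then L is nilpotent if and only if B is nilpotent and G_u^B A = 0 for some u ≥ 1. -/
/-!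
STATEMENT 14: Let `A` and `B` be nilpotent diassociative algebras, let
`0 → A --σ--> L --π--> B → 0` be an extension with section `T`, define
`φ_*(i)m = σ⁻¹(T(i)*σ(m))` and `φ'_*(i)m = σ⁻¹(σ(m)*T(i))` for `* ∈ {⊣,⊢}`,
and define `G_0^B A = A`, `G_{k+1}^B A = G(G_k^B A, φ)` where
`φ = (φ_⊣, φ_⊢, φ'_⊣, φ'_⊢)`.  Then `L` is nilpotent if and only if `B` is
nilpotent and `G_u^B A = 0` for some `u ≥ 1`.
-/

namespace Stmt14

variable {F : Type*} [Field F]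

/-- Subspace spanned by all products `s*t` with `s ∈ S`, `t ∈ T`. -/
def pSub {D : Type*} [AddCommGroup D] [Module F D]
    (mul : D →ₗ[F] D →ₗ[F] D) (S T : Submodule F D) : Submodule F D :=
  Submodule.span F {z | ∃ s ∈ S, ∃ t ∈ T, z = mul s t}

/-- `S ◊ T = S⊣T + S⊢T` for subspaces `S`, `T`. -/
def dSub {D : Type*} [AddCommGroup D] [Module F D]
    (ml mr : D →ₗ[F] D →ₗ[F] D) (S T : Submodule F D) : Submodule F D :=
  pSub ml S T ⊔ pSub mr S T

/-- The general lower central series: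
`D^0 = D`, `D^{k+1} = Σ_{i=0}^{k} D^i ◊ D^{k-i}`. -/
def genS {D : Type*} [AddCommGroup D] [Module F D]
    (ml mr : D →ₗ[F] D →ₗ[F] D) : ℕ → Submodule F D
  | 0 => ⊤
  | k + 1 => (Finset.range (k + 1)).attach.sup fun i =>
      have _h1 : i.1 < k + 1 := Finset.mem_range.mp i.2
      dSub ml mr (genS ml mr i.1) (genS ml mr (k - i.1))
  termination_by n => n
  decreasing_by
  · exact _h1
  · omega

/-- `(ml, mr) = (⊣, ⊢)` makes `D` a diassociative algebra. -/
def IsDias {D : Type*} [AddCommGroup D] [Module F D]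
    (ml mr : D →ₗ[F] D →ₗ[F] D) : Prop :=
  (∀ x y z : D, ml (ml x y) z = ml x (ml y z)) ∧
  (∀ x y z : D, mr (mr x y) z = mr x (mr y z)) ∧
  (∀ x y z : D, ml x (ml y z) = ml x (mr y z)) ∧
  (∀ x y z : D, ml (mr x y) z = mr x (ml y z)) ∧
  (∀ x y z : D, mr (ml x y) z = mr (mr x y) z)

/-- `G(N,φ)`: the smallest `φ`-invariant ideal of `A` containing `N⊣A`, `N⊢A`,
`A⊣N`, `A⊢N`, and all elements `φ_*(i)n`, `φ'_*(i)n` for `i ∈ B`, `n ∈ N`,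
`* ∈ {⊣,⊢}`. -/
def GidealD {A B : Type*} [AddCommGroup A] [Module F A]
    (mlA mrA : A →ₗ[F] A →ₗ[F] A) (φl φr φl' φr' : B → Module.End F A)
    (N : Submodule F A) : Submodule F A :=
  sInf {P : Submodule F A |
    (∀ a n : A, n ∈ P →
      mlA a n ∈ P ∧ mlA n a ∈ P ∧ mrA a n ∈ P ∧ mrA n a ∈ P) ∧
    (∀ i : B, ∀ n ∈ P, φl i n ∈ P ∧ φr i n ∈ P ∧ φl' i n ∈ P ∧ φr' i n ∈ P) ∧
    (∀ a n : A, n ∈ N →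
      mlA a n ∈ P ∧ mlA n a ∈ P ∧ mrA a n ∈ P ∧ mrA n a ∈ P) ∧
    (∀ i : B, ∀ n ∈ N, φl i n ∈ P ∧ φr i n ∈ P ∧ φl' i n ∈ P ∧ φr' i n ∈ P)}

section LowerCentralSeries

variable {D : Type*} [AddCommGroup D] [Module F D] {ml mr : D →ₗ[F] D →ₗ[F] D}

theorem dSub_le_iff {S T P : Submodule F D} :
    dSub ml mr S T ≤ P ↔ ∀ s ∈ S, ∀ t ∈ T, ml s t ∈ P ∧ mr s t ∈ P := by
  simp only [dSub, pSub, sup_le_iff, Submodule.span_le]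
  constructor
  · rintro ⟨h₁, h₂⟩ s hs t ht
    exact ⟨h₁ ⟨s, hs, t, ht, rfl⟩, h₂ ⟨s, hs, t, ht, rfl⟩⟩
  · intro h
    constructor
    · rintro _ ⟨s, hs, t, ht, rfl⟩
      exact (h s hs t ht).1
    · rintro _ ⟨s, hs, t, ht, rfl⟩
      exact (h s hs t ht).2

theorem mul_mem_dSub {S T : Submodule F D} {s t : D} (hs : s ∈ S) (ht : t ∈ T) :
    ml s t ∈ dSub ml mr S T ∧ mr s t ∈ dSub ml mr S T :=
  dSub_le_iff.1 le_rfl s hs t ht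

theorem dSub_mono {S S' T T' : Submodule F D} (hS : S ≤ S') (hT : T ≤ T') :
    dSub ml mr S T ≤ dSub ml mr S' T' :=
  dSub_le_iff.2 fun _ hs _ ht => mul_mem_dSub (hS hs) (hT ht)

theorem genS_zero : genS ml mr 0 = ⊤ := by
  rw [genS]

theorem genS_succ_le_iff {k : ℕ} {P : Submodule F D} :
    genS ml mr (k + 1) ≤ P ↔
      ∀ i j, i + j = k → dSub ml mr (genS ml mr i) (genS ml mr j) ≤ P := by
  rw [genS, Finset.sup_le_iff]
  constructor
  · rintro h i j rfl
    simpa using h ⟨i, Finset.mem_range.2 (by omega)⟩ (Finset.mem_attach _ _)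
  · rintro h ⟨i, hi⟩ -
    exact h i (k - i) (by have := Finset.mem_range.1 hi; omega)

theorem dSub_genS_le (i j : ℕ) :
    dSub ml mr (genS ml mr i) (genS ml mr j) ≤ genS ml mr (i + j + 1) :=
  genS_succ_le_iff.1 le_rfl i j rfl

theorem genS_antitone : Antitone (genS ml mr) := by
  refine antitone_nat_of_succ_le fun n => ?_
  induction n using Nat.strong_induction_on with
  | _ n ih =>
    rcases n with _ | k
    · simp [genS_zero]
    · rw [genS_succ_le_iff]
      rintro (_ | i) j hij
      · obtain rfl : j = k + 1 := by omega
        refine (dSub_mono le_rfl (ih k (by omega))).trans ?_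
        simpa using dSub_genS_le (ml := ml) (mr := mr) 0 k
      · obtain rfl : k = i + j := by omega
        exact (dSub_mono (ih i (by omega)) le_rfl).trans (dSub_genS_le i j)

theorem mul_mem_genS_succ {k : ℕ} {x : D} (hx : x ∈ genS ml mr k) (y : D) :
    ml y x ∈ genS ml mr (k + 1) ∧ ml x y ∈ genS ml mr (k + 1) ∧
      mr y x ∈ genS ml mr (k + 1) ∧ mr x y ∈ genS ml mr (k + 1) := by
  have hy : y ∈ genS ml mr 0 := by simp [genS_zero]
  have hl := dSub_le_iff.1 (dSub_genS_le (ml := ml) (mr := mr) 0 k) y hy x hx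
  have hr := dSub_le_iff.1 (dSub_genS_le (ml := ml) (mr := mr) k 0) x hx y hy
  rw [Nat.zero_add] at hl
  exact ⟨hl.1, hr.1, hl.2, hr.2⟩

/-- The two-sided lower central series, whose terms are obtained by multiplying the previous term
by the whole algebra on either side. -/
def twoSidedSeries (ml mr : D →ₗ[F] D →ₗ[F] D) : ℕ → Submodule F D
  | 0 => ⊤
  | k + 1 => dSub ml mr ⊤ (twoSidedSeries ml mr k) ⊔ dSub ml mr (twoSidedSeries ml mr k) ⊤

theorem twoSidedSeries_le_genS (k : ℕ) : twoSidedSeries ml mr k ≤ genS ml mr k := by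
  induction k with
  | zero => simp [genS_zero]
  | succ k ih =>
    refine sup_le (dSub_le_iff.2 fun s _ t ht => ?_) (dSub_le_iff.2 fun s hs t _ => ?_)
    · have h := mul_mem_genS_succ (ih ht) s
      exact ⟨h.1, h.2.2.1⟩
    · have h := mul_mem_genS_succ (ih hs) t
      exact ⟨h.2.1, h.2.2.2⟩

theorem dSub_twoSidedSeries_le (hD : IsDias ml mr) (i j : ℕ) :
    dSub ml mr (twoSidedSeries ml mr i) (twoSidedSeries ml mr j) ≤
      twoSidedSeries ml mr (i + j + 1) := by
  obtain ⟨hll, hrr, -, hrl, hlr⟩ := hD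
  induction i generalizing j with
  | zero =>
    rw [Nat.zero_add]
    exact le_sup_left
  | succ i ih =>
    have left_mul {k : ℕ} {y : D} (hy : y ∈ twoSidedSeries ml mr k) (x : D) :
        ml x y ∈ twoSidedSeries ml mr (k + 1) ∧ mr x y ∈ twoSidedSeries ml mr (k + 1) :=
      dSub_le_iff.1 le_sup_left x Submodule.mem_top y hy
    have mul_mem {k : ℕ} {x y : D} (hx : x ∈ twoSidedSeries ml mr i)
        (hy : y ∈ twoSidedSeries ml mr k) := dSub_le_iff.1 (ih k) x hx y hy
    -- every product `(x * z) * y` can be rebracketed as `x * (z * y)`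
    have rebracket {P : Submodule F D} {x z y : D}
        (hl : ml x (ml z y) ∈ P ∧ mr x (ml z y) ∈ P) (hr : mr x (mr z y) ∈ P) :
        (ml (ml x z) y ∈ P ∧ mr (ml x z) y ∈ P) ∧ ml (mr x z) y ∈ P ∧ mr (mr x z) y ∈ P := by
      rw [hlr, hrr, hll, hrl]
      exact ⟨⟨hl.1, hr⟩, hl.2, hr⟩
    refine dSub_le_iff.2 fun x hx y hy => ?_
    let P := twoSidedSeries ml mr (i + 1 + j + 1)
    suffices h : twoSidedSeries ml mr (i + 1) ≤ P.comap (ml.flip y) ⊓ P.comap (mr.flip y) from h hx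
    refine sup_le (dSub_le_iff.2 fun s _ t ht => ?_) (dSub_le_iff.2 fun s hs t _ => ?_)
    · have hty := mul_mem ht hy
      have e : twoSidedSeries ml mr (i + j + 1 + 1) = P := congrArg _ (by omega)
      exact rebracket (P := P) (e ▸ left_mul hty.1 s) (e ▸ (left_mul hty.2 s).2)
    · have hty := left_mul hy t
      have e : twoSidedSeries ml mr (i + (j + 1) + 1) = P := congrArg _ (by omega)
      exact rebracket (P := P) (e ▸ mul_mem hs hty.1) (e ▸ (mul_mem hs hty.2).2)

theorem genS_le_twoSidedSeries (hD : IsDias ml mr) (k : ℕ) :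
    genS ml mr k ≤ twoSidedSeries ml mr k := by
  induction k using Nat.strong_induction_on with
  | _ k ih =>
    rcases k with _ | k
    · exact le_top
    · rw [genS_succ_le_iff]
      rintro i j rfl
      exact (dSub_mono (ih i (by omega)) (ih j (by omega))).trans (dSub_twoSidedSeries_le hD i j)

theorem genS_le_comap {E : Type*} [AddCommGroup E] [Module F E] {ml' mr' : E →ₗ[F] E →ₗ[F] E}
    (f : D →ₗ[F] E) (hl : ∀ x y, f (ml x y) = ml' (f x) (f y))
    (hr : ∀ x y, f (mr x y) = mr' (f x) (f y)) (k : ℕ) :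
    genS ml mr k ≤ (genS ml' mr' k).comap f := by
  induction k using Nat.strong_induction_on with
  | _ k ih =>
    rcases k with _ | k
    · simp [genS_zero]
    · rw [genS_succ_le_iff]
      rintro i j rfl
      refine dSub_le_iff.2 fun x hx y hy => ?_
      simp only [Submodule.mem_comap, hl, hr]
      exact dSub_le_iff.1 (dSub_genS_le i j) _ (ih i (by omega) hx) _ (ih j (by omega) hy)

end LowerCentralSeries

section GidealD

variable {A B : Type*} [AddCommGroup A] [Module F A] {mlA mrA : A →ₗ[F] A →ₗ[F] A}
  {φl φr φl' φr' : B → Module.End F A} {N : Submodule F A} {n : A}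

theorem mul_mem_GidealD (hn : n ∈ N) (a : A) :
    mlA a n ∈ GidealD mlA mrA φl φr φl' φr' N ∧ mlA n a ∈ GidealD mlA mrA φl φr φl' φr' N ∧
      mrA a n ∈ GidealD mlA mrA φl φr φl' φr' N ∧ mrA n a ∈ GidealD mlA mrA φl φr φl' φr' N := by
  simp only [GidealD, Submodule.mem_sInf]
  exact ⟨fun P hP => (hP.2.2.1 a n hn).1, fun P hP => (hP.2.2.1 a n hn).2.1,
    fun P hP => (hP.2.2.1 a n hn).2.2.1, fun P hP => (hP.2.2.1 a n hn).2.2.2⟩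

theorem action_mem_GidealD (hn : n ∈ N) (i : B) :
    φl i n ∈ GidealD mlA mrA φl φr φl' φr' N ∧ φr i n ∈ GidealD mlA mrA φl φr φl' φr' N ∧
      φl' i n ∈ GidealD mlA mrA φl φr φl' φr' N ∧ φr' i n ∈ GidealD mlA mrA φl φr φl' φr' N := by
  simp only [GidealD, Submodule.mem_sInf]
  exact ⟨fun P hP => (hP.2.2.2 i n hn).1, fun P hP => (hP.2.2.2 i n hn).2.1,
    fun P hP => (hP.2.2.2 i n hn).2.2.1, fun P hP => (hP.2.2.2 i n hn).2.2.2⟩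

end GidealD

theorem nilpotent_iff {A L B : Type*}
    [AddCommGroup A] [Module F A] [AddCommGroup L] [Module F L]
    [AddCommGroup B] [Module F B]
    (mlA mrA : A →ₗ[F] A →ₗ[F] A) (mlL mrL : L →ₗ[F] L →ₗ[F] L)
    (mlB mrB : B →ₗ[F] B →ₗ[F] B)
    -- the three algebras are diassociative algebras
    (hA : IsDias mlA mrA) (hL : IsDias mlL mrL) (hB : IsDias mlB mrB)
    -- `A` and `B` are nilpotent
    (hAnil : ∃ u, genS mlA mrA u = ⊥) (hBnil : ∃ u, genS mlB mrB u = ⊥)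
    -- `0 → A --σ--> L --π--> B → 0` is an extension of `A` by `B`
    (σ : A →ₗ[F] L) (π : L →ₗ[F] B)
    (hσl : ∀ x y, σ (mlA x y) = mlL (σ x) (σ y))
    (hσr : ∀ x y, σ (mrA x y) = mrL (σ x) (σ y))
    (hπl : ∀ x y, π (mlL x y) = mlB (π x) (π y))
    (hπr : ∀ x y, π (mrL x y) = mrB (π x) (π y))
    (hσinj : Function.Injective σ) (hπsurj : Function.Surjective π)
    (hexact : LinearMap.range σ = LinearMap.ker π)
    -- `T` is a section of the extension
    (T : B →ₗ[F] L) (hT : ∀ b, π (T b) = b)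
    -- `φ_*(i)m = σ⁻¹(T(i)*σ(m))` and `φ'_*(i)m = σ⁻¹(σ(m)*T(i))` for `* ∈ {⊣,⊢}`
    (φl φr φl' φr' : B → Module.End F A)
    (hφl : ∀ i m, σ (φl i m) = mlL (T i) (σ m))
    (hφr : ∀ i m, σ (φr i m) = mrL (T i) (σ m))
    (hφl' : ∀ i m, σ (φl' i m) = mlL (σ m) (T i))
    (hφr' : ∀ i m, σ (φr' i m) = mrL (σ m) (T i))
    -- the sequence `G_0^B A = A`, `G_{k+1}^B A = G(G_k^B A, φ)`
    (Gseq : ℕ → Submodule F A) (hG0 : Gseq 0 = ⊤)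
    (hGsucc : ∀ k, Gseq (k + 1) = GidealD mlA mrA φl φr φl' φr' (Gseq k)) :
    (∃ u, genS mlL mrL u = ⊥) ↔
      (∃ u, genS mlB mrB u = ⊥) ∧ ∃ u, 1 ≤ u ∧ Gseq u = ⊥ := by
  constructor
  · rintro ⟨u, hu⟩
    refine ⟨hBnil, u + 1, by omega, ?_⟩
    have hle : ∀ k, Gseq k ≤ (genS mlL mrL k).comap σ := by
      intro k
      induction k with
      | zero => simp [genS_zero]
      | succ k ih =>
        have hmul : ∀ a n : A, σ n ∈ genS mlL mrL k →
            σ (mlA a n) ∈ genS mlL mrL (k + 1) ∧ σ (mlA n a) ∈ genS mlL mrL (k + 1) ∧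
            σ (mrA a n) ∈ genS mlL mrL (k + 1) ∧ σ (mrA n a) ∈ genS mlL mrL (k + 1) := by
          intro a n hn
          rw [hσl, hσl, hσr, hσr]
          exact mul_mem_genS_succ hn (σ a)
        have hact : ∀ (i : B) (n : A), σ n ∈ genS mlL mrL k →
            σ (φl i n) ∈ genS mlL mrL (k + 1) ∧ σ (φr i n) ∈ genS mlL mrL (k + 1) ∧
            σ (φl' i n) ∈ genS mlL mrL (k + 1) ∧ σ (φr' i n) ∈ genS mlL mrL (k + 1) := by
          intro i n hn
          rw [hφl, hφr, hφl', hφr']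
          obtain ⟨h₁, h₂, h₃, h₄⟩ := mul_mem_genS_succ hn (T i)
          exact ⟨h₁, h₃, h₂, h₄⟩
        have hanti := genS_antitone (ml := mlL) (mr := mrL) (Nat.le_succ k)
        rw [hGsucc]
        exact sInf_le ⟨fun a n hn => hmul a n (hanti hn), fun i n hn => hact i n (hanti hn),
          fun a n hn => hmul a n (ih hn), fun i n hn => hact i n (ih hn)⟩
    refine eq_bot_iff.2 fun a ha => ?_
    have h : σ a ∈ genS mlL mrL u := genS_antitone (Nat.le_succ u) (hle (u + 1) ha)
    rw [hu, Submodule.mem_bot] at h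
    exact (Submodule.mem_bot F).2 (hσinj (h.trans (map_zero σ).symm))
  · rintro ⟨⟨v, hv⟩, u, -, hu⟩
    have hstep : ∀ (k : ℕ) (l : L) (g : A), g ∈ Gseq k →
        mlL l (σ g) ∈ (Gseq (k + 1)).map σ ∧ mrL l (σ g) ∈ (Gseq (k + 1)).map σ ∧
        mlL (σ g) l ∈ (Gseq (k + 1)).map σ ∧ mrL (σ g) l ∈ (Gseq (k + 1)).map σ := by
      intro k l g hg
      obtain ⟨a, ha⟩ : l - T (π l) ∈ LinearMap.range σ := by
        rw [hexact, LinearMap.mem_ker, map_sub, hT, sub_self]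
      have hl : l = T (π l) + σ a := by rw [ha, add_sub_cancel]
      obtain ⟨p₁, p₂, p₃, p₄⟩ :=
        mul_mem_GidealD (mlA := mlA) (mrA := mrA) (φl := φl) (φr := φr) (φl' := φl') (φr' := φr')
          hg a
      obtain ⟨q₁, q₂, q₃, q₄⟩ :=
        action_mem_GidealD (mlA := mlA) (mrA := mrA) (φl := φl) (φr := φr) (φl' := φl')
          (φr' := φr') hg (π l)
      rw [hGsucc, hl]
      simp only [map_add, LinearMap.add_apply, ← hφl, ← hφr, ← hφl', ← hφr', ← hσl, ← hσr]
      simp only [← map_add]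
      exact ⟨Submodule.mem_map_of_mem (add_mem q₁ p₁), Submodule.mem_map_of_mem (add_mem q₂ p₃),
        Submodule.mem_map_of_mem (add_mem q₃ p₂), Submodule.mem_map_of_mem (add_mem q₄ p₄)⟩
    have hle : ∀ k, twoSidedSeries mlL mrL (v + k) ≤ (Gseq k).map σ := by
      intro k
      induction k with
      | zero =>
        intro x hx
        have h := genS_le_comap π hπl hπr v (twoSidedSeries_le_genS v hx)
        rw [hv, Submodule.mem_comap, Submodule.mem_bot, ← LinearMap.mem_ker, ← hexact] at h
        rwa [hG0, Submodule.map_top]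
      | succ k ih =>
        refine sup_le (dSub_le_iff.2 fun s _ t ht => ?_) (dSub_le_iff.2 fun s hs t _ => ?_)
        · obtain ⟨g, hg, rfl⟩ := ih ht
          have h := hstep k s g hg
          exact ⟨h.1, h.2.1⟩
        · obtain ⟨g, hg, rfl⟩ := ih hs
          exact (hstep k t g hg).2.2
    refine ⟨v + u, eq_bot_iff.2 ?_⟩
    simpa [hu] using (genS_le_twoSidedSeries hL (v + u)).trans (hle u)

end Stmt14
end

section
/- Let A and B be nilpotent diassociative algebras, let 0 → A --σ--> L --π--> B → 0 be an extension with section T, define φ_*(i)m = σ⁻¹(T(i)*σ(m)) and φ'_*(i)m = σ⁻¹(σ(m)*T(i)) for * ∈ {⊣,⊢}, and suppose L is nilpotent. Then max(nil_B A, nil B) ≤ nil L ≤ nil_B A + nil B. -/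
/-!
STATEMENT 15: Let `A` and `B` be nilpotent diassociative algebras, let
`0 → A --σ--> L --π--> B → 0` be an extension with section `T`, define
`φ_*(i)m = σ⁻¹(T(i)*σ(m))` and `φ'_*(i)m = σ⁻¹(σ(m)*T(i))` for `* ∈ {⊣,⊢}`,
and suppose `L` is nilpotent.  Then
`max(nil_B A, nil B) ≤ nil L ≤ nil_B A + nil B`.

Nilpotency classes are encoded by their defining property: `nil D = u` iff
`D^u = 0` and `D^{u-1} ≠ 0` (general lower central series), and `nil_B A = u`
iff `G_u^B A = 0` and `G_{u-1}^B A ≠ 0`.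
-/

namespace Stmt15

variable {F : Type*} [Field F]

/-- Subspace spanned by all products `s*t` with `s ∈ S`, `t ∈ T`. -/
def pSub {D : Type*} [AddCommGroup D] [Module F D]
    (mul : D →ₗ[F] D →ₗ[F] D) (S T : Submodule F D) : Submodule F D :=
  Submodule.span F {z | ∃ s ∈ S, ∃ t ∈ T, z = mul s t}

/-- `S ◊ T = S⊣T + S⊢T` for subspaces `S`, `T`. -/
def dSub {D : Type*} [AddCommGroup D] [Module F D]
    (ml mr : D →ₗ[F] D →ₗ[F] D) (S T : Submodule F D) : Submodule F D :=
  pSub ml S T ⊔ pSub mr S T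

/-- The general lower central series:
`D^0 = D`, `D^{k+1} = Σ_{i=0}^{k} D^i ◊ D^{k-i}`. -/
def genS {D : Type*} [AddCommGroup D] [Module F D]
    (ml mr : D →ₗ[F] D →ₗ[F] D) : ℕ → Submodule F D
  | 0 => ⊤
  | k + 1 => (Finset.range (k + 1)).attach.sup fun i =>
      have _h1 : i.1 < k + 1 := Finset.mem_range.mp i.2
      dSub ml mr (genS ml mr i.1) (genS ml mr (k - i.1))
  termination_by n => n
  decreasing_by
  · exact _h1
  · omega

/-- `(ml, mr) = (⊣, ⊢)` makes `D` a diassociative algebra. -/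
def IsDias {D : Type*} [AddCommGroup D] [Module F D]
    (ml mr : D →ₗ[F] D →ₗ[F] D) : Prop :=
  (∀ x y z : D, ml (ml x y) z = ml x (ml y z)) ∧
  (∀ x y z : D, mr (mr x y) z = mr x (mr y z)) ∧
  (∀ x y z : D, ml x (ml y z) = ml x (mr y z)) ∧
  (∀ x y z : D, ml (mr x y) z = mr x (ml y z)) ∧
  (∀ x y z : D, mr (ml x y) z = mr (mr x y) z)

/-- `G(N,φ)`: the smallest `φ`-invariant ideal of `A` containing `N⊣A`, `N⊢A`,
`A⊣N`, `A⊢N`, and all elements `φ_*(i)n`, `φ'_*(i)n` for `i ∈ B`, `n ∈ N`,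
`* ∈ {⊣,⊢}`. -/
def GidealD {A B : Type*} [AddCommGroup A] [Module F A]
    (mlA mrA : A →ₗ[F] A →ₗ[F] A) (φl φr φl' φr' : B → Module.End F A)
    (N : Submodule F A) : Submodule F A :=
  sInf {P : Submodule F A |
    (∀ a n : A, n ∈ P →
      mlA a n ∈ P ∧ mlA n a ∈ P ∧ mrA a n ∈ P ∧ mrA n a ∈ P) ∧
    (∀ i : B, ∀ n ∈ P, φl i n ∈ P ∧ φr i n ∈ P ∧ φl' i n ∈ P ∧ φr' i n ∈ P) ∧
    (∀ a n : A, n ∈ N →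
      mlA a n ∈ P ∧ mlA n a ∈ P ∧ mrA a n ∈ P ∧ mrA n a ∈ P) ∧
    (∀ i : B, ∀ n ∈ N, φl i n ∈ P ∧ φr i n ∈ P ∧ φl' i n ∈ P ∧ φr' i n ∈ P)}

section GeneralSeries

variable {D E : Type*} [AddCommGroup D] [Module F D] [AddCommGroup E] [Module F E]

theorem dSub_le_iff {ml mr : D →ₗ[F] D →ₗ[F] D} {S T P : Submodule F D} :
    dSub ml mr S T ≤ P ↔ ∀ x ∈ S, ∀ y ∈ T, ml x y ∈ P ∧ mr x y ∈ P := by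
  simp only [dSub, pSub, sup_le_iff, Submodule.span_le]
  constructor
  · rintro ⟨hl, hr⟩ x hx y hy
    exact ⟨hl ⟨x, hx, y, hy, rfl⟩, hr ⟨x, hx, y, hy, rfl⟩⟩
  · intro h
    constructor
    · rintro _ ⟨x, hx, y, hy, rfl⟩
      exact (h x hx y hy).1
    · rintro _ ⟨x, hx, y, hy, rfl⟩
      exact (h x hx y hy).2

theorem mul_mem_dSub (ml mr : D →ₗ[F] D →ₗ[F] D) {S T : Submodule F D} {x y : D}
    (hx : x ∈ S) (hy : y ∈ T) : ml x y ∈ dSub ml mr S T ∧ mr x y ∈ dSub ml mr S T :=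
  dSub_le_iff.1 le_rfl x hx y hy

theorem genS_zero (ml mr : D →ₗ[F] D →ₗ[F] D) : genS ml mr 0 = ⊤ := by
  rw [genS]

theorem genS_succ_le_iff_dSub {ml mr : D →ₗ[F] D →ₗ[F] D} {k : ℕ} {P : Submodule F D} :
    genS ml mr (k + 1) ≤ P ↔
      ∀ i j, i + j = k → dSub ml mr (genS ml mr i) (genS ml mr j) ≤ P := by
  rw [genS, Finset.sup_le_iff]
  constructor
  · rintro h i j rfl
    simpa using h ⟨i, Finset.mem_range.2 (by omega)⟩ (Finset.mem_attach _ _)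
  · rintro h ⟨i, hi⟩ -
    have := Finset.mem_range.1 hi
    exact h i (k - i) (by omega)

theorem genS_succ_le_iff {ml mr : D →ₗ[F] D →ₗ[F] D} {k : ℕ} {P : Submodule F D} :
    genS ml mr (k + 1) ≤ P ↔ ∀ i j, i + j = k →
      ∀ x ∈ genS ml mr i, ∀ y ∈ genS ml mr j, ml x y ∈ P ∧ mr x y ∈ P := by
  simp only [genS_succ_le_iff_dSub, dSub_le_iff]

theorem mul_mem_genS {ml mr : D →ₗ[F] D →ₗ[F] D} {i j k : ℕ} (hk : i + j + 1 = k) {x y : D}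
    (hx : x ∈ genS ml mr i) (hy : y ∈ genS ml mr j) :
    ml x y ∈ genS ml mr k ∧ mr x y ∈ genS ml mr k := by
  subst hk
  exact genS_succ_le_iff.1 le_rfl i j rfl x hx y hy

theorem genS_antitone (ml mr : D →ₗ[F] D →ₗ[F] D) : Antitone (genS ml mr) := by
  refine antitone_nat_of_succ_le fun k => ?_
  induction k using Nat.strong_induction_on with
  | _ k ih =>
    cases k with
    | zero => simp [genS_zero]
    | succ k =>
      refine genS_succ_le_iff.2 fun i j hij x hx y hy => ?_
      cases i with
      | zero =>
        obtain rfl : j = k + 1 := by omega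
        exact mul_mem_genS (by omega) hx (ih k (by omega) hy)
      | succ i => exact mul_mem_genS (by omega) (ih i (by omega) hx) hy

/-- Diassociativity allows every product to be rebracketed with its last factor split off. -/
theorem dSub_genS_le {ml mr : D →ₗ[F] D →ₗ[F] D} (h : IsDias ml mr) (i j : ℕ) :
    dSub ml mr (genS ml mr i) (genS ml mr j) ≤ dSub ml mr (genS ml mr (i + j)) ⊤ := by
  induction j using Nat.strong_induction_on generalizing i with
  | _ j ih =>
    cases j with
    | zero => simp [genS_zero]
    | succ j =>
      obtain ⟨hll, hrr, hlr, hrl, -⟩ := h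
      have hj : genS ml mr (j + 1) ≤ dSub ml mr (genS ml mr j) ⊤ := by
        refine genS_succ_le_iff_dSub.2 fun a b hab => ?_
        subst hab
        exact ih b (by omega) a
      refine dSub_le_iff.2 fun x hx y hy => ?_
      suffices hle : dSub ml mr (genS ml mr j) ⊤ ≤
          (dSub ml mr (genS ml mr (i + (j + 1))) ⊤).comap (ml x) ⊓
            (dSub ml mr (genS ml mr (i + (j + 1))) ⊤).comap (mr x) from hle (hj hy)
      refine dSub_le_iff.2 fun u hu v hv => ?_
      obtain ⟨hxl, hxr⟩ := mul_mem_genS (k := i + (j + 1)) (by omega) hx hu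
      obtain ⟨h₁, -⟩ := mul_mem_dSub ml mr hxl hv
      obtain ⟨h₂, h₃⟩ := mul_mem_dSub ml mr hxr hv
      simp only [Submodule.mem_inf, Submodule.mem_comap, ← hlr, ← hll, ← hrl, ← hrr]
      exact ⟨⟨h₁, h₂⟩, h₁, h₃⟩

theorem genS_succ_le_dSub_top {ml mr : D →ₗ[F] D →ₗ[F] D} (h : IsDias ml mr) (k : ℕ) :
    genS ml mr (k + 1) ≤ dSub ml mr (genS ml mr k) ⊤ := by
  refine genS_succ_le_iff_dSub.2 fun i j hij => ?_
  subst hij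
  exact dSub_genS_le h i j

variable {ml mr : D →ₗ[F] D →ₗ[F] D} {ml' mr' : E →ₗ[F] E →ₗ[F] E} {f : D →ₗ[F] E}

theorem genS_le_comap (hl : ∀ x y, f (ml x y) = ml' (f x) (f y))
    (hr : ∀ x y, f (mr x y) = mr' (f x) (f y)) (k : ℕ) :
    genS ml mr k ≤ (genS ml' mr' k).comap f := by
  induction k using Nat.strong_induction_on with
  | _ k ih =>
    cases k with
    | zero => simp [genS_zero]
    | succ k =>
      refine genS_succ_le_iff.2 fun i j hij x hx y hy => ?_
      simp only [Submodule.mem_comap, hl, hr]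
      exact mul_mem_genS (by omega) (ih i (by omega) hx) (ih j (by omega) hy)

theorem genS_le_map (hl : ∀ x y, f (ml x y) = ml' (f x) (f y))
    (hr : ∀ x y, f (mr x y) = mr' (f x) (f y)) (hf : Function.Surjective f) (k : ℕ) :
    genS ml' mr' k ≤ (genS ml mr k).map f := by
  induction k using Nat.strong_induction_on with
  | _ k ih =>
    cases k with
    | zero => simp [genS_zero, LinearMap.range_eq_top.2 hf]
    | succ k =>
      refine genS_succ_le_iff.2 fun i j hij x hx y hy => ?_
      obtain ⟨u, hu, rfl⟩ := ih i (by omega) hx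
      obtain ⟨v, hv, rfl⟩ := ih j (by omega) hy
      obtain ⟨h₁, h₂⟩ := mul_mem_genS (k := k + 1) (by omega) hu hv
      exact ⟨⟨_, h₁, hl u v⟩, _, h₂, hr u v⟩

end GeneralSeries

/-- `G(N, φ)` contains the products and actions of elements of `N`. -/
theorem mem_GidealD {A B : Type*} [AddCommGroup A] [Module F A]
    (mlA mrA : A →ₗ[F] A →ₗ[F] A) (φl φr φl' φr' : B → Module.End F A)
    {N : Submodule F A} {n : A} (hn : n ∈ N) (a : A) (i : B) :
    mlA n a ∈ GidealD mlA mrA φl φr φl' φr' N ∧ mrA n a ∈ GidealD mlA mrA φl φr φl' φr' N ∧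
      φl' i n ∈ GidealD mlA mrA φl φr φl' φr' N ∧
      φr' i n ∈ GidealD mlA mrA φl φr φl' φr' N := by
  simp only [GidealD, Submodule.mem_sInf]
  exact ⟨fun P hP => (hP.2.2.1 a n hn).2.1, fun P hP => (hP.2.2.1 a n hn).2.2.2,
    fun P hP => (hP.2.2.2 i n hn).2.2.1, fun P hP => (hP.2.2.2 i n hn).2.2.2⟩

theorem nil_class_bounds {A L B : Type*}
    [AddCommGroup A] [Module F A] [AddCommGroup L] [Module F L]
    [AddCommGroup B] [Module F B]
    (mlA mrA : A →ₗ[F] A →ₗ[F] A) (mlL mrL : L →ₗ[F] L →ₗ[F] L)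
    (mlB mrB : B →ₗ[F] B →ₗ[F] B)
    -- the three algebras are diassociative algebras
    (hA : IsDias mlA mrA) (hL : IsDias mlL mrL) (hB : IsDias mlB mrB)
    -- `A` is nilpotent
    (hAnil : ∃ u, genS mlA mrA u = ⊥)
    -- `0 → A --σ--> L --π--> B → 0` is an extension of `A` by `B`
    (σ : A →ₗ[F] L) (π : L →ₗ[F] B)
    (hσl : ∀ x y, σ (mlA x y) = mlL (σ x) (σ y))
    (hσr : ∀ x y, σ (mrA x y) = mrL (σ x) (σ y))
    (hπl : ∀ x y, π (mlL x y) = mlB (π x) (π y))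
    (hπr : ∀ x y, π (mrL x y) = mrB (π x) (π y))
    (hσinj : Function.Injective σ) (hπsurj : Function.Surjective π)
    (hexact : LinearMap.range σ = LinearMap.ker π)
    -- `T` is a section of the extension
    (T : B →ₗ[F] L) (hT : ∀ b, π (T b) = b)
    -- `φ_*(i)m = σ⁻¹(T(i)*σ(m))` and `φ'_*(i)m = σ⁻¹(σ(m)*T(i))` for `* ∈ {⊣,⊢}`
    (φl φr φl' φr' : B → Module.End F A)
    (hφl : ∀ i m, σ (φl i m) = mlL (T i) (σ m))
    (hφr : ∀ i m, σ (φr i m) = mrL (T i) (σ m))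
    (hφl' : ∀ i m, σ (φl' i m) = mlL (σ m) (T i))
    (hφr' : ∀ i m, σ (φr' i m) = mrL (σ m) (T i))
    -- the sequence `G_0^B A = A`, `G_{k+1}^B A = G(G_k^B A, φ)`
    (Gseq : ℕ → Submodule F A) (hG0 : Gseq 0 = ⊤)
    (hGsucc : ∀ k, Gseq (k + 1) = GidealD mlA mrA φl φr φl' φr' (Gseq k))
    -- `L` is nilpotent of class `uL`, `B` is nilpotent of class `uB`,
    -- and `A` is `B`-nilpotent of class `uA`
    (uL uB uA : ℕ)
    (hLnil : genS mlL mrL uL = ⊥) (hLclass : genS mlL mrL (uL - 1) ≠ ⊥)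
    (hBnil : genS mlB mrB uB = ⊥) (hBclass : genS mlB mrB (uB - 1) ≠ ⊥)
    (hGnil : Gseq uA = ⊥) (hGclass : Gseq (uA - 1) ≠ ⊥) :
    max uA uB ≤ uL ∧ uL ≤ uA + uB := by
  have hanti := genS_antitone mlL mrL
  have hleft {k : ℕ} (x : L) {y : L} (hy : y ∈ genS mlL mrL k) :
      mlL x y ∈ genS mlL mrL (k + 1) ∧ mrL x y ∈ genS mlL mrL (k + 1) :=
    mul_mem_genS (i := 0) (by omega) (by simp [genS_zero]) hy
  have hright {k : ℕ} (x : L) {y : L} (hy : y ∈ genS mlL mrL k) :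
      mlL y x ∈ genS mlL mrL (k + 1) ∧ mrL y x ∈ genS mlL mrL (k + 1) :=
    mul_mem_genS (j := 0) (by omega) hy (by simp [genS_zero])
  have hGle (k : ℕ) : Gseq k ≤ (genS mlL mrL k).comap σ := by
    induction k with
    | zero => simp [genS_zero]
    | succ k ih =>
      rw [hGsucc]
      have hmul (a n : A) (hn : σ n ∈ genS mlL mrL k) :
          σ (mlA a n) ∈ genS mlL mrL (k + 1) ∧ σ (mlA n a) ∈ genS mlL mrL (k + 1) ∧
          σ (mrA a n) ∈ genS mlL mrL (k + 1) ∧ σ (mrA n a) ∈ genS mlL mrL (k + 1) := by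
        simp only [hσl, hσr]
        exact ⟨(hleft _ hn).1, (hright _ hn).1, (hleft _ hn).2, (hright _ hn).2⟩
      have hact (i : B) (n : A) (hn : σ n ∈ genS mlL mrL k) :
          σ (φl i n) ∈ genS mlL mrL (k + 1) ∧ σ (φr i n) ∈ genS mlL mrL (k + 1) ∧
          σ (φl' i n) ∈ genS mlL mrL (k + 1) ∧ σ (φr' i n) ∈ genS mlL mrL (k + 1) := by
        simp only [hφl, hφr, hφl', hφr']
        exact ⟨(hleft _ hn).1, (hleft _ hn).2, (hright _ hn).1, (hright _ hn).2⟩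
      exact sInf_le ⟨fun a n hn => hmul a n (hanti k.le_succ hn),
        fun i n hn => hact i n (hanti k.le_succ hn),
        fun a n hn => hmul a n (ih hn), fun i n hn => hact i n (ih hn)⟩
  have hleG (k : ℕ) : genS mlL mrL (uB + k) ≤ (Gseq k).map σ := by
    induction k with
    | zero =>
      rw [hG0, Submodule.map_top, hexact]
      intro x hx
      simpa [hBnil] using genS_le_comap hπl hπr uB hx
    | succ k ih =>
      refine (genS_succ_le_dSub_top hL (uB + k)).trans (dSub_le_iff.2 fun x hx y _ => ?_)
      obtain ⟨n, hn, rfl⟩ := ih hx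
      obtain ⟨a, ha⟩ : y - T (π y) ∈ LinearMap.range σ := by
        rw [hexact, LinearMap.mem_ker, map_sub, hT, sub_self]
      obtain ⟨b, rfl⟩ : ∃ b, y = σ a + T b := ⟨π y, by rw [ha, sub_add_cancel]⟩
      obtain ⟨h₁, h₂, h₃, h₄⟩ := mem_GidealD mlA mrA φl φr φl' φr' hn a b
      rw [← hGsucc] at h₁ h₂ h₃ h₄
      exact ⟨⟨_, add_mem h₁ h₃, by simp only [map_add, hσl, hφl']⟩,
        _, add_mem h₂ h₄, by simp only [map_add, hσr, hφr']⟩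
  refine ⟨max_le ?_ ?_, ?_⟩
  · by_contra! hlt
    refine hGclass (eq_bot_iff.2 fun x hx => ?_)
    have hx' := hanti (show uL ≤ uA - 1 by omega) (hGle _ hx)
    rw [hLnil, Submodule.mem_bot] at hx'
    exact (Submodule.mem_bot F).2 (hσinj (hx'.trans (map_zero σ).symm))
  · by_contra! hlt
    refine hBclass (eq_bot_iff.2 ?_)
    calc genS mlB mrB (uB - 1) ≤ genS mlB mrB uL := genS_antitone mlB mrB (by omega)
      _ ≤ (genS mlL mrL uL).map π := genS_le_map hπl hπr hπsurj uL
      _ = ⊥ := by rw [hLnil, Submodule.map_bot]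
  · by_contra! hlt
    refine hLclass (eq_bot_iff.2 ?_)
    calc genS mlL mrL (uL - 1) ≤ genS mlL mrL (uB + uA) := hanti (by omega)
      _ ≤ (Gseq uA).map σ := hleG uA
      _ = ⊥ := by rw [hGnil, Submodule.map_bot]

end Stmt15
end

section
/- Let A and B be nilpotent diassociative algebras. Let 0 → A --σ₁--> L₁ --π₁--> B → 0 and 0 → A --σ₂--> L₂ --π₂--> B → 0 be extensions of A by B with sections T₁ and T₂, and for j = 1,2 and * ∈ {⊣,⊢} define φ_{j,*}(i)m = σⱼ⁻¹(Tⱼ(i)*σⱼ(m)) and φ'_{j,*}(i)m = σⱼ⁻¹(σⱼ(m)*Tⱼ(i)). Suppose that for every i ∈ B and * ∈ {⊣,⊢} there exist m_{*,i}, m'_{*,i} ∈ A such that φ_{2,*}(i)a = φ_{1,*}(i)a + m_{*,i}*a and φ'_{2,*}(i)a = φ'_{1,*}(i)a + a*m'_{*,i} for all a ∈ A (i.e., the two extensions correspond to lifts of the same tuple (Φ_⊣, Φ_⊢, Φ'_⊣, Φ'_⊢)). Then L₁ is nilpotent if and only if L₂ is nilpotent. -/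
/-!
STATEMENT 16: Let `A` and `B` be nilpotent diassociative algebras.  Let
`0 → A --σ₁--> L₁ --π₁--> B → 0` and `0 → A --σ₂--> L₂ --π₂--> B → 0` be
extensions of `A` by `B` with sections `T₁` and `T₂`, and for `j = 1,2` and
`* ∈ {⊣,⊢}` define `φ_{j,*}(i)m = σⱼ⁻¹(Tⱼ(i)*σⱼ(m))` and
`φ'_{j,*}(i)m = σⱼ⁻¹(σⱼ(m)*Tⱼ(i))`.  Suppose the two extensions correspond to
lifts of the same tuple `(Φ_⊣, Φ_⊢, Φ'_⊣, Φ'_⊢)`.  Then `L₁` is nilpotent if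
and only if `L₂` is nilpotent.
-/

namespace Stmt16

variable {F : Type*} [Field F]

/-- Subspace spanned by all products `s*t` with `s ∈ S`, `t ∈ T`. -/
def pSub {D : Type*} [AddCommGroup D] [Module F D]
    (mul : D →ₗ[F] D →ₗ[F] D) (S T : Submodule F D) : Submodule F D :=
  Submodule.span F {z | ∃ s ∈ S, ∃ t ∈ T, z = mul s t}

/-- `S ◊ T = S⊣T + S⊢T` for subspaces `S`, `T`. -/
def dSub {D : Type*} [AddCommGroup D] [Module F D]
    (ml mr : D →ₗ[F] D →ₗ[F] D) (S T : Submodule F D) : Submodule F D :=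
  pSub ml S T ⊔ pSub mr S T

/-- The general lower central series:
`D^0 = D`, `D^{k+1} = Σ_{i=0}^{k} D^i ◊ D^{k-i}`. -/
def genS {D : Type*} [AddCommGroup D] [Module F D]
    (ml mr : D →ₗ[F] D →ₗ[F] D) : ℕ → Submodule F D
  | 0 => ⊤
  | k + 1 => (Finset.range (k + 1)).attach.sup fun i =>
      have _h1 : i.1 < k + 1 := Finset.mem_range.mp i.2
      dSub ml mr (genS ml mr i.1) (genS ml mr (k - i.1))
  termination_by n => n
  decreasing_by
  · exact _h1
  · omega

/-- `(ml, mr) = (⊣, ⊢)` makes `D` a diassociative algebra. -/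
def IsDias {D : Type*} [AddCommGroup D] [Module F D]
    (ml mr : D →ₗ[F] D →ₗ[F] D) : Prop :=
  (∀ x y z : D, ml (ml x y) z = ml x (ml y z)) ∧
  (∀ x y z : D, mr (mr x y) z = mr x (mr y z)) ∧
  (∀ x y z : D, ml x (ml y z) = ml x (mr y z)) ∧
  (∀ x y z : D, ml (mr x y) z = mr x (ml y z)) ∧
  (∀ x y z : D, mr (ml x y) z = mr (mr x y) z)

section Ideals

variable {D E : Type*} [AddCommGroup D] [Module F D] [AddCommGroup E] [Module F E]

theorem pSub_le {mul : D →ₗ[F] D →ₗ[F] D} {S T X : Submodule F D} :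
    pSub mul S T ≤ X ↔ ∀ s ∈ S, ∀ t ∈ T, mul s t ∈ X := by
  rw [pSub, Submodule.span_le]
  constructor
  · exact fun h s hs t ht => h ⟨s, hs, t, ht, rfl⟩
  · rintro h _ ⟨s, hs, t, ht, rfl⟩
    exact h s hs t ht

theorem dSub_le {ml mr : D →ₗ[F] D →ₗ[F] D} {S T X : Submodule F D} :
    dSub ml mr S T ≤ X ↔ ∀ s ∈ S, ∀ t ∈ T, ml s t ∈ X ∧ mr s t ∈ X := by
  rw [dSub, sup_le_iff, pSub_le, pSub_le]
  grind

theorem dSub_mono {ml mr : D →ₗ[F] D →ₗ[F] D} {S S' T T' : Submodule F D}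
    (hS : S ≤ S') (hT : T ≤ T') : dSub ml mr S T ≤ dSub ml mr S' T' :=
  dSub_le.2 fun s hs t ht => dSub_le.1 le_rfl s (hS hs) t (hT ht)

theorem genS_zero (ml mr : D →ₗ[F] D →ₗ[F] D) : genS ml mr 0 = ⊤ := by
  rw [genS]

theorem genS_succ_le {ml mr : D →ₗ[F] D →ₗ[F] D} {k : ℕ} {X : Submodule F D} :
    genS ml mr (k + 1) ≤ X ↔
      ∀ i ≤ k, dSub ml mr (genS ml mr i) (genS ml mr (k - i)) ≤ X := by
  rw [genS, Finset.sup_le_iff]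
  simp

/-- The sum `D ◊ S + S ◊ D`. -/
def mulTop (ml mr : D →ₗ[F] D →ₗ[F] D) (S : Submodule F D) : Submodule F D :=
  dSub ml mr ⊤ S ⊔ dSub ml mr S ⊤

theorem mulTop_le {ml mr : D →ₗ[F] D →ₗ[F] D} {S X : Submodule F D} :
    mulTop ml mr S ≤ X ↔
      ∀ x, ∀ s ∈ S, (ml x s ∈ X ∧ mr x s ∈ X) ∧ ml s x ∈ X ∧ mr s x ∈ X := by
  rw [mulTop, sup_le_iff, dSub_le, dSub_le]
  simp only [Submodule.mem_top, true_implies]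
  grind

theorem mulTop_mono (ml mr : D →ₗ[F] D →ₗ[F] D) : Monotone (mulTop ml mr) :=
  fun _ _ h => sup_le_sup (dSub_mono le_rfl h) (dSub_mono h le_rfl)

theorem mulTop_iterate_top_le_genS (ml mr : D →ₗ[F] D →ₗ[F] D) (n : ℕ) :
    (mulTop ml mr)^[n] ⊤ ≤ genS ml mr n := by
  induction n with
  | zero => simp [genS_zero]
  | succ n ih =>
    rw [Function.iterate_succ_apply']
    refine (mulTop_mono ml mr ih).trans (sup_le ?_ ?_)
    · simpa [genS_zero] using genS_succ_le.1 (le_refl (genS ml mr (n + 1))) 0 n.zero_le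
    · simpa [genS_zero] using genS_succ_le.1 (le_refl (genS ml mr (n + 1))) n le_rfl

/-- A product of more than `2 ^ n - 1` factors contains nested products of depth `n`,
however it is bracketed. -/
theorem genS_le_mulTop_iterate_top (ml mr : D →ₗ[F] D →ₗ[F] D) (n : ℕ) :
    ∀ m, 2 ^ n ≤ m + 1 → genS ml mr m ≤ (mulTop ml mr)^[n] ⊤ := by
  induction n with
  | zero => simp
  | succ n ih =>
    intro m hm
    rw [Function.iterate_succ_apply']
    have hpos : 0 < 2 ^ n := by positivity
    rw [pow_succ] at hm
    obtain _ | k := m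
    · omega
    refine genS_succ_le.2 fun i hi => ?_
    by_cases h : 2 ^ n ≤ i + 1
    · exact (dSub_mono (ih i h) le_top).trans le_sup_right
    · exact (dSub_mono le_top (ih (k - i) (by omega))).trans le_sup_left

theorem exists_genS_eq_bot_iff (ml mr : D →ₗ[F] D →ₗ[F] D) :
    (∃ u, genS ml mr u = ⊥) ↔ ∃ n, (mulTop ml mr)^[n] ⊤ = ⊥ := by
  constructor
  · rintro ⟨u, hu⟩
    exact ⟨u, le_bot_iff.1 (hu ▸ mulTop_iterate_top_le_genS ml mr u)⟩
  · rintro ⟨n, hn⟩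
    exact ⟨2 ^ n, le_bot_iff.1 (hn ▸ genS_le_mulTop_iterate_top ml mr n _ (Nat.le_succ _))⟩

theorem mulTop_iterate_top_le_comap {ml mr : D →ₗ[F] D →ₗ[F] D} {ml' mr' : E →ₗ[F] E →ₗ[F] E}
    (f : D →ₗ[F] E) (hl : ∀ x y, f (ml x y) = ml' (f x) (f y))
    (hr : ∀ x y, f (mr x y) = mr' (f x) (f y)) (n : ℕ) :
    (mulTop ml mr)^[n] ⊤ ≤ ((mulTop ml' mr')^[n] ⊤).comap f := by
  induction n with
  | zero => simp
  | succ n ih =>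
    rw [Function.iterate_succ_apply', Function.iterate_succ_apply']
    refine mulTop_le.2 fun x s hs => ?_
    simpa only [Submodule.mem_comap, hl, hr] using mulTop_le.1 le_rfl (f x) (f s) (ih hs)

theorem exists_genS_eq_bot_iff_of_nilpotent_quotient {ml mr : D →ₗ[F] D →ₗ[F] D}
    {ml' mr' : E →ₗ[F] E →ₗ[F] E} (f : D →ₗ[F] E)
    (hl : ∀ x y, f (ml x y) = ml' (f x) (f y)) (hr : ∀ x y, f (mr x y) = mr' (f x) (f y))
    (hE : ∃ u, genS ml' mr' u = ⊥) :
    (∃ u, genS ml mr u = ⊥) ↔ ∃ n, (mulTop ml mr)^[n] (LinearMap.ker f) = ⊥ := by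
  rw [exists_genS_eq_bot_iff] at hE ⊢
  constructor
  · rintro ⟨n, hn⟩
    exact ⟨n, le_bot_iff.1 (hn ▸ (mulTop_mono ml mr).iterate n le_top)⟩
  · rintro ⟨n, hn⟩
    obtain ⟨u, hu⟩ := hE
    refine ⟨n + u, le_bot_iff.1 (hn ▸ ?_)⟩
    rw [Function.iterate_add_apply]
    refine (mulTop_mono ml mr).iterate n ?_
    have h := mulTop_iterate_top_le_comap f hl hr u
    rwa [hu, Submodule.comap_bot] at h

end Ideals

section Extensions

variable {A L₁ L₂ : Type*} [AddCommGroup A] [Module F A] [AddCommGroup L₁] [Module F L₁]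
  [AddCommGroup L₂] [Module F L₂]

/-- Every operator on `A` induced by multiplication by an element of `L₁` is also induced by
an element of `L₂`. -/
def OperatorsLE (σ₁ : A →ₗ[F] L₁) (σ₂ : A →ₗ[F] L₂)
    (mul₁ : L₁ →ₗ[F] L₁ →ₗ[F] L₁) (mul₂ : L₂ →ₗ[F] L₂ →ₗ[F] L₂) : Prop :=
  ∀ x, ∃ y, ∀ a, ∃ c, σ₁ c = mul₁ x (σ₁ a) ∧ σ₂ c = mul₂ y (σ₂ a)

theorem mulTop_iterate_range_le {σ₁ : A →ₗ[F] L₁} {σ₂ : A →ₗ[F] L₂}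
    {ml₁ mr₁ : L₁ →ₗ[F] L₁ →ₗ[F] L₁} {ml₂ mr₂ : L₂ →ₗ[F] L₂ →ₗ[F] L₂}
    (hl : OperatorsLE σ₁ σ₂ ml₁ ml₂) (hr : OperatorsLE σ₁ σ₂ mr₁ mr₂)
    (hl' : OperatorsLE σ₁ σ₂ ml₁.flip ml₂.flip) (hr' : OperatorsLE σ₁ σ₂ mr₁.flip mr₂.flip)
    (n : ℕ) :
    (mulTop ml₁ mr₁)^[n] (LinearMap.range σ₁) ≤
      (((mulTop ml₂ mr₂)^[n] (LinearMap.range σ₂)).comap σ₂).map σ₁ := by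
  induction n with
  | zero =>
    rintro _ ⟨a, rfl⟩
    exact ⟨a, ⟨a, rfl⟩, rfl⟩
  | succ n ih =>
    rw [Function.iterate_succ_apply', Function.iterate_succ_apply']
    refine mulTop_le.2 fun x s hs => ?_
    obtain ⟨a, ha, rfl⟩ := ih hs
    have key := fun y => mulTop_le.1 (le_refl (mulTop ml₂ mr₂ _)) y (σ₂ a) ha
    refine ⟨⟨?_, ?_⟩, ?_, ?_⟩
    · obtain ⟨y, hy⟩ := hl x
      obtain ⟨c, hc, hc'⟩ := hy a
      exact ⟨c, by simpa only [hc', SetLike.mem_coe, Submodule.mem_comap] using (key y).1.1, hc⟩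
    · obtain ⟨y, hy⟩ := hr x
      obtain ⟨c, hc, hc'⟩ := hy a
      exact ⟨c, by simpa only [hc', SetLike.mem_coe, Submodule.mem_comap] using (key y).1.2, hc⟩
    · obtain ⟨y, hy⟩ := hl' x
      obtain ⟨c, hc, hc'⟩ := hy a
      exact ⟨c, by simpa only [hc', SetLike.mem_coe, Submodule.mem_comap, LinearMap.flip_apply]
        using (key y).2.1, hc⟩
    · obtain ⟨y, hy⟩ := hr' x
      obtain ⟨c, hc, hc'⟩ := hy a
      exact ⟨c, by simpa only [hc', SetLike.mem_coe, Submodule.mem_comap, LinearMap.flip_apply]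
        using (key y).2.2, hc⟩

theorem mulTop_iterate_range_eq_bot {σ₁ : A →ₗ[F] L₁} {σ₂ : A →ₗ[F] L₂}
    {ml₁ mr₁ : L₁ →ₗ[F] L₁ →ₗ[F] L₁} {ml₂ mr₂ : L₂ →ₗ[F] L₂ →ₗ[F] L₂}
    (hσ₂ : Function.Injective σ₂)
    (hl : OperatorsLE σ₁ σ₂ ml₁ ml₂) (hr : OperatorsLE σ₁ σ₂ mr₁ mr₂)
    (hl' : OperatorsLE σ₁ σ₂ ml₁.flip ml₂.flip) (hr' : OperatorsLE σ₁ σ₂ mr₁.flip mr₂.flip)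
    {n : ℕ} (hn : (mulTop ml₂ mr₂)^[n] (LinearMap.range σ₂) = ⊥) :
    (mulTop ml₁ mr₁)^[n] (LinearMap.range σ₁) = ⊥ := by
  have h := mulTop_iterate_range_le hl hr hl' hr' n
  rwa [hn, Submodule.comap_bot, LinearMap.ker_eq_bot.2 hσ₂, Submodule.map_bot, le_bot_iff] at h

/-- If the operators of the representatives `T₁ i` and `T₂ i` differ by an inner operator of `A`,
then multiplication by `L₁` induces no operators on `A` beyond those induced by `L₂`. -/
theorem operatorsLE_of_lift {B : Type*} [AddCommGroup B] [Module F B]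
    {σ₁ : A →ₗ[F] L₁} {σ₂ : A →ₗ[F] L₂} {mulA : A →ₗ[F] A →ₗ[F] A}
    {mul₁ : L₁ →ₗ[F] L₁ →ₗ[F] L₁} {mul₂ : L₂ →ₗ[F] L₂ →ₗ[F] L₂}
    (h₁ : ∀ x y, σ₁ (mulA x y) = mul₁ (σ₁ x) (σ₁ y))
    (h₂ : ∀ x y, σ₂ (mulA x y) = mul₂ (σ₂ x) (σ₂ y))
    {π₁ : L₁ →ₗ[F] B} (hexact : LinearMap.range σ₁ = LinearMap.ker π₁)
    {T₁ : B → L₁} {T₂ : B → L₂} (hT₁ : ∀ b, π₁ (T₁ b) = b)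
    {φ₁ φ₂ : B → Module.End F A}
    (hφ₁ : ∀ i m, σ₁ (φ₁ i m) = mul₁ (T₁ i) (σ₁ m))
    (hφ₂ : ∀ i m, σ₂ (φ₂ i m) = mul₂ (T₂ i) (σ₂ m))
    (hlift : ∀ i, ∃ m, ∀ a, φ₁ i a = φ₂ i a + mulA m a) :
    OperatorsLE σ₁ σ₂ mul₁ mul₂ := by
  intro x
  obtain ⟨b, hb⟩ : x - T₁ (π₁ x) ∈ LinearMap.range σ₁ := by
    rw [hexact, LinearMap.mem_ker, map_sub, hT₁, sub_self]
  obtain ⟨m, hm⟩ := hlift (π₁ x)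
  refine ⟨T₂ (π₁ x) + σ₂ m + σ₂ b, fun a => ⟨φ₁ (π₁ x) a + mulA b a, ?_, ?_⟩⟩
  · rw [map_add, hφ₁, h₁, hb, ← LinearMap.add_apply, ← map_add, add_sub_cancel]
  · rw [hm, map_add, map_add, hφ₂, h₂, h₂]
    simp only [map_add, LinearMap.add_apply]

end Extensions

theorem nilpotent_iff_nilpotent {A L₁ L₂ B : Type*}
    [AddCommGroup A] [Module F A] [AddCommGroup L₁] [Module F L₁]
    [AddCommGroup L₂] [Module F L₂] [AddCommGroup B] [Module F B]
    (mlA mrA : A →ₗ[F] A →ₗ[F] A) (mlL₁ mrL₁ : L₁ →ₗ[F] L₁ →ₗ[F] L₁)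
    (mlL₂ mrL₂ : L₂ →ₗ[F] L₂ →ₗ[F] L₂) (mlB mrB : B →ₗ[F] B →ₗ[F] B)
    -- the algebras are diassociative algebras
    (hA : IsDias mlA mrA) (hL₁ : IsDias mlL₁ mrL₁)
    (hL₂ : IsDias mlL₂ mrL₂) (hB : IsDias mlB mrB)
    -- `A` and `B` are nilpotent
    (hAnil : ∃ u, genS mlA mrA u = ⊥) (hBnil : ∃ u, genS mlB mrB u = ⊥)
    -- `0 → A --σ₁--> L₁ --π₁--> B → 0` is an extension of `A` by `B` with section `T₁`
    (σ₁ : A →ₗ[F] L₁) (π₁ : L₁ →ₗ[F] B)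
    (hσ₁l : ∀ x y, σ₁ (mlA x y) = mlL₁ (σ₁ x) (σ₁ y))
    (hσ₁r : ∀ x y, σ₁ (mrA x y) = mrL₁ (σ₁ x) (σ₁ y))
    (hπ₁l : ∀ x y, π₁ (mlL₁ x y) = mlB (π₁ x) (π₁ y))
    (hπ₁r : ∀ x y, π₁ (mrL₁ x y) = mrB (π₁ x) (π₁ y))
    (hσ₁inj : Function.Injective σ₁) (hπ₁surj : Function.Surjective π₁)
    (hexact₁ : LinearMap.range σ₁ = LinearMap.ker π₁)
    (T₁ : B →ₗ[F] L₁) (hT₁ : ∀ b, π₁ (T₁ b) = b)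
    -- `0 → A --σ₂--> L₂ --π₂--> B → 0` is an extension of `A` by `B` with section `T₂`
    (σ₂ : A →ₗ[F] L₂) (π₂ : L₂ →ₗ[F] B)
    (hσ₂l : ∀ x y, σ₂ (mlA x y) = mlL₂ (σ₂ x) (σ₂ y))
    (hσ₂r : ∀ x y, σ₂ (mrA x y) = mrL₂ (σ₂ x) (σ₂ y))
    (hπ₂l : ∀ x y, π₂ (mlL₂ x y) = mlB (π₂ x) (π₂ y))
    (hπ₂r : ∀ x y, π₂ (mrL₂ x y) = mrB (π₂ x) (π₂ y))
    (hσ₂inj : Function.Injective σ₂) (hπ₂surj : Function.Surjective π₂)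
    (hexact₂ : LinearMap.range σ₂ = LinearMap.ker π₂)
    (T₂ : B →ₗ[F] L₂) (hT₂ : ∀ b, π₂ (T₂ b) = b)
    -- `φ_{j,*}(i)m = σⱼ⁻¹(Tⱼ(i)*σⱼ(m))` and `φ'_{j,*}(i)m = σⱼ⁻¹(σⱼ(m)*Tⱼ(i))`
    (φ₁l φ₁r φ₁l' φ₁r' φ₂l φ₂r φ₂l' φ₂r' : B → Module.End F A)
    (hφ₁l : ∀ i m, σ₁ (φ₁l i m) = mlL₁ (T₁ i) (σ₁ m))
    (hφ₁r : ∀ i m, σ₁ (φ₁r i m) = mrL₁ (T₁ i) (σ₁ m))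
    (hφ₁l' : ∀ i m, σ₁ (φ₁l' i m) = mlL₁ (σ₁ m) (T₁ i))
    (hφ₁r' : ∀ i m, σ₁ (φ₁r' i m) = mrL₁ (σ₁ m) (T₁ i))
    (hφ₂l : ∀ i m, σ₂ (φ₂l i m) = mlL₂ (T₂ i) (σ₂ m))
    (hφ₂r : ∀ i m, σ₂ (φ₂r i m) = mrL₂ (T₂ i) (σ₂ m))
    (hφ₂l' : ∀ i m, σ₂ (φ₂l' i m) = mlL₂ (σ₂ m) (T₂ i))
    (hφ₂r' : ∀ i m, σ₂ (φ₂r' i m) = mrL₂ (σ₂ m) (T₂ i))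
    -- the two extensions correspond to lifts of the same tuple
    (hlift : ∀ i : B, ∃ ml' mr' nl' nr' : A, ∀ a : A,
      φ₂l i a = φ₁l i a + mlA ml' a ∧ φ₂r i a = φ₁r i a + mrA mr' a ∧
      φ₂l' i a = φ₁l' i a + mlA a nl' ∧ φ₂r' i a = φ₁r' i a + mrA a nr') :
    (∃ u, genS mlL₁ mrL₁ u = ⊥) ↔ (∃ u, genS mlL₂ mrL₂ u = ⊥) := by
  rw [exists_genS_eq_bot_iff_of_nilpotent_quotient π₁ hπ₁l hπ₁r hBnil,
    exists_genS_eq_bot_iff_of_nilpotent_quotient π₂ hπ₂l hπ₂r hBnil, ← hexact₁, ← hexact₂]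
  choose m m' n n' h using hlift
  constructor
  · rintro ⟨k, hk⟩
    refine ⟨k, mulTop_iterate_range_eq_bot hσ₁inj ?_ ?_ ?_ ?_ hk⟩
    · exact operatorsLE_of_lift hσ₂l hσ₁l hexact₂ hT₂ hφ₂l hφ₁l
        fun i => ⟨m i, fun a => (h i a).1⟩
    · exact operatorsLE_of_lift hσ₂r hσ₁r hexact₂ hT₂ hφ₂r hφ₁r
        fun i => ⟨m' i, fun a => (h i a).2.1⟩
    · exact operatorsLE_of_lift (mulA := mlA.flip) (fun x y => hσ₂l y x) (fun x y => hσ₁l y x)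
        hexact₂ hT₂ hφ₂l' hφ₁l' fun i => ⟨n i, fun a => (h i a).2.2.1⟩
    · exact operatorsLE_of_lift (mulA := mrA.flip) (fun x y => hσ₂r y x) (fun x y => hσ₁r y x)
        hexact₂ hT₂ hφ₂r' hφ₁r' fun i => ⟨n' i, fun a => (h i a).2.2.2⟩
  · rintro ⟨k, hk⟩
    refine ⟨k, mulTop_iterate_range_eq_bot hσ₂inj ?_ ?_ ?_ ?_ hk⟩
    · exact operatorsLE_of_lift hσ₁l hσ₂l hexact₁ hT₁ hφ₁l hφ₂l
        fun i => ⟨-m i, fun a => by simp [(h i a).1]⟩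
    · exact operatorsLE_of_lift hσ₁r hσ₂r hexact₁ hT₁ hφ₁r hφ₂r
        fun i => ⟨-m' i, fun a => by simp [(h i a).2.1]⟩
    · exact operatorsLE_of_lift (mulA := mlA.flip) (fun x y => hσ₁l y x) (fun x y => hσ₂l y x)
        hexact₁ hT₁ hφ₁l' hφ₂l' fun i => ⟨-n i, fun a => by simp [(h i a).2.2.1]⟩
    · exact operatorsLE_of_lift (mulA := mrA.flip) (fun x y => hσ₁r y x) (fun x y => hσ₂r y x)
        hexact₁ hT₁ hφ₁r' hφ₂r' fun i => ⟨-n' i, fun a => by simp [(h i a).2.2.2]⟩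

end Stmt16
end

section
/- Let A and B be nilpotent associative algebras. Let 0 → A --σ₁--> L₁ --π₁--> B → 0 and 0 → A --σ₂--> L₂ --π₂--> B → 0 be extensions of A by B with sections T₁ and T₂, and for j = 1,2 define φⱼ(i)m = σⱼ⁻¹(Tⱼ(i)·σⱼ(m)) and φⱼ'(i)m = σⱼ⁻¹(σⱼ(m)·Tⱼ(i)). Suppose that for every i ∈ B there exist m_i, m_i' ∈ A such that φ₂(i)a = φ₁(i)a + m_i·a and φ₂'(i)a = φ₁'(i)a + a·m_i' for all a ∈ A (i.e., the two extensions correspond to lifts of the same pair (Φ,Φ')). Then L₁ is nilpotent if and only if L₂ is nilpotent. -/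
/-!
STATEMENT 17: Let `A` and `B` be nilpotent (not necessarily unital)
associative algebras.  Let
`0 → A --σ₁--> L₁ --π₁--> B → 0` and `0 → A --σ₂--> L₂ --π₂--> B → 0` be
extensions of `A` by `B` with sections `T₁` and `T₂`, and for `j = 1,2` define
`φⱼ(i)m = σⱼ⁻¹(Tⱼ(i)·σⱼ(m))` and `φⱼ'(i)m = σⱼ⁻¹(σⱼ(m)·Tⱼ(i))`.  Suppose the
two extensions correspond to lifts of the same pair `(Φ,Φ')`.  Then `L₁` is
nilpotent if and only if `L₂` is nilpotent.
-/

namespace Stmt17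

/-- Subspace spanned by all products `s·t` with `s ∈ S`, `t ∈ T`. -/
def pSub {F L : Type*} [Field F] [AddCommGroup L] [Module F L]
    (mul : L →ₗ[F] L →ₗ[F] L) (S T : Submodule F L) : Submodule F L :=
  Submodule.span F {z | ∃ s ∈ S, ∃ t ∈ T, z = mul s t}

/-- The lower central series: `L^0 = L`, `L^{k+1} = L·L^k`. -/
def lcs {F L : Type*} [Field F] [AddCommGroup L] [Module F L]
    (mul : L →ₗ[F] L →ₗ[F] L) : ℕ → Submodule F L
  | 0 => ⊤
  | k + 1 => pSub mul ⊤ (lcs mul k)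

theorem mul_mem_lcs_succ {F L : Type*} [Field F] [AddCommGroup L] [Module F L]
    (mul : L →ₗ[F] L →ₗ[F] L) (x : L) {y : L} {k : ℕ} (hy : y ∈ lcs mul k) :
    mul x y ∈ lcs mul (k + 1) :=
  Submodule.subset_span ⟨x, Submodule.mem_top, y, hy, rfl⟩

theorem lcs_succ_le {F L : Type*} [Field F] [AddCommGroup L] [Module F L]
    {mul : L →ₗ[F] L →ₗ[F] L} {k : ℕ} {S : Submodule F L}
    (h : ∀ x, ∀ y ∈ lcs mul k, mul x y ∈ S) : lcs mul (k + 1) ≤ S := by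
  refine Submodule.span_le.2 ?_
  rintro _ ⟨x, -, y, hy, rfl⟩
  exact h x y hy

theorem lcs_le_comap {F L B : Type*} [Field F] [AddCommGroup L] [Module F L]
    [AddCommGroup B] [Module F B] {mulL : L →ₗ[F] L →ₗ[F] L} {mulB : B →ₗ[F] B →ₗ[F] B}
    (π : L →ₗ[F] B) (hπ : ∀ x y, π (mulL x y) = mulB (π x) (π y)) (k : ℕ) :
    lcs mulL k ≤ (lcs mulB k).comap π := by
  induction k with
  | zero => exact fun _ _ => Submodule.mem_top
  | succ k ih =>
    refine lcs_succ_le fun x y hy => ?_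
    rw [Submodule.mem_comap, hπ]
    exact mul_mem_lcs_succ mulB _ (ih hy)

/-- If a term of the lower central series of `L₁` lies in `A`, and every left multiplication of
`L₁` on `A` is also one of `L₂`, then nilpotency passes from `L₂` to `L₁`. -/
theorem nilpotent_of_left_mul {F A L₁ L₂ : Type*} [Field F]
    [AddCommGroup A] [Module F A] [AddCommGroup L₁] [Module F L₁]
    [AddCommGroup L₂] [Module F L₂]
    {mulL₁ : L₁ →ₗ[F] L₁ →ₗ[F] L₁} {mulL₂ : L₂ →ₗ[F] L₂ →ₗ[F] L₂}
    {σ₁ : A →ₗ[F] L₁} {σ₂ : A →ₗ[F] L₂} (hσ₂ : Function.Injective σ₂)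
    {v : ℕ} (hv : lcs mulL₁ v ≤ LinearMap.range σ₁)
    (h : ∀ x, ∃ y, ∀ a, ∃ c, mulL₁ x (σ₁ a) = σ₁ c ∧ mulL₂ y (σ₂ a) = σ₂ c)
    (hnil : ∃ u, lcs mulL₂ u = ⊥) : ∃ u, lcs mulL₁ u = ⊥ := by
  have key : ∀ k, lcs mulL₁ (v + k) ≤ ((lcs mulL₂ k).comap σ₂).map σ₁ := by
    intro k
    induction k with
    | zero =>
      intro x hx
      obtain ⟨a, rfl⟩ := hv hx
      exact ⟨a, Submodule.mem_top, rfl⟩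
    | succ k ih =>
      refine lcs_succ_le fun x y hy => ?_
      obtain ⟨a, ha, rfl⟩ := ih hy
      obtain ⟨z, hz⟩ := h x
      obtain ⟨c, hc₁, hc₂⟩ := hz a
      refine ⟨c, ?_, hc₁.symm⟩
      change σ₂ c ∈ lcs mulL₂ (k + 1)
      rw [← hc₂]
      exact mul_mem_lcs_succ mulL₂ z ha
  obtain ⟨u, hu⟩ := hnil
  refine ⟨v + u, le_bot_iff.1 ((key u).trans ?_)⟩
  rw [hu, Submodule.comap_bot, LinearMap.ker_eq_bot.2 hσ₂, Submodule.map_bot]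

theorem nilpotent_of_lift {F A L₁ L₂ B : Type*} [Field F]
    [AddCommGroup A] [Module F A] [AddCommGroup L₁] [Module F L₁]
    [AddCommGroup L₂] [Module F L₂] [AddCommGroup B] [Module F B]
    {mulA : A →ₗ[F] A →ₗ[F] A} {mulL₁ : L₁ →ₗ[F] L₁ →ₗ[F] L₁}
    {mulL₂ : L₂ →ₗ[F] L₂ →ₗ[F] L₂} {mulB : B →ₗ[F] B →ₗ[F] B}
    (hBnil : ∃ u, lcs mulB u = ⊥)
    {σ₁ : A →ₗ[F] L₁} {π₁ : L₁ →ₗ[F] B}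
    (hσ₁mul : ∀ x y, σ₁ (mulA x y) = mulL₁ (σ₁ x) (σ₁ y))
    (hπ₁mul : ∀ x y, π₁ (mulL₁ x y) = mulB (π₁ x) (π₁ y))
    (hexact₁ : LinearMap.range σ₁ = LinearMap.ker π₁)
    {T₁ : B →ₗ[F] L₁} (hT₁ : ∀ b, π₁ (T₁ b) = b)
    {σ₂ : A →ₗ[F] L₂} (hσ₂mul : ∀ x y, σ₂ (mulA x y) = mulL₂ (σ₂ x) (σ₂ y))
    (hσ₂inj : Function.Injective σ₂) {T₂ : B →ₗ[F] L₂}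
    {φ₁ φ₂ : B → Module.End F A}
    (hφ₁ : ∀ i m, σ₁ (φ₁ i m) = mulL₁ (T₁ i) (σ₁ m))
    (hφ₂ : ∀ i m, σ₂ (φ₂ i m) = mulL₂ (T₂ i) (σ₂ m))
    (hlift : ∀ i, ∃ m, ∀ a, φ₁ i a = φ₂ i a + mulA m a)
    (hnil : ∃ u, lcs mulL₂ u = ⊥) : ∃ u, lcs mulL₁ u = ⊥ := by
  obtain ⟨v, hv⟩ := hBnil
  refine nilpotent_of_left_mul (σ₁ := σ₁) hσ₂inj (v := v) ?_ (fun x => ?_) hnil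
  · have h := lcs_le_comap π₁ hπ₁mul v
    rwa [hv, Submodule.comap_bot, ← hexact₁] at h
  · obtain ⟨c, hc⟩ : x - T₁ (π₁ x) ∈ LinearMap.range σ₁ := by
      rw [hexact₁, LinearMap.mem_ker, map_sub, hT₁, sub_self]
    obtain ⟨m, hm⟩ := hlift (π₁ x)
    refine ⟨T₂ (π₁ x) + σ₂ (m + c), fun a => ⟨φ₁ (π₁ x) a + mulA c a, ?_, ?_⟩⟩
    · rw [map_add, hφ₁, hσ₁mul, hc, ← LinearMap.add_apply, ← map_add, add_sub_cancel]
    · rw [hm]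
      simp only [map_add, LinearMap.add_apply, hφ₂, hσ₂mul, add_assoc]

theorem nilpotent_iff_nilpotent {F A L₁ L₂ B : Type*} [Field F]
    [AddCommGroup A] [Module F A] [AddCommGroup L₁] [Module F L₁]
    [AddCommGroup L₂] [Module F L₂] [AddCommGroup B] [Module F B]
    (mulA : A →ₗ[F] A →ₗ[F] A) (mulL₁ : L₁ →ₗ[F] L₁ →ₗ[F] L₁)
    (mulL₂ : L₂ →ₗ[F] L₂ →ₗ[F] L₂) (mulB : B →ₗ[F] B →ₗ[F] B)
    -- the algebras are associative
    (hA : ∀ x y z : A, mulA (mulA x y) z = mulA x (mulA y z))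
    (hL₁ : ∀ x y z : L₁, mulL₁ (mulL₁ x y) z = mulL₁ x (mulL₁ y z))
    (hL₂ : ∀ x y z : L₂, mulL₂ (mulL₂ x y) z = mulL₂ x (mulL₂ y z))
    (hB : ∀ x y z : B, mulB (mulB x y) z = mulB x (mulB y z))
    -- `A` and `B` are nilpotent
    (hAnil : ∃ u, lcs mulA u = ⊥) (hBnil : ∃ u, lcs mulB u = ⊥)
    -- `0 → A --σ₁--> L₁ --π₁--> B → 0` is an extension of `A` by `B` with section `T₁`
    (σ₁ : A →ₗ[F] L₁) (π₁ : L₁ →ₗ[F] B)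
    (hσ₁mul : ∀ x y, σ₁ (mulA x y) = mulL₁ (σ₁ x) (σ₁ y))
    (hπ₁mul : ∀ x y, π₁ (mulL₁ x y) = mulB (π₁ x) (π₁ y))
    (hσ₁inj : Function.Injective σ₁) (hπ₁surj : Function.Surjective π₁)
    (hexact₁ : LinearMap.range σ₁ = LinearMap.ker π₁)
    (T₁ : B →ₗ[F] L₁) (hT₁ : ∀ b, π₁ (T₁ b) = b)
    -- `0 → A --σ₂--> L₂ --π₂--> B → 0` is an extension of `A` by `B` with section `T₂`
    (σ₂ : A →ₗ[F] L₂) (π₂ : L₂ →ₗ[F] B)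
    (hσ₂mul : ∀ x y, σ₂ (mulA x y) = mulL₂ (σ₂ x) (σ₂ y))
    (hπ₂mul : ∀ x y, π₂ (mulL₂ x y) = mulB (π₂ x) (π₂ y))
    (hσ₂inj : Function.Injective σ₂) (hπ₂surj : Function.Surjective π₂)
    (hexact₂ : LinearMap.range σ₂ = LinearMap.ker π₂)
    (T₂ : B →ₗ[F] L₂) (hT₂ : ∀ b, π₂ (T₂ b) = b)
    -- `φⱼ(i)m = σⱼ⁻¹(Tⱼ(i)·σⱼ(m))` and `φⱼ'(i)m = σⱼ⁻¹(σⱼ(m)·Tⱼ(i))`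
    (φ₁ φ₁' φ₂ φ₂' : B → Module.End F A)
    (hφ₁ : ∀ i m, σ₁ (φ₁ i m) = mulL₁ (T₁ i) (σ₁ m))
    (hφ₁' : ∀ i m, σ₁ (φ₁' i m) = mulL₁ (σ₁ m) (T₁ i))
    (hφ₂ : ∀ i m, σ₂ (φ₂ i m) = mulL₂ (T₂ i) (σ₂ m))
    (hφ₂' : ∀ i m, σ₂ (φ₂' i m) = mulL₂ (σ₂ m) (T₂ i))
    -- the two extensions correspond to lifts of the same pair `(Φ,Φ')`
    (hlift : ∀ i : B, ∃ m m' : A, ∀ a : A,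
      φ₂ i a = φ₁ i a + mulA m a ∧ φ₂' i a = φ₁' i a + mulA a m') :
    (∃ u, lcs mulL₁ u = ⊥) ↔ (∃ u, lcs mulL₂ u = ⊥) := by
  constructor
  · refine nilpotent_of_lift hBnil hσ₂mul hπ₂mul hexact₂ hT₂ hσ₁mul hσ₁inj hφ₂ hφ₁ fun i => ?_
    obtain ⟨m, _, h⟩ := hlift i
    exact ⟨m, fun a => (h a).1⟩
  · refine nilpotent_of_lift hBnil hσ₁mul hπ₁mul hexact₁ hT₁ hσ₂mul hσ₂inj hφ₁ hφ₂ fun i => ?_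
    obtain ⟨m, _, h⟩ := hlift i
    exact ⟨-m, fun a => by simp [(h a).1]⟩

end Stmt17
end

section
/- Let A and B be nilpotent dendriform algebras. Let 0 → A --σ₁--> L₁ --π₁--> B → 0 and 0 → A --σ₂--> L₂ --π₂--> B → 0 be extensions of A by B with sections T₁ and T₂, and for j = 1,2 and * ∈ {<,>} define φ_{j,*}(i)m = σⱼ⁻¹(Tⱼ(i)*σⱼ(m)) and φ'_{j,*}(i)m = σⱼ⁻¹(σⱼ(m)*Tⱼ(i)). Suppose that for every i ∈ B and * ∈ {<,>} there exist m_{*,i}, m'_{*,i} ∈ A such that φ_{2,*}(i)a = φ_{1,*}(i)a + m_{*,i}*a and φ'_{2,*}(i)a = φ'_{1,*}(i)a + a*m'_{*,i} for all a ∈ A (i.e., the two extensions correspond to lifts of the same tuple). Then L₁ is nilpotent if and only if L₂ is nilpotent. -/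
/-!
STATEMENT 18: Let `A` and `B` be nilpotent dendriform algebras.  Let
`0 → A --σ₁--> L₁ --π₁--> B → 0` and `0 → A --σ₂--> L₂ --π₂--> B → 0` be
extensions of `A` by `B` with sections `T₁` and `T₂`, and for `j = 1,2` and
`* ∈ {<,>}` define `φ_{j,*}(i)m = σⱼ⁻¹(Tⱼ(i)*σⱼ(m))` and
`φ'_{j,*}(i)m = σⱼ⁻¹(σⱼ(m)*Tⱼ(i))`.  Suppose the two extensions correspond to
lifts of the same tuple.  Then `L₁` is nilpotent if
and only if `L₂` is nilpotent.
-/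

namespace Stmt18

variable {F : Type*} [Field F]

/-- Subspace spanned by all products `s*t` with `s ∈ S`, `t ∈ T`. -/
def pSub {D : Type*} [AddCommGroup D] [Module F D]
    (mul : D →ₗ[F] D →ₗ[F] D) (S T : Submodule F D) : Submodule F D :=
  Submodule.span F {z | ∃ s ∈ S, ∃ t ∈ T, z = mul s t}

/-- `S ◊ T = S<T + S>T` for subspaces `S`, `T`. -/
def dSub {D : Type*} [AddCommGroup D] [Module F D]
    (ml mr : D →ₗ[F] D →ₗ[F] D) (S T : Submodule F D) : Submodule F D :=
  pSub ml S T ⊔ pSub mr S T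

/-- The general lower central series:
`D^0 = D`, `D^{k+1} = Σ_{i=0}^{k} D^i ◊ D^{k-i}`. -/
def genS {D : Type*} [AddCommGroup D] [Module F D]
    (ml mr : D →ₗ[F] D →ₗ[F] D) : ℕ → Submodule F D
  | 0 => ⊤
  | k + 1 => (Finset.range (k + 1)).attach.sup fun i =>
      have _h1 : i.1 < k + 1 := Finset.mem_range.mp i.2
      dSub ml mr (genS ml mr i.1) (genS ml mr (k - i.1))
  termination_by n => n
  decreasing_by
  · exact _h1
  · omega

/-- `(ml, mr) = (<, >)` makes `D` a dendriform algebra: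
E1: `(x<y)<z = x<(y<z) + x<(y>z)`, E2: `(x>y)<z = x>(y<z)`,
E3: `(x<y)>z + (x>y)>z = x>(y>z)`. -/
def IsDend {D : Type*} [AddCommGroup D] [Module F D]
    (ml mr : D →ₗ[F] D →ₗ[F] D) : Prop :=
  (∀ x y z : D, ml (ml x y) z = ml x (ml y z) + ml x (mr y z)) ∧
  (∀ x y z : D, ml (mr x y) z = mr x (ml y z)) ∧
  (∀ x y z : D, mr (ml x y) z + mr (mr x y) z = mr x (mr y z))

section GenS

variable {D : Type*} [AddCommGroup D] [Module F D] {ml mr : D →ₗ[F] D →ₗ[F] D}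

theorem mul_mem_genS {i j : ℕ} {s t : D} (hs : s ∈ genS ml mr i) (ht : t ∈ genS ml mr j) :
    ml s t ∈ genS ml mr (i + j + 1) ∧ mr s t ∈ genS ml mr (i + j + 1) := by
  have hi : i ∈ Finset.range (i + j + 1) := by simp
  have hle : dSub ml mr (genS ml mr i) (genS ml mr j) ≤ genS ml mr (i + j + 1) := by
    rw [genS]
    have h := Finset.le_sup (f := fun l : Finset.range (i + j + 1) =>
      dSub ml mr (genS ml mr l.1) (genS ml mr (i + j - l.1))) (Finset.mem_attach _ ⟨i, hi⟩)
    simpa using h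
  exact ⟨hle (Submodule.mem_sup_left (Submodule.subset_span ⟨s, hs, t, ht, rfl⟩)),
    hle (Submodule.mem_sup_right (Submodule.subset_span ⟨s, hs, t, ht, rfl⟩))⟩

theorem genS_succ_le {k : ℕ} {P : Submodule F D}
    (h : ∀ i j, i + j = k → ∀ s ∈ genS ml mr i, ∀ t ∈ genS ml mr j, ml s t ∈ P ∧ mr s t ∈ P) :
    genS ml mr (k + 1) ≤ P := by
  rw [genS]
  refine Finset.sup_le fun i _ => ?_
  have hi : i.1 + (k - i.1) = k := by
    have := Finset.mem_range.mp i.2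
    omega
  refine sup_le (Submodule.span_le.mpr ?_) (Submodule.span_le.mpr ?_)
  · rintro _ ⟨s, hs, t, ht, rfl⟩
    exact (h _ _ hi s hs t ht).1
  · rintro _ ⟨s, hs, t, ht, rfl⟩
    exact (h _ _ hi s hs t ht).2

/-- A filtration that drops a step under every multiplication by a single element contains
the terms of the general lower central series of exponentially large index. -/
theorem genS_le_of_two_pow_le {P : ℕ → Submodule F D} (h0 : P 0 = ⊤)
    (hP : ∀ k, ∀ p ∈ P k, ∀ x, ml x p ∈ P (k + 1) ∧ mr x p ∈ P (k + 1) ∧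
      ml p x ∈ P (k + 1) ∧ mr p x ∈ P (k + 1))
    (k n : ℕ) (hn : 2 ^ k ≤ n + 1) : genS ml mr n ≤ P k := by
  induction k generalizing n with
  | zero => simp [h0]
  | succ k ih =>
    have hpos := Nat.two_pow_pos k
    rw [pow_succ] at hn
    obtain ⟨n, rfl⟩ : ∃ l, n = l + 1 := ⟨n - 1, by omega⟩
    refine genS_succ_le fun i j hij s hs t ht => ?_
    rcases (by omega : 2 ^ k ≤ i + 1 ∨ 2 ^ k ≤ j + 1) with h | h
    · exact (hP k s (ih i h hs) t).2.2
    · exact ⟨(hP k t (ih j h ht) s).1, (hP k t (ih j h ht) s).2.1⟩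

end GenS

section Action

variable {A L B : Type*} [AddCommGroup A] [Module F A] [AddCommGroup L] [Module F L]
  [AddCommGroup B] [Module F B]

/-- `N` is a descending filtration of `A`, starting at `A`, that drops a step under every
multiplication by an element of `L`, where `A` is regarded as a subspace of `L` via `σ`. -/
def IsActionFiltration (ml mr : L →ₗ[F] L →ₗ[F] L) (σ : A →ₗ[F] L)
    (N : ℕ → Submodule F A) : Prop :=
  N 0 = ⊤ ∧ ∀ k, ∀ m ∈ N k, ∀ (x : L) (a : A),
    (σ a = ml x (σ m) ∨ σ a = mr x (σ m) ∨ σ a = ml (σ m) x ∨ σ a = mr (σ m) x) → a ∈ N (k + 1)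

theorem isActionFiltration_comap_genS (ml mr : L →ₗ[F] L →ₗ[F] L) (σ : A →ₗ[F] L) :
    IsActionFiltration ml mr σ fun k => (genS ml mr k).comap σ := by
  refine ⟨by simp [genS], fun k m hm x a ha => ?_⟩
  have hx : x ∈ genS ml mr 0 := by simp [genS]
  have hl := mul_mem_genS hx hm
  have hr := mul_mem_genS hm hx
  rw [zero_add] at hl
  rw [add_zero] at hr
  rw [Submodule.mem_comap]
  rcases ha with ha | ha | ha | ha <;> rw [ha]
  exacts [hl.1, hl.2, hr.1, hr.2]

theorem IsActionFiltration.exists_genS_eq_bot {ml mr : L →ₗ[F] L →ₗ[F] L}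
    {mlB mrB : B →ₗ[F] B →ₗ[F] B} {σ : A →ₗ[F] L} {π : L →ₗ[F] B}
    (hπl : ∀ x y, π (ml x y) = mlB (π x) (π y)) (hπr : ∀ x y, π (mr x y) = mrB (π x) (π y))
    (hexact : LinearMap.range σ = LinearMap.ker π)
    {N : ℕ → Submodule F A} (hN : IsActionFiltration ml mr σ N) {u : ℕ} (hu : N u = ⊥)
    {v : ℕ} (hv : genS mlB mrB v = ⊥) : ∃ w, genS ml mr w = ⊥ := by
  set P : ℕ → Submodule F L := fun k =>
    if k < v then (genS mlB mrB k).comap π else (N (k - v)).map σ with hP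
  have hPv : (genS mlB mrB v).comap π = P v := by
    simp [hP, hv, hN.1, hexact]
  have hPle {k : ℕ} (hk : k ≤ v) : P k = (genS mlB mrB k).comap π := by
    rcases hk.lt_or_eq with hk | rfl
    · simp [hP, hk]
    · exact hPv.symm
  have hle : genS ml mr (2 ^ (v + u)) ≤ P (v + u) := by
    refine genS_le_of_two_pow_le ?_ ?_ _ _ (Nat.le_succ _)
    · simp [hPle, genS]
    · intro k p hp x
      rcases lt_or_ge k v with hk | hk
      · rw [hPle hk.le] at hp
        rw [hPle hk]
        have hx : π x ∈ genS mlB mrB 0 := by simp [genS]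
        have hl := mul_mem_genS hx hp
        have hr := mul_mem_genS hp hx
        rw [zero_add] at hl
        rw [add_zero] at hr
        simp only [Submodule.mem_comap, hπl, hπr]
        exact ⟨hl.1, hl.2, hr⟩
      · simp only [hP, hk.not_gt, (Nat.le_succ_of_le hk).not_gt, if_false,
          Nat.succ_sub hk, Nat.succ_eq_add_one] at hp ⊢
        obtain ⟨m, hm, rfl⟩ := hp
        have hm0 : π (σ m) = 0 := by
          rw [← LinearMap.mem_ker, ← hexact]
          exact ⟨m, rfl⟩
        have key (z : L) (hz : z = ml x (σ m) ∨ z = mr x (σ m) ∨ z = ml (σ m) x ∨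
            z = mr (σ m) x) : z ∈ (N (k - v + 1)).map σ := by
          have hz0 : z ∈ LinearMap.ker π := by
            rcases hz with rfl | rfl | rfl | rfl <;> simp [hπl, hπr, hm0]
          rw [← hexact] at hz0
          obtain ⟨a, rfl⟩ := hz0
          exact ⟨a, hN.2 _ m hm x a hz, rfl⟩
        exact ⟨key _ (by simp), key _ (by simp), key _ (by simp), key _ (by simp)⟩
  refine ⟨2 ^ (v + u), eq_bot_iff.mpr (hle.trans ?_)⟩
  simp [hP, hu]

end Action

section Lift

variable {A L₁ L₂ B : Type*} [AddCommGroup A] [Module F A] [AddCommGroup L₁] [Module F L₁]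
  [AddCommGroup L₂] [Module F L₂] [AddCommGroup B] [Module F B]

/-- If the actions of two extensions on `A` agree up to multiplications by elements of `A`, then
every multiplication on `A` by an element of the second is one by an element of the first. -/
theorem exists_map_eq_mul {mulA : A →ₗ[F] A →ₗ[F] A} {mul₁ : L₁ →ₗ[F] L₁ →ₗ[F] L₁}
    {mul₂ : L₂ →ₗ[F] L₂ →ₗ[F] L₂} {σ₁ : A →ₗ[F] L₁} {T₁ : B →ₗ[F] L₁}
    {σ₂ : A →ₗ[F] L₂} {π₂ : L₂ →ₗ[F] B} {T₂ : B →ₗ[F] L₂}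
    (hσ₁ : ∀ x y, σ₁ (mulA x y) = mul₁ (σ₁ x) (σ₁ y))
    (hσ₂ : ∀ x y, σ₂ (mulA x y) = mul₂ (σ₂ x) (σ₂ y)) (hσ₂inj : Function.Injective σ₂)
    (hexact₂ : LinearMap.range σ₂ = LinearMap.ker π₂) (hT₂ : ∀ b, π₂ (T₂ b) = b)
    {φ₁ φ₂ : B → Module.End F A} (hφ₁ : ∀ i m, σ₁ (φ₁ i m) = mul₁ (T₁ i) (σ₁ m))
    (hφ₂ : ∀ i m, σ₂ (φ₂ i m) = mul₂ (T₂ i) (σ₂ m))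
    (hlift : ∀ i, ∃ n, ∀ a, φ₂ i a = φ₁ i a + mulA n a) (x : L₂) (m a : A)
    (ha : σ₂ a = mul₂ x (σ₂ m)) : ∃ y, σ₁ a = mul₁ y (σ₁ m) := by
  obtain ⟨n, hn⟩ : x - T₂ (π₂ x) ∈ LinearMap.range σ₂ := by
    rw [hexact₂, LinearMap.mem_ker, map_sub, hT₂, sub_self]
  obtain ⟨n', hn'⟩ := hlift (π₂ x)
  have hx : x = T₂ (π₂ x) + σ₂ n := by rw [hn]; abel
  have haφ : a = φ₂ (π₂ x) m + mulA n m := by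
    apply hσ₂inj
    rw [ha, map_add, hφ₂, hσ₂, ← LinearMap.add_apply, ← map_add, ← hx]
  refine ⟨T₁ (π₂ x) + σ₁ (n' + n), ?_⟩
  rw [haφ, hn']
  simp only [map_add, LinearMap.add_apply, hφ₁, hσ₁]
  abel

theorem IsActionFiltration.of_exists {ml₁ mr₁ : L₁ →ₗ[F] L₁ →ₗ[F] L₁}
    {ml₂ mr₂ : L₂ →ₗ[F] L₂ →ₗ[F] L₂} {σ₁ : A →ₗ[F] L₁} {σ₂ : A →ₗ[F] L₂}
    {N : ℕ → Submodule F A} (hN : IsActionFiltration ml₁ mr₁ σ₁ N)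
    (hl : ∀ x m a, σ₂ a = ml₂ x (σ₂ m) → ∃ y, σ₁ a = ml₁ y (σ₁ m))
    (hr : ∀ x m a, σ₂ a = mr₂ x (σ₂ m) → ∃ y, σ₁ a = mr₁ y (σ₁ m))
    (hl' : ∀ x m a, σ₂ a = ml₂.flip x (σ₂ m) → ∃ y, σ₁ a = ml₁.flip y (σ₁ m))
    (hr' : ∀ x m a, σ₂ a = mr₂.flip x (σ₂ m) → ∃ y, σ₁ a = mr₁.flip y (σ₁ m)) :
    IsActionFiltration ml₂ mr₂ σ₂ N := by
  refine ⟨hN.1, fun k m hm x a ha => ?_⟩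
  rcases ha with ha | ha | ha | ha
  · obtain ⟨y, hy⟩ := hl x m a ha
    exact hN.2 k m hm y a (.inl hy)
  · obtain ⟨y, hy⟩ := hr x m a ha
    exact hN.2 k m hm y a (.inr (.inl hy))
  · obtain ⟨y, hy⟩ := hl' x m a ha
    exact hN.2 k m hm y a (.inr (.inr (.inl hy)))
  · obtain ⟨y, hy⟩ := hr' x m a ha
    exact hN.2 k m hm y a (.inr (.inr (.inr hy)))

end Lift

theorem nilpotent_iff_nilpotent {A L₁ L₂ B : Type*}
    [AddCommGroup A] [Module F A] [AddCommGroup L₁] [Module F L₁]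
    [AddCommGroup L₂] [Module F L₂] [AddCommGroup B] [Module F B]
    (mlA mrA : A →ₗ[F] A →ₗ[F] A) (mlL₁ mrL₁ : L₁ →ₗ[F] L₁ →ₗ[F] L₁)
    (mlL₂ mrL₂ : L₂ →ₗ[F] L₂ →ₗ[F] L₂) (mlB mrB : B →ₗ[F] B →ₗ[F] B)
    -- the algebras are dendriform algebras
    (hA : IsDend mlA mrA) (hL₁ : IsDend mlL₁ mrL₁)
    (hL₂ : IsDend mlL₂ mrL₂) (hB : IsDend mlB mrB)
    -- `A` and `B` are nilpotent
    (hAnil : ∃ u, genS mlA mrA u = ⊥) (hBnil : ∃ u, genS mlB mrB u = ⊥)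
    -- `0 → A --σ₁--> L₁ --π₁--> B → 0` is an extension of `A` by `B` with section `T₁`
    (σ₁ : A →ₗ[F] L₁) (π₁ : L₁ →ₗ[F] B)
    (hσ₁l : ∀ x y, σ₁ (mlA x y) = mlL₁ (σ₁ x) (σ₁ y))
    (hσ₁r : ∀ x y, σ₁ (mrA x y) = mrL₁ (σ₁ x) (σ₁ y))
    (hπ₁l : ∀ x y, π₁ (mlL₁ x y) = mlB (π₁ x) (π₁ y))
    (hπ₁r : ∀ x y, π₁ (mrL₁ x y) = mrB (π₁ x) (π₁ y))
    (hσ₁inj : Function.Injective σ₁) (hπ₁surj : Function.Surjective π₁)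
    (hexact₁ : LinearMap.range σ₁ = LinearMap.ker π₁)
    (T₁ : B →ₗ[F] L₁) (hT₁ : ∀ b, π₁ (T₁ b) = b)
    -- `0 → A --σ₂--> L₂ --π₂--> B → 0` is an extension of `A` by `B` with section `T₂`
    (σ₂ : A →ₗ[F] L₂) (π₂ : L₂ →ₗ[F] B)
    (hσ₂l : ∀ x y, σ₂ (mlA x y) = mlL₂ (σ₂ x) (σ₂ y))
    (hσ₂r : ∀ x y, σ₂ (mrA x y) = mrL₂ (σ₂ x) (σ₂ y))
    (hπ₂l : ∀ x y, π₂ (mlL₂ x y) = mlB (π₂ x) (π₂ y))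
    (hπ₂r : ∀ x y, π₂ (mrL₂ x y) = mrB (π₂ x) (π₂ y))
    (hσ₂inj : Function.Injective σ₂) (hπ₂surj : Function.Surjective π₂)
    (hexact₂ : LinearMap.range σ₂ = LinearMap.ker π₂)
    (T₂ : B →ₗ[F] L₂) (hT₂ : ∀ b, π₂ (T₂ b) = b)
    -- `φ_{j,*}(i)m = σⱼ⁻¹(Tⱼ(i)*σⱼ(m))` and `φ'_{j,*}(i)m = σⱼ⁻¹(σⱼ(m)*Tⱼ(i))`
    (φ₁l φ₁r φ₁l' φ₁r' φ₂l φ₂r φ₂l' φ₂r' : B → Module.End F A)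
    (hφ₁l : ∀ i m, σ₁ (φ₁l i m) = mlL₁ (T₁ i) (σ₁ m))
    (hφ₁r : ∀ i m, σ₁ (φ₁r i m) = mrL₁ (T₁ i) (σ₁ m))
    (hφ₁l' : ∀ i m, σ₁ (φ₁l' i m) = mlL₁ (σ₁ m) (T₁ i))
    (hφ₁r' : ∀ i m, σ₁ (φ₁r' i m) = mrL₁ (σ₁ m) (T₁ i))
    (hφ₂l : ∀ i m, σ₂ (φ₂l i m) = mlL₂ (T₂ i) (σ₂ m))
    (hφ₂r : ∀ i m, σ₂ (φ₂r i m) = mrL₂ (T₂ i) (σ₂ m))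
    (hφ₂l' : ∀ i m, σ₂ (φ₂l' i m) = mlL₂ (σ₂ m) (T₂ i))
    (hφ₂r' : ∀ i m, σ₂ (φ₂r' i m) = mrL₂ (σ₂ m) (T₂ i))
    -- the two extensions correspond to lifts of the same tuple
    (hlift : ∀ i : B, ∃ ml' mr' nl' nr' : A, ∀ a : A,
      φ₂l i a = φ₁l i a + mlA ml' a ∧ φ₂r i a = φ₁r i a + mrA mr' a ∧
      φ₂l' i a = φ₁l' i a + mlA a nl' ∧ φ₂r' i a = φ₁r' i a + mrA a nr') :
    (∃ u, genS mlL₁ mrL₁ u = ⊥) ↔ (∃ u, genS mlL₂ mrL₂ u = ⊥) := by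
  choose pl pr pl' pr' hp using hlift
  obtain ⟨v, hv⟩ := hBnil
  constructor
  · rintro ⟨u, hu⟩
    refine IsActionFiltration.exists_genS_eq_bot hπ₂l hπ₂r hexact₂
      ((isActionFiltration_comap_genS mlL₁ mrL₁ σ₁).of_exists ?_ ?_ ?_ ?_) (u := u)
      (by simp [hu, LinearMap.ker_eq_bot.mpr hσ₁inj]) hv
    · exact exists_map_eq_mul hσ₁l hσ₂l hσ₂inj hexact₂ hT₂ hφ₁l hφ₂l
        fun i => ⟨pl i, fun a => (hp i a).1⟩
    · exact exists_map_eq_mul hσ₁r hσ₂r hσ₂inj hexact₂ hT₂ hφ₁r hφ₂r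
        fun i => ⟨pr i, fun a => (hp i a).2.1⟩
    · exact exists_map_eq_mul (mulA := mlA.flip) (fun x y => hσ₁l y x) (fun x y => hσ₂l y x)
        hσ₂inj hexact₂ hT₂ hφ₁l' hφ₂l' fun i => ⟨pl' i, fun a => (hp i a).2.2.1⟩
    · exact exists_map_eq_mul (mulA := mrA.flip) (fun x y => hσ₁r y x) (fun x y => hσ₂r y x)
        hσ₂inj hexact₂ hT₂ hφ₁r' hφ₂r' fun i => ⟨pr' i, fun a => (hp i a).2.2.2⟩
  · rintro ⟨u, hu⟩
    refine IsActionFiltration.exists_genS_eq_bot hπ₁l hπ₁r hexact₁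
      ((isActionFiltration_comap_genS mlL₂ mrL₂ σ₂).of_exists ?_ ?_ ?_ ?_) (u := u)
      (by simp [hu, LinearMap.ker_eq_bot.mpr hσ₂inj]) hv
    · exact exists_map_eq_mul hσ₂l hσ₁l hσ₁inj hexact₁ hT₁ hφ₂l hφ₁l
        fun i => ⟨-pl i, fun a => by simp [(hp i a).1]⟩
    · exact exists_map_eq_mul hσ₂r hσ₁r hσ₁inj hexact₁ hT₁ hφ₂r hφ₁r
        fun i => ⟨-pr i, fun a => by simp [(hp i a).2.1]⟩
    · exact exists_map_eq_mul (mulA := mlA.flip) (fun x y => hσ₂l y x) (fun x y => hσ₁l y x)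
        hσ₁inj hexact₁ hT₁ hφ₂l' hφ₁l' fun i => ⟨-pl' i, fun a => by simp [(hp i a).2.2.1]⟩
    · exact exists_map_eq_mul (mulA := mrA.flip) (fun x y => hσ₂r y x) (fun x y => hσ₁r y x)
        hσ₁inj hexact₁ hT₁ hφ₂r' hφ₁r' fun i => ⟨-pr' i, fun a => by simp [(hp i a).2.2.2]⟩

end Stmt18
end
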